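/- There is N ∈ ℕ such that the following holds. Let G be a finite abelian group (written additively) of order n ≥ N with ∑_{g∈G} g = 0, and let k be an integer with k ≥ (log n)^9 and k dividing n − 1. Then there exists a permutation σ of G ∖ {0} all of whose cycles have length exactly k such that the map v ↦ v − σ(v) is a bijection from G ∖ {0} onto G ∖ {0}; equivalently, G admits an orthomorphism fixing 0 and permuting the remaining elements as a product of disjoint cycles of length k. -/

import Mathlib

set_option linter.unusedSectionVars false

section Labelling

open Finset

/-- A mean-zero function with values in `[-c, c]` has a sub-Gaussian exponential sum. -/
theorem sum_exp_le_of_sum_eq_zero {α : Type*} [Fintype α] (f : α → ℝ) (c s : ℝ) (hc : 0 < c)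
    (hf : ∀ x, |f x| ≤ c) (h0 : ∑ x, f x = 0) :
    ∑ x, Real.exp (s * f x) ≤ Fintype.card α * Real.exp (s ^ 2 * c ^ 2 / 2) := by
  have key : ∀ x, Real.exp (s * f x) ≤
      Real.cosh (s * c) + f x * (Real.sinh (s * c) / c) := by
    intro x
    have hx := abs_le.1 (hf x)
    have hconv := (convexOn_exp).2 (Set.mem_univ (s * c)) (Set.mem_univ (-(s * c)))
      (show 0 ≤ (c + f x) / (2 * c) from div_nonneg (by linarith) (by linarith))
      (show 0 ≤ (c - f x) / (2 * c) from div_nonneg (by linarith) (by linarith))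
      (by field_simp; ring)
    have e1 : ((c + f x) / (2 * c)) • (s * c) + ((c - f x) / (2 * c)) • (-(s * c)) = s * f x := by
      simp only [smul_eq_mul]; field_simp; ring
    rw [e1] at hconv
    refine hconv.trans (le_of_eq ?_)
    rw [Real.cosh_eq, Real.sinh_eq]
    simp only [smul_eq_mul]; field_simp; ring
  calc ∑ x, Real.exp (s * f x) ≤ ∑ x, (Real.cosh (s * c) + f x * (Real.sinh (s * c) / c)) :=
        sum_le_sum fun x _ => key x
    _ = Fintype.card α * Real.cosh (s * c) := by
        rw [sum_add_distrib, ← sum_mul, h0]; simp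
    _ ≤ _ := by
        gcongr
        refine (Real.cosh_le_exp_half_sq _).trans (le_of_eq ?_)
        congr 1; ring

/-- The moment generating function bound behind McDiarmid's inequality. -/
theorem sum_exp_le_of_bounded_differences_fin {α : Type*} [Fintype α] [Nonempty α]
    (s c : ℝ) (hc : 0 < c) (N : ℕ) (f : (Fin N → α) → ℝ)
    (hf : ∀ ω i v, |f ω - f (Function.update ω i v)| ≤ c) :
    ∑ ω, Real.exp (s * (f ω - (∑ ω, f ω) / (Fintype.card α : ℝ) ^ N)) ≤
      (Fintype.card α : ℝ) ^ N * Real.exp (N * (s ^ 2 * c ^ 2 / 2)) := by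
  have ha : (0 : ℝ) < Fintype.card α := by exact_mod_cast Fintype.card_pos
  induction N with
  | zero => simp
  | succ N ih =>
    set a : ℝ := (Fintype.card α : ℝ) with hadef
    let g : α → ℝ := fun x => (∑ ω : Fin N → α, f (Fin.cons x ω)) / a ^ N
    have hsum : ∀ F : (Fin (N + 1) → α) → ℝ, ∑ ω, F ω = ∑ x, ∑ ω : Fin N → α, F (Fin.cons x ω) := by
      intro F
      rw [← (Fin.consEquiv fun _ : Fin (N + 1) => α).sum_comp, Fintype.sum_prod_type]
      rfl
    set A : ℝ := (∑ ω, f ω) / a ^ (N + 1) with hA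
    have hAg : A = (∑ x, g x) / a := by
      simp only [hA, g, hsum f, ← sum_div]
      rw [pow_succ, div_div]
    have hgd : ∀ x y, |g x - g y| ≤ c := by
      intro x y
      simp only [g]
      rw [← sub_div, ← sum_sub_distrib, abs_div, abs_of_pos (pow_pos ha N), div_le_iff₀ (pow_pos ha N)]
      refine (abs_sum_le_sum_abs _ _).trans ?_
      calc _ ≤ ∑ _ω : Fin N → α, c := by
            refine sum_le_sum fun ω _ => ?_
            have := hf (Fin.cons x ω) 0 y
            rwa [Fin.update_cons_zero] at this
        _ = _ := by simp [a, mul_comm]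
    have h1 : ∑ x, Real.exp (s * (g x - A)) ≤ a * Real.exp (s ^ 2 * c ^ 2 / 2) := by
      refine sum_exp_le_of_sum_eq_zero (fun x => g x - A) c s hc (fun x => ?_) ?_
      · have : g x - A = (∑ y, (g x - g y)) / a := by
          rw [hAg, sum_sub_distrib]
          simp only [sum_const, card_univ, nsmul_eq_mul]
          field_simp; try ring
        rw [this, abs_div, abs_of_pos ha, div_le_iff₀ ha]
        refine (abs_sum_le_sum_abs _ _).trans ?_
        calc _ ≤ ∑ _y : α, c := sum_le_sum fun y _ => hgd x y
          _ = _ := by simp [a, mul_comm]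
      · rw [sum_sub_distrib, hAg]
        simp only [sum_const, card_univ, nsmul_eq_mul]
        field_simp; simp only [a]; ring
    rw [hsum]
    calc ∑ x, ∑ ω : Fin N → α, Real.exp (s * (f (Fin.cons x ω) - A))
        = ∑ x, Real.exp (s * (g x - A)) *
            ∑ ω : Fin N → α, Real.exp (s * (f (Fin.cons x ω) - g x)) := by
          refine sum_congr rfl fun x _ => ?_
          rw [mul_sum]
          refine sum_congr rfl fun ω _ => ?_
          rw [← Real.exp_add]; congr 1; ring
      _ ≤ ∑ x, Real.exp (s * (g x - A)) * (a ^ N * Real.exp (N * (s ^ 2 * c ^ 2 / 2))) := by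
          refine sum_le_sum fun x _ => ?_
          gcongr
          refine ih (fun ω => f (Fin.cons x ω)) fun ω i v => ?_
          have := hf (Fin.cons x ω) i.succ v
          rwa [← Fin.cons_update] at this
      _ ≤ _ := by
          rw [← sum_mul]
          calc _ ≤ (a * Real.exp (s ^ 2 * c ^ 2 / 2)) * (a ^ N * Real.exp (N * (s ^ 2 * c ^ 2 / 2))) := by
                gcongr
            _ = a ^ (N + 1) * (Real.exp (s ^ 2 * c ^ 2 / 2) * Real.exp (N * (s ^ 2 * c ^ 2 / 2))) := by ring
            _ = _ := by rw [← Real.exp_add]; congr 2; push_cast; ring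

/-- The average of a function over all labellings. -/
noncomputable def average {Ω α : Type*} [Fintype Ω] [DecidableEq Ω] [Fintype α] (f : (Ω → α) → ℝ) : ℝ :=
  (∑ ω, f ω) / (Fintype.card α : ℝ) ^ Fintype.card Ω

theorem sum_exp_le_of_bounded_differences {Ω α : Type*} [Fintype Ω] [DecidableEq Ω]
    [Fintype α] [Nonempty α] (s c : ℝ) (hc : 0 < c) (f : (Ω → α) → ℝ)
    (hf : ∀ ω i v, |f ω - f (Function.update ω i v)| ≤ c) :
    ∑ ω, Real.exp (s * (f ω - average f)) ≤
      (Fintype.card α : ℝ) ^ Fintype.card Ω * Real.exp (Fintype.card Ω * (s ^ 2 * c ^ 2 / 2)) := by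
  let e := Fintype.equivFin Ω
  have := sum_exp_le_of_bounded_differences_fin (α := α) s c hc (Fintype.card Ω)
    (fun ω => f (ω ∘ e)) (fun ω i v => by
      have h := hf (ω ∘ e) (e.symm i) v
      rwa [show Function.update (ω ∘ e) (e.symm i) v = Function.update ω i v ∘ e from ?_] at h
      ext x; by_cases hx : x = e.symm i
      · subst hx; simp
      · have : e x ≠ i := fun h => hx (by rw [← h]; simp)
        simp [Function.update_of_ne hx, Function.update_of_ne this])
  have hs : ∀ F : (Ω → α) → ℝ, ∑ ω : Fin (Fintype.card Ω) → α, F (ω ∘ e) = ∑ ω, F ω := fun F =>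
    (Equiv.arrowCongr e.symm (Equiv.refl α)).sum_comp F
  rw [hs f, hs (fun w => Real.exp (s * (f w - (∑ ω, f ω) / (Fintype.card α : ℝ) ^ Fintype.card Ω)))] at this
  exact this

/-- **McDiarmid**, counting form. -/
theorem exists_labelling {Ω α ι : Type*} [Fintype Ω] [DecidableEq Ω] [Nonempty Ω] [Fintype α] [Nonempty α]
    [Fintype ι] (X : ι → (Ω → α) → ℝ) (c : ι → ℝ) (hc : ∀ i, 0 < c i)
    (hX : ∀ i ω x v, |X i ω - X i (Function.update ω x v)| ≤ c i) (τ : ℝ) (hτ0 : 0 ≤ τ)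
    (h : 2 * Fintype.card ι * Real.exp (-τ ^ 2 / (2 * Fintype.card Ω)) < 1) :
    ∃ ω, ∀ i, |X i ω - average (X i)| ≤ τ * c i := by
  by_contra! hcon
  have ha : (0 : ℝ) < (Fintype.card α : ℝ) ^ Fintype.card Ω := by
    have : (0 : ℝ) < Fintype.card α := by exact_mod_cast Fintype.card_pos
    positivity
  have hN : (0 : ℝ) < Fintype.card Ω := by exact_mod_cast Fintype.card_pos
  set N : ℝ := (Fintype.card Ω : ℝ)
  let s : ι → ℝ := fun i => τ / (N * c i)
  have hone : ∀ ω, 1 ≤ ∑ i, Real.exp (-τ ^ 2 / N) *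
      (Real.exp (s i * (X i ω - average (X i))) + Real.exp (-s i * (X i ω - average (X i)))) := by
    intro ω
    obtain ⟨i, hi⟩ := hcon ω
    refine le_trans ?_ (single_le_sum (f := fun i => Real.exp (-τ ^ 2 / N) *
      (Real.exp (s i * (X i ω - average (X i))) + Real.exp (-s i * (X i ω - average (X i)))))
      (fun j _ => by positivity) (mem_univ i))
    have hci := hc i
    have hτ : ∀ Y : ℝ, τ * c i ≤ Y → 1 ≤ Real.exp (-τ ^ 2 / N) * Real.exp (τ / (N * c i) * Y) := by
      intro Y hY
      rw [← Real.exp_add]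
      apply Real.one_le_exp
      have : τ / (N * c i) * (τ * c i) ≤ τ / (N * c i) * Y := by gcongr
      have e : τ / (N * c i) * (τ * c i) = τ ^ 2 / N := by field_simp
      rw [e] at this
      rw [neg_div]; linarith
    simp only [s]
    rw [mul_add]
    rcases le_abs'.1 hi.le with h1 | h1
    · refine (hτ (-(X i ω - average (X i))) (by linarith)).trans ?_
      rw [show τ / (N * c i) * -(X i ω - average (X i)) = -(τ / (N * c i)) * (X i ω - average (X i)) by ring]
      exact le_add_of_nonneg_left (by positivity)
    · exact (hτ _ h1).trans (le_add_of_nonneg_right (by positivity))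
  have hsum := sum_le_sum fun ω (_ : ω ∈ (univ : Finset (Ω → α))) => hone ω
  rw [sum_comm] at hsum
  have hb : ∀ i, ∑ ω, Real.exp (-τ ^ 2 / N) *
      (Real.exp (s i * (X i ω - average (X i))) + Real.exp (-s i * (X i ω - average (X i)))) ≤
      2 * Real.exp (-τ ^ 2 / (2 * N)) * (Fintype.card α : ℝ) ^ Fintype.card Ω := by
    intro i
    rw [← mul_sum, sum_add_distrib]
    have h1 := sum_exp_le_of_bounded_differences (s i) (c i) (hc i) (X i) (hX i)
    have h2 := sum_exp_le_of_bounded_differences (-s i) (c i) (hc i) (X i) (hX i)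
    rw [neg_sq] at h2
    have hci := hc i
    have e : (Fintype.card Ω : ℝ) * (s i ^ 2 * c i ^ 2 / 2) = τ ^ 2 / (2 * N) := by
      simp only [s]; simp only [N]; field_simp
    rw [e] at h1 h2
    calc _ ≤ Real.exp (-τ ^ 2 / N) * ((Fintype.card α : ℝ) ^ Fintype.card Ω * Real.exp (τ ^ 2 / (2 * N)) +
          (Fintype.card α : ℝ) ^ Fintype.card Ω * Real.exp (τ ^ 2 / (2 * N))) := by gcongr
      _ = 2 * (Real.exp (-τ ^ 2 / N) * Real.exp (τ ^ 2 / (2 * N))) * (Fintype.card α : ℝ) ^ Fintype.card Ω := by ring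
      _ = _ := by
        rw [← Real.exp_add]; congr 3; field_simp; ring
  have hfin := hsum.trans (sum_le_sum fun i _ => hb i)
  simp only [sum_const, card_univ, Fintype.card_pi, prod_const, nsmul_eq_mul] at hfin
  push_cast at hfin
  rw [mul_one] at hfin
  have : (Fintype.card α : ℝ) ^ Fintype.card Ω < (Fintype.card α : ℝ) ^ Fintype.card Ω :=
    calc _ ≤ _ := hfin
      _ = (2 * Fintype.card ι * Real.exp (-τ ^ 2 / (2 * N))) * (Fintype.card α : ℝ) ^ Fintype.card Ω := by ring
      _ < 1 * (Fintype.card α : ℝ) ^ Fintype.card Ω := by gcongr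
      _ = _ := one_mul _
  exact lt_irrefl _ this

theorem average_card_filter {Ω α κ : Type*} [Fintype Ω] [DecidableEq Ω] [Fintype α] [DecidableEq α]
    [Nonempty α] (T : Finset κ) {h : ℕ} (pos : κ → Fin h → Ω)
    (hpos : ∀ p ∈ T, Function.Injective (pos p)) (A : Fin h → Finset α) :
    average (fun ω : Ω → α => (#{p ∈ T | ∀ i, ω (pos p i) ∈ A i} : ℝ)) =
      #T * ∏ i, ((#(A i) : ℝ) / Fintype.card α) := by
  have ha : (Fintype.card α : ℝ) ≠ 0 := by exact_mod_cast Fintype.card_ne_zero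
  have key : ∀ p ∈ T, (#{ω : Ω → α | ∀ i, ω (pos p i) ∈ A i} : ℝ) =
      (Fintype.card α : ℝ) ^ Fintype.card Ω * ∏ i, ((#(A i) : ℝ) / Fintype.card α) := by
    intro p hp
    let B : Ω → Finset α := fun x => univ.filter fun a => ∀ i, pos p i = x → a ∈ A i
    have e1 : (univ.filter fun ω : Ω → α => ∀ i, ω (pos p i) ∈ A i) = Fintype.piFinset B := by
      ext ω
      simp only [mem_filter, mem_univ, true_and, Fintype.mem_piFinset, B]
      exact ⟨fun h x i hi => hi ▸ h i, fun h i => h _ i rfl⟩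
    have e2 : ∏ x, ((#(B x) : ℝ) / Fintype.card α) = ∏ i, ((#(A i) : ℝ) / Fintype.card α) := by
      rw [← prod_subset (subset_univ (univ.image (pos p))), prod_image (fun i _ j _ hij => hpos p hp hij)]
      · refine prod_congr rfl fun i _ => ?_
        congr 3
        ext a
        simp only [mem_filter, mem_univ, true_and, B]
        exact ⟨fun h => h i rfl, fun h j hj => hpos p hp hj ▸ h⟩
      · intro x _ hx
        have : B x = univ := by
          ext a
          simp only [mem_filter, mem_univ, true_and, B, iff_true]
          intro i hi
          exact absurd (mem_image.2 ⟨i, mem_univ _, hi⟩) hx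
        rw [this, card_univ, div_self ha]
    rw [e1, Fintype.card_piFinset, ← e2, prod_div_distrib]
    rw [prod_const, card_univ, mul_div_cancel₀ _ (pow_ne_zero _ ha), Nat.cast_prod]
  unfold average
  have : ∑ ω : Ω → α, (#{p ∈ T | ∀ i, ω (pos p i) ∈ A i} : ℝ) =
      ∑ p ∈ T, (#{ω : Ω → α | ∀ i, ω (pos p i) ∈ A i} : ℝ) := by
    have h := sum_card_bipartiteAbove_eq_sum_card_bipartiteBelow (s := (univ : Finset (Ω → α))) (t := T)
      (fun ω p => ∀ i, ω (pos p i) ∈ A i)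
    exact_mod_cast h
  rw [this, sum_congr rfl key, sum_const, nsmul_eq_mul, mul_left_comm, mul_div_cancel_left₀]
  exact pow_ne_zero _ ha

/-- Relabelling one point changes a pattern count by at most the number of patterns through it. -/
theorem abs_card_filter_sub_update_le {Ω α κ : Type*} [DecidableEq Ω] [DecidableEq α]
    (T : Finset κ) {h : ℕ} (pos : κ → Fin h → Ω) (A : Fin h → Finset α) (c : ℝ)
    (hc : ∀ x, (#{p ∈ T | ∃ i, pos p i = x} : ℝ) ≤ c) (ω : Ω → α) (x : Ω) (v : α) :
    |(#{p ∈ T | ∀ i, ω (pos p i) ∈ A i} : ℝ) -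
      #{p ∈ T | ∀ i, Function.update ω x v (pos p i) ∈ A i}| ≤ c := by
  classical
  have aux : ∀ ω₁ ω₂ : Ω → α, (∀ y, y ≠ x → ω₁ y = ω₂ y) →
      (#{p ∈ T | ∀ i, ω₁ (pos p i) ∈ A i} : ℝ) ≤ #{p ∈ T | ∀ i, ω₂ (pos p i) ∈ A i} + c := by
    intro ω₁ ω₂ h12
    have : #{p ∈ T | ∀ i, ω₁ (pos p i) ∈ A i} ≤
        #{p ∈ T | ∀ i, ω₂ (pos p i) ∈ A i} + #{p ∈ T | ∃ i, pos p i = x} := by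
      refine (card_le_card ?_).trans (card_union_le _ _)
      intro p
      simp only [mem_filter, mem_union]
      rintro ⟨hp, hA⟩
      by_cases hx : ∃ i, pos p i = x
      · exact Or.inr ⟨hp, hx⟩
      · refine Or.inl ⟨hp, fun i => ?_⟩
        rw [← h12 _ fun h => hx ⟨i, h⟩]
        exact hA i
    have h2 : (#{p ∈ T | ∀ i, ω₁ (pos p i) ∈ A i} : ℝ) ≤
        #{p ∈ T | ∀ i, ω₂ (pos p i) ∈ A i} + #{p ∈ T | ∃ i, pos p i = x} := by exact_mod_cast this
    linarith [hc x]
  have hne : ∀ y, y ≠ x → ω y = Function.update ω x v y := fun y hy => by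
    rw [Function.update_of_ne hy]
  rw [abs_le]
  constructor <;> linarith [aux _ _ hne, aux _ _ fun y hy => (hne y hy).symm]

end Labelling

section Matching

open Finset

variable {G : Type} [AddCommGroup G] [DecidableEq G]

/-- A matching from `A` to `B` whose differences are distinct elements of `C`. -/
structure IsRainbowMatching (A B C : Finset G) (M : Finset (G × G)) : Prop where
  fst_mem : ∀ p ∈ M, p.1 ∈ A
  snd_mem : ∀ p ∈ M, p.2 ∈ B
  sub_mem : ∀ p ∈ M, p.2 - p.1 ∈ C
  fst_inj : ∀ p ∈ M, ∀ q ∈ M, p.1 = q.1 → p = q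
  snd_inj : ∀ p ∈ M, ∀ q ∈ M, p.2 = q.2 → p = q
  sub_inj : ∀ p ∈ M, ∀ q ∈ M, p.2 - p.1 = q.2 - q.1 → p = q

namespace IsRainbowMatching

variable {A B C : Finset G} {M : Finset (G × G)}

theorem card_fst (h : IsRainbowMatching A B C M) : #(M.image Prod.fst) = #M :=
  card_image_of_injOn fun p hp q hq => h.fst_inj p hp q hq

theorem card_sub (h : IsRainbowMatching A B C M) : #(M.image fun p => p.2 - p.1) = #M :=
  card_image_of_injOn fun p hp q hq => h.sub_inj p hp q hq

theorem card_le (h : IsRainbowMatching A B C M) : #M ≤ #A := by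
  rw [← h.card_fst]
  exact card_le_card (image_subset_iff.2 h.fst_mem)

theorem erase (h : IsRainbowMatching A B C M) (p : G × G) : IsRainbowMatching A B C (M.erase p) where
  fst_mem q hq := h.fst_mem q (mem_of_mem_erase hq)
  snd_mem q hq := h.snd_mem q (mem_of_mem_erase hq)
  sub_mem q hq := h.sub_mem q (mem_of_mem_erase hq)
  fst_inj q hq q' hq' := h.fst_inj q (mem_of_mem_erase hq) q' (mem_of_mem_erase hq')
  snd_inj q hq q' hq' := h.snd_inj q (mem_of_mem_erase hq) q' (mem_of_mem_erase hq')
  sub_inj q hq q' hq' := h.sub_inj q (mem_of_mem_erase hq) q' (mem_of_mem_erase hq')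

theorem insert (h : IsRainbowMatching A B C M) {a b : G} (ha : a ∈ A) (hb : b ∈ B) (hc : b - a ∈ C)
    (ha' : ∀ p ∈ M, p.1 ≠ a) (hb' : ∀ p ∈ M, p.2 ≠ b) (hc' : ∀ p ∈ M, p.2 - p.1 ≠ b - a) :
    IsRainbowMatching A B C (insert (a, b) M) where
  fst_mem q hq := by rcases mem_insert.1 hq with rfl | hq; exacts [ha, h.fst_mem q hq]
  snd_mem q hq := by rcases mem_insert.1 hq with rfl | hq; exacts [hb, h.snd_mem q hq]
  sub_mem q hq := by rcases mem_insert.1 hq with rfl | hq; exacts [hc, h.sub_mem q hq]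
  fst_inj q hq q' hq' e := by
    rcases mem_insert.1 hq with rfl | hq <;> rcases mem_insert.1 hq' with rfl | hq'
    exacts [rfl, absurd e.symm (ha' _ hq'), absurd e (ha' _ hq), h.fst_inj q hq q' hq' e]
  snd_inj q hq q' hq' e := by
    rcases mem_insert.1 hq with rfl | hq <;> rcases mem_insert.1 hq' with rfl | hq'
    exacts [rfl, absurd e.symm (hb' _ hq'), absurd e (hb' _ hq), h.snd_inj q hq q' hq' e]
  sub_inj q hq q' hq' e := by
    rcases mem_insert.1 hq with rfl | hq <;> rcases mem_insert.1 hq' with rfl | hq'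
    exacts [rfl, absurd e.symm (hc' _ hq'), absurd e (hc' _ hq), h.sub_inj q hq q' hq' e]

end IsRainbowMatching

/-- An expansion property forces a nearly perfect rainbow matching. -/
theorem exists_rainbowMatching (A B C : Finset G) (d e K : ℕ) (hK : #A < d + K * (d - e)) (he : e ≤ d)
    (hexp : ∀ S ⊆ A, d ≤ #S → ∀ C₀ ⊆ C, #C ≤ #C₀ + #A → ∀ Forb : G → Finset G,
      (∀ a, #(Forb a) ≤ 2 * K) →
      #S ≤ e + #{b ∈ B | ∃ a ∈ S, b - a ∈ C₀ ∧ b ∉ Forb a}) :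
    ∃ M, IsRainbowMatching A B C M ∧ #A < #M + d := by
  classical
  let Ms : Finset (Finset (G × G)) := (A ×ˢ B).powerset.filter fun M => IsRainbowMatching A B C M
  have hMs : ∀ M, IsRainbowMatching A B C M → M ∈ Ms := fun M hM =>
    mem_filter.2 ⟨mem_powerset.2 fun p hp => mem_product.2 ⟨hM.fst_mem p hp, hM.snd_mem p hp⟩, hM⟩
  have hempty : IsRainbowMatching A B C ∅ := by constructor <;> simp
  obtain ⟨M, hM, hmax⟩ := exists_max_image Ms card ⟨∅, hMs _ hempty⟩
  replace hM := (mem_filter.1 hM).2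
  refine ⟨M, hM, ?_⟩
  by_contra! hlt
  let C₀ := C \ M.image fun p => p.2 - p.1
  have hC₀ : #C ≤ #C₀ + #A := by
    have h1 := le_card_sdiff (M.image fun p => p.2 - p.1) C
    rw [hM.card_sub] at h1
    have h2 : #C - #M ≤ #C₀ := h1
    have := hM.card_le
    omega
  let Q : ℕ → G → Finset (G × G) → Prop := fun i a M' =>
    IsRainbowMatching A B C M' ∧ #M' = #M ∧ (∀ p ∈ M', p.1 ≠ a) ∧
      (∀ p ∈ M', ∃ q ∈ M, q.2 = p.2) ∧ (∀ p ∈ M, ∃ q ∈ M', q.2 = p.2) ∧ #(M' \ M) ≤ i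
  let R : ℕ → Finset G := fun i => A.filter fun a => ∃ M', Q i a M'
  have hR0 : ∀ i, A \ M.image Prod.fst ⊆ R i := by
    intro i a ha
    rw [mem_sdiff, mem_image] at ha
    exact mem_filter.2 ⟨ha.1, M, hM, rfl, fun p hp h => ha.2 ⟨p, hp, h⟩,
      fun p hp => ⟨p, hp, rfl⟩, fun p hp => ⟨p, hp, rfl⟩, by simp⟩
  have hcard0 : d ≤ #(A \ M.image Prod.fst) := by
    rw [card_sdiff_of_subset (image_subset_iff.2 hM.fst_mem), hM.card_fst]; omega
  have hstep : ∀ i < K, #(R i) + (d - e) ≤ #(R (i + 1)) := by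
    intro i hi
    have hch : ∀ a, ∃ M', a ∈ R i → Q i a M' := by
      intro a
      by_cases ha : a ∈ R i
      · obtain ⟨M', h⟩ := (mem_filter.1 ha).2
        exact ⟨M', fun _ => h⟩
      · exact ⟨∅, fun h => absurd h ha⟩
    choose M' hM' using hch
    let Forb : G → Finset G := fun a => if a ∈ R i then
      ((M' a \ M).image fun p => a + (p.2 - p.1)) ∪ (M' a \ M).image Prod.snd else ∅
    have hForb : ∀ a, #(Forb a) ≤ 2 * K := by
      intro a
      by_cases ha : a ∈ R i
      · simp only [Forb, if_pos ha]
        have h := (hM' a ha).2.2.2.2.2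
        refine (card_union_le _ _).trans ?_
        have h1 := card_image_le (s := M' a \ M) (f := fun p => a + (p.2 - p.1))
        have h2 := card_image_le (s := M' a \ M) (f := Prod.snd)
        omega
      · simp [Forb, ha]
    have hx := hexp (R i) (filter_subset _ _) (hcard0.trans (card_le_card (hR0 i))) C₀ sdiff_subset hC₀ Forb hForb
    set N := {b ∈ B | ∃ a ∈ R i, b - a ∈ C₀ ∧ b ∉ Forb a} with hN
    have hNM : ∀ b ∈ N, ∃ q ∈ M, q.2 = b ∧ q.1 ∈ R (i + 1) := by
      intro b hb
      obtain ⟨hbB, a, haR, hc, hf⟩ := mem_filter.1 hb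
      obtain ⟨h1, h2, h3, h4, h5, h6⟩ := hM' a haR
      have haA := (mem_filter.1 haR).1
      simp only [Forb, if_pos haR, mem_union, not_or, mem_image, not_exists, not_and] at hf
      have hcC := mem_sdiff.1 hc
      have hcol : ∀ p ∈ M' a, p.2 - p.1 ≠ b - a := by
        intro p hp hpe
        by_cases hpM : p ∈ M
        · exact hcC.2 (mem_image.2 ⟨p, hpM, hpe⟩)
        · refine hf.1 p (mem_sdiff.2 ⟨hp, hpM⟩) ?_
          rw [hpe]; abel
      by_cases hbM : ∃ q ∈ M' a, q.2 = b
      · obtain ⟨q, hq, rfl⟩ := hbM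
        have hqM : q ∈ M := by
          by_contra hqM
          exact hf.2 q (mem_sdiff.2 ⟨hq, hqM⟩) rfl
        refine ⟨q, hqM, rfl, mem_filter.2 ⟨hM.fst_mem q hqM, insert (a, q.2) ((M' a).erase q), ?_⟩⟩
        have hnot : (a, q.2) ∉ (M' a).erase q := fun h => h3 _ (mem_of_mem_erase h) rfl
        refine ⟨(h1.erase q).insert haA hbB hcC.1 (fun p hp => h3 p (mem_of_mem_erase hp))
          (fun p hp hpe => (ne_of_mem_erase hp) (h1.snd_inj p (mem_of_mem_erase hp) q hq hpe))
          (fun p hp => hcol p (mem_of_mem_erase hp)), ?_, ?_, ?_, ?_, ?_⟩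
        · rw [card_insert_of_notMem hnot, card_erase_add_one hq, h2]
        · intro p hp
          rcases mem_insert.1 hp with rfl | hp
          · exact fun h => h3 q hq h.symm
          · exact fun h => (ne_of_mem_erase hp) (h1.fst_inj p (mem_of_mem_erase hp) q hq h)
        · intro p hp
          rcases mem_insert.1 hp with rfl | hp
          · exact ⟨q, hqM, rfl⟩
          · exact h4 p (mem_of_mem_erase hp)
        · intro p hp
          obtain ⟨q', hq', he'⟩ := h5 p hp
          by_cases hqq : q' = q
          · exact ⟨(a, q.2), mem_insert_self _ _, by rw [← he', hqq]⟩
          · exact ⟨q', mem_insert_of_mem (mem_erase.2 ⟨hqq, hq'⟩), he'⟩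
        · calc #(insert (a, q.2) ((M' a).erase q) \ M) ≤ #(insert (a, q.2) (M' a \ M)) := by
                refine card_le_card fun p hp => ?_
                obtain ⟨hp1, hp2⟩ := mem_sdiff.1 hp
                rcases mem_insert.1 hp1 with rfl | hp1
                · exact mem_insert_self _ _
                · exact mem_insert_of_mem (mem_sdiff.2 ⟨mem_of_mem_erase hp1, hp2⟩)
            _ ≤ #(M' a \ M) + 1 := card_insert_le _ _
            _ ≤ i + 1 := by omega
      · exfalso
        push Not at hbM
        have hbig := h1.insert haA hbB hcC.1 h3 hbM hcol
        have := hmax _ (hMs _ hbig)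
        rw [card_insert_of_notMem (fun h => h3 _ h rfl), h2] at this
        omega
    choose! f hf1 hf2 hf3 using hNM
    have hcardN : #(N.image fun b => (f b).1) = #N :=
      card_image_of_injOn fun b hb b' hb' hbb => by
        have := hM.fst_inj _ (hf1 b hb) _ (hf1 b' hb') hbb
        rw [← hf2 b hb, ← hf2 b' hb', this]
    have hdisj : Disjoint (N.image fun b => (f b).1) (A \ M.image Prod.fst) := by
      rw [disjoint_left]
      intro a ha ha'
      obtain ⟨b, hb, rfl⟩ := mem_image.1 ha
      exact (mem_sdiff.1 ha').2 (mem_image.2 ⟨f b, hf1 b hb, rfl⟩)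
    have hsub : (N.image fun b => (f b).1) ∪ (A \ M.image Prod.fst) ⊆ R (i + 1) :=
      union_subset (image_subset_iff.2 hf3) (hR0 _)
    have := card_le_card hsub
    rw [card_union_of_disjoint hdisj, hcardN] at this
    omega
  have hind : ∀ i ≤ K, d + i * (d - e) ≤ #(R i) := by
    intro i
    induction i with
    | zero => intro _; simpa using hcard0.trans (card_le_card (hR0 0))
    | succ i ih =>
      intro hi
      have h1 := ih (by omega)
      have h2 := hstep i (by omega)
      rw [add_mul]; omega
  have h1 := hind K le_rfl
  have h2 : #(R K) ≤ #A := card_filter_le _ _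
  omega

/-- `Y` meets sumsets like a random set of density `β`, up to an additive error `E`. -/
def IsMixing (Y : Finset G) (β E : ℝ) : Prop :=
  ∀ X C : Finset G, |(#{p ∈ X ×ˢ C | p.1 + p.2 ∈ Y} : ℝ) - β * #X * #C| ≤ E

/-- Sets with random-like size and codegrees are mixing. -/
theorem isMixing_of_codegree [Fintype G] (Y : Finset G) (β t E : ℝ) (hβ0 : 0 ≤ β) (hβ1 : β ≤ 1) (ht : 1 ≤ t)
    (hsize : β * Fintype.card G - t ≤ #Y)
    (hcod : ∀ g : G, g ≠ 0 → (#{y ∈ Y | y + g ∈ Y} : ℝ) ≤ β ^ 2 * Fintype.card G + t)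
    (hE0 : 0 ≤ E) (hE : 4 * (Fintype.card G : ℝ) ^ 3 * t ≤ E ^ 2) : IsMixing Y β E := by
  intro X C
  set n : ℝ := (Fintype.card G : ℝ) with hn
  have hn1 : 1 ≤ n := by rw [hn]; exact_mod_cast Fintype.card_pos
  let d : G → ℝ := fun x => (#{c ∈ C | x + c ∈ Y} : ℝ)
  have hXn : (#X : ℝ) ≤ n := by rw [hn]; exact_mod_cast card_le_univ X
  have hCn : (#C : ℝ) ≤ n := by rw [hn]; exact_mod_cast card_le_univ C
  have hYn : (#Y : ℝ) ≤ n := by rw [hn]; exact_mod_cast card_le_univ Y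
  have hfib : ∀ c : G, #{x : G | x + c ∈ Y} = #Y := by
    intro c
    refine card_bij (fun x _ => x + c) (fun x hx => (mem_filter.1 hx).2) (fun x _ y _ h => add_right_cancel h)
      fun y hy => ⟨y - c, by simp [hy], by abel⟩
  have hsum1 : ∑ x, d x = #C * #Y := by
    have := sum_card_bipartiteAbove_eq_sum_card_bipartiteBelow (s := (univ : Finset G)) (t := C)
      (fun x c => x + c ∈ Y)
    simp only [bipartiteAbove, bipartiteBelow, hfib, sum_const, smul_eq_mul] at this
    simp only [d]
    exact_mod_cast this
  have hsum2 : ∑ x, d x ^ 2 ≤ #C * n + (#C : ℝ) ^ 2 * (β ^ 2 * n + t) := by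
    have h1 : ∀ x, d x ^ 2 = (#{q ∈ C ×ˢ C | x + q.1 ∈ Y ∧ x + q.2 ∈ Y} : ℝ) := by
      intro x
      have : {q ∈ C ×ˢ C | x + q.1 ∈ Y ∧ x + q.2 ∈ Y} = {c ∈ C | x + c ∈ Y} ×ˢ {c ∈ C | x + c ∈ Y} := by
        ext q; simp only [mem_filter, mem_product]; tauto
      rw [this, card_product]; push_cast; simp only [d]; ring
    have h2 := sum_card_bipartiteAbove_eq_sum_card_bipartiteBelow (s := (univ : Finset G)) (t := C ×ˢ C)
      (fun x q => x + q.1 ∈ Y ∧ x + q.2 ∈ Y)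
    have h3 : ∑ x, d x ^ 2 = ∑ q ∈ C ×ˢ C, (#{x : G | x + q.1 ∈ Y ∧ x + q.2 ∈ Y} : ℝ) := by
      simp only [h1]; exact_mod_cast h2
    rw [h3, sum_product]
    have h4 : ∀ c ∈ C, ∑ c' ∈ C, (#{x : G | x + c ∈ Y ∧ x + c' ∈ Y} : ℝ) ≤ n + #C * (β ^ 2 * n + t) := by
      intro c hc
      calc _ ≤ ∑ c' ∈ C, ((if c' = c then n else 0) + (β ^ 2 * n + t)) := by
            refine sum_le_sum fun c' _ => ?_
            by_cases hcc : c' = c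
            · rw [if_pos hcc]
              have h6 : (#{x : G | x + c ∈ Y ∧ x + c' ∈ Y} : ℝ) ≤ n := by
                rw [hn]; exact_mod_cast card_le_univ _
              have : 0 ≤ β ^ 2 * n + t := by positivity
              linarith
            · rw [if_neg hcc, zero_add]
              refine le_trans ?_ (hcod (c' - c) (sub_ne_zero.2 hcc))
              have : #{x : G | x + c ∈ Y ∧ x + c' ∈ Y} ≤ #{y ∈ Y | y + (c' - c) ∈ Y} := by
                refine card_le_card_of_injOn (fun x => x + c) (fun x hx => ?_) fun x _ y _ h => add_right_cancel h
                simp only [coe_filter, mem_univ, true_and, Set.mem_ofPred_eq] at hx ⊢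
                exact ⟨hx.1, by rw [show x + c + (c' - c) = x + c' by abel]; exact hx.2⟩
              exact_mod_cast this
        _ = _ := by rw [sum_add_distrib, sum_ite_eq' C c, if_pos hc, sum_const, nsmul_eq_mul]
    calc _ ≤ ∑ c ∈ C, (n + #C * (β ^ 2 * n + t)) := sum_le_sum h4
      _ = _ := by rw [sum_const, nsmul_eq_mul]; ring
  have hvar : ∑ x, (d x - β * #C) ^ 2 ≤ 4 * n ^ 2 * t := by
    have : ∑ x, (d x - β * #C) ^ 2 = ∑ x, d x ^ 2 - 2 * β * #C * ∑ x, d x + n * (β * #C) ^ 2 := by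
      rw [mul_sum, ← sum_sub_distrib, hn, ← nsmul_eq_mul, ← card_univ, ← sum_const, ← sum_add_distrib]
      exact sum_congr rfl fun x _ => by ring
    rw [this, hsum1]
    have hC0 : (0 : ℝ) ≤ #C := by positivity
    have hC2 : (#C : ℝ) ^ 2 ≤ n ^ 2 := by gcongr
    have hp : β * (#C : ℝ) ^ 2 * (β * n - t) ≤ β * (#C : ℝ) ^ 2 * #Y := by gcongr
    have hq : (#C : ℝ) ^ 2 * (t * (1 + 2 * β)) ≤ n ^ 2 * (t * (1 + 2 * 1)) := by gcongr
    have hr : (#C : ℝ) * n ≤ n ^ 2 * t := by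
      calc (#C : ℝ) * n ≤ n * n := by gcongr
        _ ≤ n ^ 2 * t := by nlinarith [sq_nonneg n]
    nlinarith
  have hcount : (#{p ∈ X ×ˢ C | p.1 + p.2 ∈ Y} : ℝ) = ∑ x ∈ X, d x := by
    rw [card_filter, sum_product]
    push_cast
    refine sum_congr rfl fun x _ => ?_
    simp only [d, card_filter]; push_cast; rfl
  have hdiff : (#{p ∈ X ×ˢ C | p.1 + p.2 ∈ Y} : ℝ) - β * #X * #C = ∑ x ∈ X, (d x - β * #C) := by
    rw [hcount, sum_sub_distrib, sum_const, nsmul_eq_mul]; ring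
  rw [hdiff]
  refine abs_le_of_sq_le_sq ?_ hE0
  calc (∑ x ∈ X, (d x - β * #C)) ^ 2 ≤ #X * ∑ x ∈ X, (d x - β * #C) ^ 2 := sq_sum_le_card_mul_sum_sq
    _ ≤ n * (4 * n ^ 2 * t) := by
      gcongr
      exact (sum_le_univ_sum_of_nonneg fun x => sq_nonneg _).trans hvar
    _ ≤ E ^ 2 := by linarith

theorem IsMixing.sub {Y : Finset G} {β E : ℝ} (h : IsMixing Y β E) (X C : Finset G) :
    |(#{p ∈ X ×ˢ C | p.1 - p.2 ∈ Y} : ℝ) - β * #X * #C| ≤ E := by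
  have h1 := h X (C.image Neg.neg)
  rw [card_image_of_injective _ neg_injective] at h1
  have : #{p ∈ X ×ˢ C | p.1 - p.2 ∈ Y} = #{p ∈ X ×ˢ C.image Neg.neg | p.1 + p.2 ∈ Y} := by
    refine card_bij (fun p _ => (p.1, -p.2)) ?_ ?_ ?_
    · intro p hp
      simp only [mem_filter, mem_product, mem_image] at hp ⊢
      exact ⟨⟨hp.1.1, p.2, hp.1.2, rfl⟩, by rw [← sub_eq_add_neg]; exact hp.2⟩
    · intro p _ q _ hpq
      simp only [Prod.mk.injEq, neg_inj] at hpq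
      exact Prod.ext hpq.1 hpq.2
    · intro p hp
      simp only [mem_filter, mem_product, mem_image] at hp
      obtain ⟨⟨h1, c, hc, h2⟩, h3⟩ := hp
      refine ⟨(p.1, c), ?_, Prod.ext rfl h2⟩
      simp only [mem_filter, mem_product]
      exact ⟨⟨h1, hc⟩, by rw [sub_eq_add_neg, h2]; exact h3⟩
  rw [this]; exact h1

/-- Pairs counted through a family of small forbidden sets. -/
theorem card_filter_mem_forb_le {α : Type*} [DecidableEq α] (S Z : Finset α) (Forb : α → Finset α) (k : ℕ) (h : ∀ a, #(Forb a) ≤ k) :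
    #{p ∈ S ×ˢ Z | p.2 ∈ Forb p.1} ≤ #S * k := by
  rw [card_filter, sum_product]
  calc _ ≤ ∑ _a ∈ S, k := sum_le_sum fun a _ => by
        rw [← card_filter]
        exact (card_le_card fun b hb => (mem_filter.1 hb).2).trans (h a)
    _ = _ := by simp

/-- Almost perfect rainbow matchings between mixing sets using colours from a mixing set of which
only a small part has been removed. -/
theorem exists_rainbowMatching_of_wide_colours [Fintype G] {A B C T YA YB : Finset G} {β τ E : ℝ} {d e K g : ℕ} {u L : ℝ}
    (hYA : IsMixing YA β E) (hYB : IsMixing YB β E) (hT : IsMixing T τ E)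
    (hA : A ⊆ YA) (hB : B ⊆ YB) (hC : C ⊆ T) (hβ : 0 ≤ β) (hE : 0 ≤ E) (hτ : 0.49 ≤ τ)
    (hu : (#T : ℝ) - #C + #A ≤ u) (hL : 0 < L) (huL : β * u ≤ L / 50)
    (hAB : #A ≤ #B + g) (hBL : 0.9 * L ≤ #B) (hAL : (#A : ℝ) ≤ 2 * L)
    (hd : 2 * E + 2 * K * d ≤ 0.02 * L * d) (hd0 : 0 < d)
    (he : (g + 12 * K) * L + 6 * E ≤ e * L)
    (hK : #A < d + K * (d - e)) (hed : e ≤ d) :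
    ∃ M, IsRainbowMatching A B C M ∧ #A < #M + d := by
  refine exists_rainbowMatching A B C d e K hK hed fun S hS hdS C₀ hC₀ hCC Forb hForb => ?_
  set N := {b ∈ B | ∃ a ∈ S, b - a ∈ C₀ ∧ b ∉ Forb a} with hN
  set Z := B \ N with hZ
  set Us := T \ C₀ with hUs
  have hNB : N ⊆ B := filter_subset _ _
  have hZN : #Z + #N = #B := card_sdiff_add_card_eq_card hNB
  have hUsc : (#Us : ℝ) ≤ u := by
    have h1 : #Us + #C₀ = #T := card_sdiff_add_card_eq_card (hC₀.trans hC)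
    have h2 : (#Us : ℝ) + #C₀ = #T := by exact_mod_cast h1
    have h3 : (#C : ℝ) ≤ #C₀ + #A := by exact_mod_cast hCC
    linarith
  have hlow : τ * #Z * #S - E ≤ #{p ∈ Z ×ˢ S | p.1 - p.2 ∈ T} := by
    have := (abs_le.1 (hT.sub Z S)).1; linarith
  have hsplit : #{p ∈ Z ×ˢ S | p.1 - p.2 ∈ T} ≤ #{p ∈ Z ×ˢ S | p.1 - p.2 ∈ Us} + #S * (2 * K) := by
    have hf := card_filter_mem_forb_le S Z Forb (2 * K) hForb
    have hsw : #{p ∈ Z ×ˢ S | p.1 ∈ Forb p.2} ≤ #{p ∈ S ×ˢ Z | p.2 ∈ Forb p.1} := by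
      refine card_le_card_of_injOn Prod.swap (fun p hp => ?_) Prod.swap_injective.injOn
      simp only [coe_filter, mem_product, Set.mem_ofPred_eq, Prod.fst_swap, Prod.snd_swap] at hp ⊢
      exact ⟨⟨hp.1.2, hp.1.1⟩, hp.2⟩
    refine le_trans ((card_le_card fun p hp => ?_).trans 
      (card_union_le {p ∈ Z ×ˢ S | p.1 - p.2 ∈ Us} {p ∈ Z ×ˢ S | p.1 ∈ Forb p.2})) (by omega)
    simp only [mem_filter, mem_product, mem_union] at hp ⊢
    by_cases hpU : p.1 - p.2 ∈ C₀
    · right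
      refine ⟨hp.1, ?_⟩
      by_contra hpf
      have hz := mem_sdiff.1 hp.1.1
      exact hz.2 (mem_filter.2 ⟨hz.1, p.2, hp.1.2, hpU, hpf⟩)
    · exact Or.inl ⟨hp.1, mem_sdiff.2 ⟨hp.2, hpU⟩⟩
  have hsplit' : (#{p ∈ Z ×ˢ S | p.1 - p.2 ∈ T} : ℝ) ≤ #{p ∈ Z ×ˢ S | p.1 - p.2 ∈ Us} + #S * (2 * K) := by
    exact_mod_cast hsplit
  have hup1 : (#{p ∈ Z ×ˢ S | p.1 - p.2 ∈ Us} : ℝ) ≤ β * #S * #Us + E := by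
    have h1 : #{p ∈ Z ×ˢ S | p.1 - p.2 ∈ Us} ≤ #{p ∈ S ×ˢ Us | p.1 + p.2 ∈ YB} := by
      refine card_le_card_of_injOn (fun p => (p.2, p.1 - p.2)) (fun p hp => ?_) fun p _ q _ hpq => ?_
      · simp only [coe_filter, mem_product, Set.mem_ofPred_eq] at hp ⊢
        refine ⟨⟨hp.1.2, hp.2⟩, ?_⟩
        rw [add_sub_cancel]
        exact hB (mem_sdiff.1 hp.1.1).1
      · simp only [Prod.mk.injEq] at hpq
        refine Prod.ext ?_ hpq.1
        have := hpq.2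
        rw [hpq.1] at this
        exact sub_left_injective this
    have h2 := (abs_le.1 (hYB S Us)).2
    have h3 : (#{p ∈ Z ×ˢ S | p.1 - p.2 ∈ Us} : ℝ) ≤ #{p ∈ S ×ˢ Us | p.1 + p.2 ∈ YB} := by exact_mod_cast h1
    linarith
  have hup2 : (#{p ∈ Z ×ˢ S | p.1 - p.2 ∈ Us} : ℝ) ≤ β * #Z * #Us + E := by
    have h1 : #{p ∈ Z ×ˢ S | p.1 - p.2 ∈ Us} ≤ #{p ∈ Z ×ˢ Us | p.1 - p.2 ∈ YA} := by
      refine card_le_card_of_injOn (fun p => (p.1, p.1 - p.2)) (fun p hp => ?_) fun p _ q _ hpq => ?_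
      · simp only [coe_filter, mem_product, Set.mem_ofPred_eq] at hp ⊢
        refine ⟨⟨hp.1.1, hp.2⟩, ?_⟩
        rw [sub_sub_cancel]
        exact hA (hS hp.1.2)
      · simp only [Prod.mk.injEq] at hpq
        refine Prod.ext hpq.1 ?_
        have := hpq.2
        rw [hpq.1] at this
        exact sub_right_injective this
    have h2 := (abs_le.1 (hYA.sub Z Us)).2
    have h3 : (#{p ∈ Z ×ˢ S | p.1 - p.2 ∈ Us} : ℝ) ≤ #{p ∈ Z ×ˢ Us | p.1 - p.2 ∈ YA} := by exact_mod_cast h1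
    linarith
  have hs : (d : ℝ) ≤ #S := by exact_mod_cast hdS
  have hd0' : (0 : ℝ) < d := by exact_mod_cast hd0
  have hSA : (#S : ℝ) ≤ #A := by exact_mod_cast card_le_card hS
  have hZN' : (#Z : ℝ) + #N = #B := by exact_mod_cast hZN
  have hAB' : (#A : ℝ) ≤ #B + g := by exact_mod_cast hAB
  have hβUs : β * #Us ≤ L / 50 := (mul_le_mul_of_nonneg_left hUsc hβ).trans huL
  have hgoal : (#S : ℝ) ≤ e + #N := by
    set z : ℝ := (#Z : ℝ)
    set x : ℝ := (#S : ℝ)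
    set b : ℝ := (#B : ℝ)
    have hz0 : 0 ≤ z := by positivity
    have hx0 : 0 < x := by linarith
    have hτz : 0.49 * z * x ≤ τ * z * x := by gcongr
    rcases le_or_gt x (0.9 * b) with hcase | hcase
    · have h0 : β * x * #Us ≤ L / 50 * x := by
        calc β * x * #Us = (β * #Us) * x := by ring
          _ ≤ _ := by gcongr
      have h1 : 0.49 * z * x ≤ L / 50 * x + 2 * E + 2 * K * x := by linarith
      have h2 : 2 * E + 2 * K * x ≤ 0.02 * L * x := by
        have : 2 * E * d + 2 * K * d * x ≤ 0.02 * L * d * x := by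
          calc 2 * E * d + 2 * K * d * x ≤ 2 * E * x + 2 * K * d * x := by gcongr
            _ = (2 * E + 2 * K * d) * x := by ring
            _ ≤ _ := by gcongr
        have h3 : d * (2 * E + 2 * K * x) ≤ d * (0.02 * L * x) := by linarith
        exact le_of_mul_le_mul_left h3 hd0'
      have h4 : x * (0.49 * z) ≤ x * (0.04 * L) := by linarith
      have h5 := le_of_mul_le_mul_left h4 hx0
      have : (0 : ℝ) ≤ e := by positivity
      linarith
    · have h0 : β * z * #Us ≤ L / 50 * z := by
        calc β * z * #Us = (β * #Us) * z := by ring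
          _ ≤ _ := by gcongr
      have h1 : 0.49 * z * x ≤ L / 50 * z + 2 * E + 2 * K * x := by linarith
      have h2 : (0.81 * L) * (0.49 * z) ≤ x * (0.49 * z) := by exact mul_le_mul_of_nonneg_right (by linarith) (by linarith)
      have hKx : (K : ℝ) * x ≤ K * (2 * L) := mul_le_mul_of_nonneg_left (by linarith) (by positivity)
      have h3 : L * (0.37 * z) ≤ 2 * E + 4 * K * L := by
        have : 0 ≤ L * z := by positivity
        linarith
      have h4 : L * (z + g) ≤ L * e := by
        have : 0 ≤ K * L := by positivity
        linarith
      have h5 := le_of_mul_le_mul_left h4 hL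
      linarith
  exact_mod_cast hgoal

/-- Almost perfect rainbow matchings between mixing sets with an arbitrary set of colours. -/
theorem exists_rainbowMatching_of_mixing [Fintype G] {A B C YA YB : Finset G} {β E c₀ : ℝ} {d e K : ℕ}
    (hYA : IsMixing YA β E) (hYB : IsMixing YB β E) (hA : A ⊆ YA) (hB : #(YB \ B) ≤ 1)
    (hβ : 0 < β) (hc₀ : 0 < c₀) (hC : c₀ + #A ≤ #C)
    (he : 2 * E + (2 * K + 1) * #A ≤ β * c₀ * e)
    (hK : #A < d + K * (d - e)) (hed : e ≤ d) :
    ∃ M, IsRainbowMatching A B C M ∧ #A < #M + d := by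
  refine exists_rainbowMatching A B C d e K hK hed fun S hS _ C₀ hC₀ hCC Forb hForb => ?_
  set N := {b ∈ B | ∃ a ∈ S, b - a ∈ C₀ ∧ b ∉ Forb a} with hN
  have hlow := (abs_le.1 (hYB S C₀)).1
  have hup := (abs_le.1 (hYA.sub N C₀)).2
  have hsplit : #{p ∈ S ×ˢ C₀ | p.1 + p.2 ∈ YB} ≤ #{p ∈ N ×ˢ C₀ | p.1 - p.2 ∈ YA} + #S * (2 * K + 1) := by
    have hf : #{p ∈ S ×ˢ C₀ | p.1 + p.2 ∈ Forb p.1 ∪ (YB \ B)} ≤ #S * (2 * K + 1) := by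
      refine le_trans ?_ (card_filter_mem_forb_le S univ (fun a => Forb a ∪ (YB \ B)) (2 * K + 1)
        fun a => (card_union_le _ _).trans (add_le_add (hForb a) hB))
      refine card_le_card_of_injOn (fun p => (p.1, p.1 + p.2)) (fun p hp => ?_) fun p _ q _ hpq => ?_
      · simp only [coe_filter, mem_product, Set.mem_ofPred_eq, mem_univ, and_true] at hp ⊢
        exact ⟨hp.1.1, hp.2⟩
      · simp only [Prod.mk.injEq] at hpq
        refine Prod.ext hpq.1 ?_
        have := hpq.2
        rw [hpq.1] at this
        exact add_left_cancel this
    have hg : #{p ∈ S ×ˢ C₀ | p.1 + p.2 ∈ N} ≤ #{p ∈ N ×ˢ C₀ | p.1 - p.2 ∈ YA} := by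
      refine card_le_card_of_injOn (fun p => (p.1 + p.2, p.2)) (fun p hp => ?_) fun p _ q _ hpq => ?_
      · simp only [coe_filter, mem_product, Set.mem_ofPred_eq] at hp ⊢
        refine ⟨⟨hp.2, hp.1.2⟩, ?_⟩
        rw [add_sub_cancel_right]
        exact hA (hS hp.1.1)
      · simp only [Prod.mk.injEq] at hpq
        refine Prod.ext ?_ hpq.2
        have := hpq.1
        rw [hpq.2] at this
        exact add_right_cancel this
    refine le_trans ((card_le_card fun p hp => ?_).trans
      (card_union_le {p ∈ S ×ˢ C₀ | p.1 + p.2 ∈ N} {p ∈ S ×ˢ C₀ | p.1 + p.2 ∈ Forb p.1 ∪ (YB \ B)})) (by omega)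
    simp only [mem_filter, mem_product, mem_union, mem_sdiff] at hp ⊢
    by_cases h1 : p.1 + p.2 ∈ B
    · by_cases h2 : p.1 + p.2 ∈ Forb p.1
      · exact Or.inr ⟨hp.1, Or.inl h2⟩
      · exact Or.inl ⟨hp.1, mem_filter.2 ⟨h1, p.1, hp.1.1, by rw [add_sub_cancel_left]; exact hp.1.2, h2⟩⟩
    · exact Or.inr ⟨hp.1, Or.inr ⟨hp.2, h1⟩⟩
  have hsplit' : (#{p ∈ S ×ˢ C₀ | p.1 + p.2 ∈ YB} : ℝ) ≤
      #{p ∈ N ×ˢ C₀ | p.1 - p.2 ∈ YA} + #S * (2 * K + 1) := by exact_mod_cast hsplit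
  have hSA : (#S : ℝ) ≤ #A := by exact_mod_cast card_le_card hS
  have hc : c₀ ≤ #C₀ := by
    have h3 : (#C : ℝ) ≤ #C₀ + #A := by exact_mod_cast hCC
    linarith
  have hgoal : (#S : ℝ) ≤ e + #N := by
    have h1 : (#S : ℝ) * (2 * K + 1) ≤ #A * (2 * K + 1) := by gcongr
    have h2 : β * c₀ * e ≤ β * #C₀ * e := by gcongr
    have h3 : (β * #C₀) * #S ≤ (β * #C₀) * (e + #N) := by linarith
    exact le_of_mul_le_mul_left h3 (mul_pos hβ (hc₀.trans_le hc))
  exact_mod_cast hgoal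

end Matching

section Absorber

open Finset

variable {G : Type} [AddCommGroup G] [DecidableEq G]

/-- The vertices (`inl`) and colours (`inr`) used by a directed path. -/
def pathTokens : List G → Multiset (G ⊕ G)
  | [] => 0
  | [v] => {Sum.inl v}
  | v :: w :: l => {Sum.inl v} + {Sum.inr (w - v)} + pathTokens (w :: l)

/-- First vertex, last vertex and number of vertices of a path. -/
def pathEnds (l : List G) : G × G × ℕ := (l.headD 0, l.getLastD 0, l.length)

/-- Some family of paths with the prescribed ends and lengths uses precisely the tokens `M`. -/
def Realizes (E : Multiset (G × G × ℕ)) (M : Multiset (G ⊕ G)) : Prop :=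
  ∃ P : Multiset (List G), P.map pathEnds = E ∧ (P.map pathTokens).sum = M

theorem Realizes.zero : Realizes (0 : Multiset (G × G × ℕ)) 0 := ⟨0, rfl, rfl⟩

theorem Realizes.add {E E' : Multiset (G × G × ℕ)} {M M' : Multiset (G ⊕ G)} :
    Realizes E M → Realizes E' M' → Realizes (E + E') (M + M') := by
  rintro ⟨P, rfl, rfl⟩ ⟨P', rfl, rfl⟩
  exact ⟨P + P', by simp, by simp⟩

theorem Realizes.sum {ι : Type*} [DecidableEq ι] (s : Finset ι) {E : ι → Multiset (G × G × ℕ)}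
    {M : ι → Multiset (G ⊕ G)} (h : ∀ i ∈ s, Realizes (E i) (M i)) :
    Realizes (∑ i ∈ s, E i) (∑ i ∈ s, M i) := by
  induction s using Finset.induction_on with
  | empty => exact Realizes.zero
  | insert a s ha ih =>
    rw [sum_insert ha, sum_insert ha]
    exact (h a (mem_insert_self _ _)).add (ih fun i hi => h i (mem_insert_of_mem hi))

theorem Realizes.path (l : List G) : Realizes {pathEnds l} (pathTokens l) :=
  ⟨{l}, by simp, by simp⟩

theorem pathTokens_append (l l' : List G) (a b : G) :
    pathTokens ((l ++ [a]) ++ (b :: l')) =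
      pathTokens (l ++ [a]) + {Sum.inr (b - a)} + pathTokens (b :: l') := by
  induction l with
  | nil => simp [pathTokens]
  | cons c l ih =>
    cases l with
    | nil => simp only [List.nil_append, List.cons_append, pathTokens]; abel
    | cons d l =>
      simp only [List.cons_append, pathTokens] at ih ⊢
      rw [ih]; abel

theorem Realizes.join {E : Multiset (G × G × ℕ)} {M : Multiset (G ⊕ G)} {s t s' t' : G} {l l' : ℕ}
    (hl : 0 < l) (hl' : 0 < l') (h : Realizes ((s, t, l) ::ₘ (s', t', l') ::ₘ E) M) :
    Realizes ((s, t', l + l') ::ₘ E) (M + {Sum.inr (s' - t)}) := by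
  obtain ⟨P, hP, rfl⟩ := h
  rw [← Multiset.map_eq_cons] at hP
  obtain ⟨p, hp, hpe, hP⟩ := hP
  obtain ⟨Q, rfl⟩ := Multiset.exists_cons_of_mem hp
  rw [Multiset.erase_cons_head, ← Multiset.map_eq_cons] at hP
  obtain ⟨p', hp', hpe', hQ⟩ := hP
  obtain ⟨R, rfl⟩ := Multiset.exists_cons_of_mem hp'
  rw [Multiset.erase_cons_head] at hQ
  subst hQ
  simp only [pathEnds, Prod.mk.injEq] at hpe hpe'
  obtain ⟨rfl, rfl, rfl⟩ := hpe
  obtain ⟨rfl, rfl, rfl⟩ := hpe'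
  obtain ⟨q, a, rfl⟩ := List.eq_nil_or_concat' p |>.resolve_left (by rintro rfl; simp at hl)
  obtain ⟨b, q', rfl⟩ := List.exists_cons_of_length_pos hl'
  refine ⟨((q ++ [a]) ++ (b :: q')) ::ₘ R, ?_, ?_⟩
  · rw [Multiset.map_cons]
    congr 1
    simp only [pathEnds, Prod.mk.injEq]
    refine ⟨by cases q <;> simp, ?_, by simp; omega⟩
    rw [List.getLastD_eq_getLast?, List.getLastD_eq_getLast?, List.getLast?_append_of_ne_nil _ (List.cons_ne_nil _ _)]
  · rw [Multiset.map_cons, Multiset.map_cons, Multiset.map_cons, Multiset.sum_cons, pathTokens_append,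
      Multiset.sum_cons, Multiset.sum_cons]
    simp only [List.headD_cons, List.getLastD_concat]
    abel

/-- Any realization with ends `E` extends to one with ends `E'` using the extra tokens `X`. -/
def Extends (E E' : Multiset (G × G × ℕ)) (X : Multiset (G ⊕ G)) : Prop :=
  ∀ F M, Realizes (E + F) M → Realizes (E' + F) (M + X)

theorem Extends.trans {E E' E'' : Multiset (G × G × ℕ)} {X Y : Multiset (G ⊕ G)}
    (h : Extends E E' X) (h' : Extends E' E'' Y) : Extends E E'' (X + Y) := fun F M hM => by
  rw [← add_assoc]; exact h' _ _ (h _ _ hM)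

theorem Extends.add {E E' D D' : Multiset (G × G × ℕ)} {X Y : Multiset (G ⊕ G)}
    (h : Extends E E' X) (h' : Extends D D' Y) : Extends (E + D) (E' + D') (X + Y) := fun F M hM => by
  rw [add_assoc] at hM
  have := h _ _ hM
  rw [add_left_comm] at this
  have := h' _ _ this
  rw [add_left_comm, ← add_assoc] at this
  rwa [← add_assoc M]

theorem Extends.pad {s t v : G} {l : ℕ} (hl : 0 < l) :
    Extends {(s, t, l)} {(s, v, l + 1)} ({Sum.inl v} + {Sum.inr (v - t)}) := fun F M hM => by
  have h1 : Realizes ((v, v, 1) ::ₘ (s, t, l) ::ₘ F) ({Sum.inl v} + M) := (Realizes.path [v]).add hM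
  rw [Multiset.cons_swap] at h1
  have h3 := h1.join hl one_pos
  rwa [add_comm {Sum.inl v} M, add_assoc] at h3

theorem Extends.join {s t s' t' : G} {l l' : ℕ} (hl : 0 < l) (hl' : 0 < l') :
    Extends ({(s, t, l)} + {(s', t', l')}) {(s, t', l + l')} {Sum.inr (s' - t)} := fun F M hM => by
  refine Realizes.join hl hl' ?_
  simpa [add_assoc] using hM

/-- `M` is a set of at most `c` admissible tokens, none of which has been used. -/
structure Fresh (Adm : Set (G ⊕ G)) (Used : Finset (G ⊕ G)) (M : Multiset (G ⊕ G)) (c : ℕ) : Prop where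
  nodup : M.Nodup
  adm : ∀ a ∈ M, a ∈ Adm
  fresh : ∀ a ∈ M, a ∉ Used
  card_le : Multiset.card M ≤ c

section

variable {Adm : Set (G ⊕ G)} {Used : Finset (G ⊕ G)} {M M' : Multiset (G ⊕ G)} {c c' : ℕ}

theorem Fresh.zero : Fresh Adm Used 0 0 := ⟨by simp, by simp, by simp, by simp⟩

theorem Fresh.mono (h : Fresh Adm Used M c) (hc : c ≤ c') : Fresh Adm Used M c' :=
  ⟨h.nodup, h.adm, h.fresh, h.card_le.trans hc⟩

theorem Fresh.add (h : Fresh Adm Used M c) (h' : Fresh Adm (Used ∪ M.toFinset) M' c') :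
    Fresh Adm Used (M + M') (c + c') where
  nodup := by
    rw [Multiset.nodup_add]
    refine ⟨h.nodup, h'.nodup, Multiset.disjoint_left.2 fun ha ha' => ?_⟩
    exact h'.fresh _ ha' (mem_union_right _ (Multiset.mem_toFinset.2 ha))
  adm a ha := (Multiset.mem_add.1 ha).elim (h.adm a) (h'.adm a)
  fresh a ha := (Multiset.mem_add.1 ha).elim (h.fresh a) fun ha' hu => h'.fresh a ha' (mem_union_left _ hu)
  card_le := by rw [Multiset.card_add]; exact add_le_add h.card_le h'.card_le

theorem Fresh.card_union (h : Fresh Adm Used M c) : #(Used ∪ M.toFinset) ≤ #Used + c :=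
  (card_union_le _ _).trans (Nat.add_le_add_left ((Multiset.toFinset_card_le M).trans h.card_le) _)

end

/-- Pieces are short nonempty paths. -/
def Short (E : Multiset (G × G × ℕ)) : Prop := ∀ e ∈ E, 0 < e.2.2 ∧ e.2.2 ≤ 4

theorem Short.add {E E' : Multiset (G × G × ℕ)} (h : Short E) (h' : Short E') : Short (E + E') :=
  fun e he => (Multiset.mem_add.1 he).elim (h e) (h' e)

/-- The local gadgets from which an absorber for items of a given kind is assembled. -/
structure ItemSupply (Adm : Set (G ⊕ G)) (tok : G → Multiset (G ⊕ G)) (Ok : G → Prop) (B : ℕ) : Prop where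
  row : ∀ x x', Ok x → Ok x' → ∀ Used : Finset (G ⊕ G), #Used ≤ B → ∃ b b' E Q, Ok b ∧ Ok b' ∧ Short E ∧
    Multiset.card E ≤ 40 ∧ Fresh Adm Used (Q + (tok b + tok b')) 40 ∧
    ∀ y ∈ [tok x, tok b, tok b'], ∀ y' ∈ [tok x', tok b, tok b'], Realizes E (Q + (y + y'))
  base : ∀ x x', Ok x → Ok x' → ∀ Used : Finset (G ⊕ G), #Used ≤ B → ∃ E Q, Short E ∧
    Multiset.card E ≤ 40 ∧ Fresh Adm Used Q 40 ∧ Realizes E (Q + tok x) ∧ Realizes E (Q + tok x')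
  item : ∀ Used : Finset (G ⊕ G), #Used ≤ B → ∃ x, Ok x ∧ Fresh Adm Used (tok x) 2

namespace ItemSupply

variable {Adm : Set (G ⊕ G)} {tok : G → Multiset (G ⊕ G)} {Ok : G → Prop} {B : ℕ}

theorem rows (h : ItemSupply Adm tok Ok B) {κ : Type} [DecidableEq κ] (s : Finset κ) (x x' : κ → G)
    (hx : ∀ i, Ok (x i)) (hx' : ∀ i, Ok (x' i)) (Used : Finset (G ⊕ G)) (hU : #Used + 40 * #s ≤ B) :
    ∃ (b b' : κ → G) (E : κ → Multiset (G × G × ℕ)) (Q : κ → Multiset (G ⊕ G)),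
      (∀ i ∈ s, Ok (b i) ∧ Ok (b' i)) ∧ Short (∑ i ∈ s, E i) ∧ Multiset.card (∑ i ∈ s, E i) ≤ 40 * #s ∧
      Fresh Adm Used (∑ i ∈ s, (Q i + (tok (b i) + tok (b' i)))) (40 * #s) ∧
      ∀ i ∈ s, ∀ y ∈ [tok (x i), tok (b i), tok (b' i)], ∀ y' ∈ [tok (x' i), tok (b i), tok (b' i)],
        Realizes (E i) (Q i + (y + y')) := by
  induction s using Finset.induction_on with
  | empty => exact ⟨x, x', fun _ => 0, fun _ => 0, by simp, by simp [Short], by simp, by simpa using Fresh.zero, by simp⟩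
  | insert a s ha ih =>
    rw [card_insert_of_notMem ha] at hU
    obtain ⟨b, b', E, Q, h1, h2, h3, h4, h5⟩ := ih (by omega)
    obtain ⟨c, c', D, R, g1, g2, g3, g4, g5, g6⟩ := h.row (x a) (x' a) (hx a) (hx' a) _ (h4.card_union.trans (by omega))
    have hne : ∀ i ∈ s, i ≠ a := fun i hi hia => ha (hia ▸ hi)
    refine ⟨Function.update b a c, Function.update b' a c', Function.update E a D, Function.update Q a R, ?_, ?_, ?_, ?_, ?_⟩
    · intro i hi
      rcases mem_insert.1 hi with rfl | hi
      · simp [g1, g2]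
      · simpa [Function.update_of_ne (hne i hi)] using h1 i hi
    · rw [sum_insert ha, sum_congr rfl fun i hi => Function.update_of_ne (hne i hi) _ _, Function.update_self]
      exact g3.add h2
    · rw [sum_insert ha, sum_congr rfl fun i hi => Function.update_of_ne (hne i hi) _ _, Function.update_self,
        card_insert_of_notMem ha, Multiset.card_add]
      omega
    · rw [sum_insert ha, sum_congr rfl fun i hi => by
        rw [Function.update_of_ne (hne i hi), Function.update_of_ne (hne i hi), Function.update_of_ne (hne i hi)],
        Function.update_self, Function.update_self, Function.update_self, card_insert_of_notMem ha, add_comm]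
      exact (h4.add g5).mono (by omega)
    · intro i hi
      rcases mem_insert.1 hi with rfl | hi
      · simpa only [Function.update_self] using g6
      · simpa only [Function.update_of_ne (hne i hi)] using h5 i hi

theorem exists_row_choice {κ A : Type} [Fintype κ] [DecidableEq κ] [AddCommMonoid A] (D : Finset (κ × Bool)) (N : ℕ)
    (hD : #D = N + N) (x x' b b' : κ → A) : ∃ H H' : Finset κ, #H = N ∧ #H' = N ∧
    ∀ i : κ, ∃ y ∈ [x i, b i, b' i], ∃ y' ∈ [x' i, b i, b' i],
      (y + y') + ((if i ∈ H then b i else 0) + (if i ∈ H' then b' i else 0)) =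
      b i + b' i + ((if (i, true) ∈ D then x i else 0) + (if (i, false) ∈ D then x' i else 0)) := by
  have hcnt : ∑ i : κ, ((if (i, true) ∈ D then 1 else 0) + (if (i, false) ∈ D then 1 else 0)) = N + N := by
    rw [← hD, card_eq_sum_ones, ← Fintype.sum_ite_mem D, Fintype.sum_prod_type]
    exact sum_congr rfl fun i _ => by rw [Fintype.sum_bool]
  let R₂ : Finset κ := univ.filter fun i => (i, true) ∈ D ∧ (i, false) ∈ D
  let R : Finset κ := univ.filter fun i => (i, true) ∈ D ∨ (i, false) ∈ D
  have hR : #R₂ + #R = N + N := by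
    refine Eq.trans ?_ hcnt
    rw [card_filter, card_filter, ← sum_add_distrib]
    refine sum_congr rfl fun i _ => ?_
    by_cases h1 : (i, true) ∈ D <;> by_cases h2 : (i, false) ∈ D <;> simp [h1, h2]
  have hRR : R₂ ⊆ R := fun i hi => mem_filter.2 ⟨mem_univ _, Or.inl (mem_filter.1 hi).2.1⟩
  have hle := card_le_card hRR
  obtain ⟨H, hH1, hH2, hH3⟩ := exists_subsuperset_card_eq hRR (show #R₂ ≤ N by omega) (show N ≤ #R by omega)
  refine ⟨H, R₂ ∪ (R \ H), hH3, ?_, fun i => ?_⟩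
  · rw [card_union_of_disjoint, card_sdiff_of_subset hH2, hH3]
    · omega
    · exact disjoint_left.2 fun i hi hi' => (mem_sdiff.1 hi').2 (hH1 hi)
  have hmem2 : i ∈ R₂ ↔ (i, true) ∈ D ∧ (i, false) ∈ D := by simp [R₂]
  have hmem : i ∈ R ↔ (i, true) ∈ D ∨ (i, false) ∈ D := by simp [R]
  have hmem' : i ∈ R₂ ∪ (R \ H) ↔ i ∈ R₂ ∨ i ∈ R ∧ i ∉ H := by simp
  have hs1 : i ∈ R₂ → i ∈ H := fun h => hH1 h
  have hs2 : i ∈ H → i ∈ R := fun h => hH2 h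
  generalize R₂ ∪ (R \ H) = H' at *
  by_cases ht : (i, true) ∈ D <;> by_cases hf : (i, false) ∈ D <;>
    simp only [ht, hf, and_true, and_false, or_true, or_false, iff_true, iff_false] at hmem2 hmem
  · have hh := hs1 hmem2
    have hh' := hmem'.2 (Or.inl hmem2)
    exact ⟨x i, by simp, x' i, by simp, by simp only [hh, hh', ht, hf, if_true]; exact add_comm _ _⟩
  · by_cases hh : i ∈ H
    · have hh' : i ∉ H' := by rw [hmem']; tauto
      exact ⟨x i, by simp, b' i, by simp, by simp only [hh, hh', ht, hf, if_true]; simp; abel⟩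
    · have hh' : i ∈ H' := by rw [hmem']; tauto
      exact ⟨x i, by simp, b i, by simp, by simp only [hh, hh', ht, hf, if_true]; simp; abel⟩
  · by_cases hh : i ∈ H
    · have hh' : i ∉ H' := by rw [hmem']; tauto
      exact ⟨b' i, by simp, x' i, by simp, by simp only [hh, hh', ht, hf, if_true]; simp; abel⟩
    · have hh' : i ∈ H' := by rw [hmem']; tauto
      exact ⟨b i, by simp, x' i, by simp, by simp only [hh, hh', ht, hf, if_true]; simp; abel⟩
  · have hh : i ∉ H := by tauto
    have hh' : i ∉ H' := by rw [hmem']; tauto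
    exact ⟨b i, by simp, b' i, by simp, by simp [hh, hh', ht, hf]⟩

theorem template_step (h : ItemSupply Adm tok Ok B) {N c : ℕ} {κ : Type} [Fintype κ] [DecidableEq κ]
    (hκ : Fintype.card κ = N + N)
    (ih : ∀ x : κ → G, (∀ i, Ok (x i)) → ∀ Used : Finset (G ⊕ G), #Used + c ≤ B →
      ∃ E Q, Short E ∧ Multiset.card E ≤ c ∧ Fresh Adm Used Q c ∧
      ∀ D : Finset κ, #D = N → Realizes E (Q + ∑ i ∈ D, tok (x i)))
    {ι : Type} [Fintype ι] [DecidableEq ι] (e : ι ≃ κ × Bool) (x : ι → G) (hx : ∀ i, Ok (x i))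
    (Used : Finset (G ⊕ G)) (hU : #Used + (40 * (N + N) + c + c) ≤ B) :
    ∃ E Q, Short E ∧ Multiset.card E ≤ 40 * (N + N) + c + c ∧ Fresh Adm Used Q (40 * (N + N) + c + c) ∧
      ∀ D : Finset ι, #D = N + N → Realizes E (Q + ∑ i ∈ D, tok (x i)) := by
  obtain ⟨b, b', E, Q, h1, h2, h3, h4, h5⟩ := h.rows (univ : Finset κ) (fun i => x (e.symm (i, true)))
    (fun i => x (e.symm (i, false))) (fun _ => hx _) (fun _ => hx _) Used (by rw [card_univ, hκ]; omega)
  rw [card_univ, hκ] at h3 h4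
  have hU1 := h4.card_union
  set U₁ := Used ∪ (∑ i, (Q i + (tok (b i) + tok (b' i)))).toFinset with hU₁
  obtain ⟨E₁, Q₁, i1, i2, i3, i4⟩ := ih b (fun i => (h1 i (mem_univ _)).1) U₁ (by omega)
  have hU2 := i3.card_union
  obtain ⟨E₂, Q₂, j1, j2, j3, j4⟩ := ih b' (fun i => (h1 i (mem_univ _)).2) (U₁ ∪ Q₁.toFinset) (by omega)
  refine ⟨∑ i, E i + E₁ + E₂, ∑ i, (Q i + (tok (b i) + tok (b' i))) + Q₁ + Q₂, (h2.add i1).add j1, ?_, ?_, ?_⟩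
  · rw [Multiset.card_add, Multiset.card_add]; omega
  · refine Fresh.add (h4.add i3) ?_
    rwa [Multiset.toFinset_add, ← union_assoc]
  intro D hD
  obtain ⟨H, H', hH, hH', hrow⟩ := exists_row_choice (D.map e.toEmbedding) N (by rw [card_map, hD])
    (fun i => tok (x (e.symm (i, true)))) (fun i => tok (x (e.symm (i, false)))) (fun i => tok (b i)) (fun i => tok (b' i))
  choose y hy y' hy' hyy using hrow
  have r1 : Realizes (∑ i, E i) (∑ i, (Q i + (y i + y' i))) :=
    Realizes.sum univ (M := fun i => Q i + (y i + y' i)) fun i hi => h5 i hi (y i) (hy i) (y' i) (hy' i)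
  have r2 := (r1.add (i4 H hH)).add (j4 H' hH')
  have hsum : ∑ i ∈ D, tok (x i) = ∑ i : κ, ((if (i, true) ∈ D.map e.toEmbedding then tok (x (e.symm (i, true))) else 0) +
      (if (i, false) ∈ D.map e.toEmbedding then tok (x (e.symm (i, false))) else 0)) := by
    have : ∑ i ∈ D, tok (x i) = ∑ q ∈ D.map e.toEmbedding, tok (x (e.symm q)) := by simp
    rw [this, ← Fintype.sum_ite_mem (D.map e.toEmbedding), Fintype.sum_prod_type]
    refine sum_congr rfl fun i _ => ?_
    rw [Fintype.sum_bool]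
  have hs : (∑ i, (y i + y' i)) + (∑ i ∈ H, tok (b i) + ∑ i ∈ H', tok (b' i)) =
      ∑ i, (tok (b i) + tok (b' i)) + ∑ i ∈ D, tok (x i) := by
    rw [hsum, ← Fintype.sum_ite_mem H, ← Fintype.sum_ite_mem H', ← sum_add_distrib, ← sum_add_distrib, ← sum_add_distrib]
    exact sum_congr rfl fun i _ => hyy i
  have : ∑ i, (Q i + (tok (b i) + tok (b' i))) + Q₁ + Q₂ + ∑ i ∈ D, tok (x i) =
      ∑ i, (Q i + (y i + y' i)) + (Q₁ + ∑ i ∈ H, tok (b i)) + (Q₂ + ∑ i ∈ H', tok (b' i)) := by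
    rw [sum_add_distrib, sum_add_distrib (f := Q)]
    calc _ = ∑ i, Q i + Q₁ + Q₂ + (∑ i, (tok (b i) + tok (b' i)) + ∑ i ∈ D, tok (x i)) := by abel
      _ = _ := by rw [← hs]; abel
  rw [this]
  exact r2

theorem template (h : ItemSupply Adm tok Ok B) (L : ℕ) : ∀ (ι : Type) [Fintype ι] [DecidableEq ι],
    Fintype.card ι = 2 ^ (L + 1) → ∀ x : ι → G, (∀ i, Ok (x i)) → ∀ Used : Finset (G ⊕ G),
    #Used + 40 * (L + 1) * 2 ^ L ≤ B → ∃ E Q, Short E ∧ Multiset.card E ≤ 40 * (L + 1) * 2 ^ L ∧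
      Fresh Adm Used Q (40 * (L + 1) * 2 ^ L) ∧
      ∀ D : Finset ι, #D = 2 ^ L → Realizes E (Q + ∑ i ∈ D, tok (x i)) := by
  induction L with
  | zero =>
    intro ι _ _ hι x hx Used hU
    have e : ι ≃ Bool := Fintype.equivOfCardEq (by simp [hι])
    obtain ⟨E, Q, h1, h2, h3, h4, h5⟩ := h.base (x (e.symm true)) (x (e.symm false)) (hx _) (hx _) Used (by omega)
    refine ⟨E, Q, h1, by simpa using h2, by simpa using h3, fun D hD => ?_⟩
    obtain ⟨i, rfl⟩ := card_eq_one.1 (by simpa using hD)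
    rw [sum_singleton, ← e.symm_apply_apply i]
    cases e i
    exacts [h5, h4]
  | succ L ih =>
    intro ι _ _ hι x hx Used hU
    have hpow : 2 ^ (L + 1) = 2 ^ L + 2 ^ L := by ring
    have e : ι ≃ Fin (2 ^ L + 2 ^ L) × Bool := Fintype.equivOfCardEq (by simp [hι]; ring)
    have hcost : 40 * (L + 1 + 1) * 2 ^ (L + 1) =
        40 * (2 ^ L + 2 ^ L) + 40 * (L + 1) * 2 ^ L + 40 * (L + 1) * 2 ^ L := by ring
    rw [hcost] at hU ⊢
    rw [hpow]
    exact h.template_step (by simp) (ih _ (by simp; ring)) e x hx Used hU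

end ItemSupply

end Absorber

section AbsorberAssembly

open Finset

variable {G : Type} [AddCommGroup G] [DecidableEq G]

theorem Extends.refl (E : Multiset (G × G × ℕ)) : Extends E E 0 := fun F M h => by simpa using h

namespace ItemSupply

variable {Adm : Set (G ⊕ G)} {tok : G → Multiset (G ⊕ G)} {Ok : G → Prop} {B : ℕ}

theorem items (h : ItemSupply Adm tok Ok B) (N : ℕ) (Used : Finset (G ⊕ G)) (hU : #Used + 2 * N ≤ B) :
    ∃ f : Fin N → G, (∀ i, Ok (f i)) ∧ Fresh Adm Used (∑ i, tok (f i)) (2 * N) := by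
  induction N with
  | zero => exact ⟨Fin.elim0, fun i => i.elim0, by simpa using Fresh.zero⟩
  | succ N ih =>
    obtain ⟨f, h1, h2⟩ := ih (by omega)
    obtain ⟨x, h3, h4⟩ := h.item _ (h2.card_union.trans (by omega))
    refine ⟨Fin.snoc f x, fun i => ?_, ?_⟩
    · refine Fin.lastCases ?_ (fun i => ?_) i
      · simpa using h3
      · simpa using h1 i
    · rw [Fin.sum_univ_castSucc]
      simpa [mul_add] using h2.add h4

theorem absorber (h : ItemSupply Adm tok Ok B) (L a : ℕ) (F : Finset G) (hF : ∀ x ∈ F, Ok x)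
    (hc : #F ≤ 2 ^ L) (ha : a ≤ 2 ^ L) (Used : Finset (G ⊕ G)) (hU : #Used + 44 * (L + 1) * 2 ^ L ≤ B) :
    ∃ E M, Short E ∧ Multiset.card E ≤ 44 * (L + 1) * 2 ^ L ∧ Fresh Adm Used M (44 * (L + 1) * 2 ^ L) ∧
      ∀ D ⊆ F, #D = a → Realizes E (M + ∑ x ∈ F \ D, tok x) := by
  have hcost : 4 * 2 ^ L + 40 * (L + 1) * 2 ^ L ≤ 44 * (L + 1) * 2 ^ L := by
    have : 44 * (L + 1) * 2 ^ L = 4 * 2 ^ L + 40 * (L + 1) * 2 ^ L + 4 * L * 2 ^ L := by ring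
    omega
  obtain ⟨z, hz, -⟩ := h.item ∅ (by simp)
  set N := 2 ^ L + a - #F with hN
  obtain ⟨f, h1, h2⟩ := h.items N Used (by omega)
  have h2' := h2.card_union
  obtain ⟨E, Q, h3, h4, h5, h6⟩ := h.template L (F ⊕ (Fin N ⊕ Fin (2 ^ L - a)))
    (by simp [pow_succ]; omega) (Sum.elim (fun x => x) (Sum.elim f fun _ => z))
    (by rintro (x | i | i)
        exacts [hF _ x.2, h1 i, hz]) (Used ∪ (∑ i, tok (f i)).toFinset) (by omega)
  refine ⟨E, ∑ i, tok (f i) + Q, h3, by omega, (h2.add h5).mono (by omega), fun D hD hDa => ?_⟩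
  have h7 := h6 ((univ.filter fun x : F => (x : G) ∉ D).disjSum (univ.disjSum ∅)) (by
    rw [card_disjSum, card_disjSum, card_univ, Fintype.card_fin, card_empty]
    have : #(univ.filter fun x : F => (x : G) ∉ D) = #(F \ D) := by
      rw [← card_map (Function.Embedding.subtype _)]
      congr 1
      ext x
      simp [and_comm]
    rw [this, card_sdiff_of_subset hD]
    have := card_le_card hD
    omega)
  convert h7 using 1
  rw [sum_disjSum, sum_disjSum]
  have : ∑ x ∈ univ.filter (fun x : F => (x : G) ∉ D), tok x = ∑ x ∈ F \ D, tok x := by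
    refine (sum_map (univ.filter fun x : F => (x : G) ∉ D) (Function.Embedding.subtype _) tok).symm.trans ?_
    congr 1
    ext x
    simp [and_comm]
  simp only [Sum.elim_inl, Sum.elim_inr, sum_empty, add_zero]
  rw [this]
  abel

end ItemSupply

/-- Short connecting paths are always available. -/
structure Connectors (Adm : Set (G ⊕ G)) (B : ℕ) : Prop where
  conn : ∀ (S T : G) (Used : Finset (G ⊕ G)), #Used ≤ B → ∃ v v',
    Fresh Adm Used ({Sum.inl v} + {Sum.inr (v - T)} + ({Sum.inl v'} + {Sum.inr (v' - v)}) + {Sum.inr (S - v')}) 5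
  pad : ∀ (T : G) (Used : Finset (G ⊕ G)), #Used ≤ B → ∃ v, Fresh Adm Used ({Sum.inl v} + {Sum.inr (v - T)}) 2

namespace Connectors

variable {Adm : Set (G ⊕ G)} {B : ℕ}

theorem chunk (h : Connectors Adm B) (E : Multiset (G × G × ℕ)) (hE : Short E) (hE0 : E ≠ 0) (Used : Finset (G ⊕ G))
    (hU : #Used + 5 * Multiset.card E ≤ B) : ∃ S T l U, Extends E {(S, T, l)} U ∧ 0 < l ∧ l ≤ 6 * Multiset.card E ∧
      Fresh Adm Used U (5 * Multiset.card E) := by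
  induction E using Multiset.induction_on with
  | empty => exact absurd rfl hE0
  | cons e E ih =>
    obtain ⟨s, t, l⟩ := e
    have hl := hE _ (Multiset.mem_cons_self _ _)
    dsimp only at hl
    by_cases h0 : E = 0
    · subst h0
      exact ⟨s, t, l, 0, Extends.refl _, hl.1, by simp; omega, Fresh.zero.mono (by simp)⟩
    rw [Multiset.card_cons] at hU ⊢
    obtain ⟨S, T, l', U, h1, h2, h3, h4⟩ := ih (fun e he => hE e (Multiset.mem_cons_of_mem he)) h0 (by omega)
    obtain ⟨v, v', hv⟩ := h.conn S t _ (h4.card_union.trans (by omega))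
    refine ⟨s, T, l + 1 + 1 + l', U + ({Sum.inl v} + {Sum.inr (v - t)} + ({Sum.inl v'} + {Sum.inr (v' - v)}) + {Sum.inr (S - v')}),
      ?_, by omega, by omega, (h4.add hv).mono (by omega)⟩
    have p1 : Extends {(s, t, l)} {(s, v', l + 1 + 1)} _ :=
      (Extends.pad (v := v) hl.1).trans (Extends.pad (v := v') (Nat.succ_pos l))
    have p2 := (h1.add p1).trans (by
      rw [add_comm {(S, T, l')}]
      exact Extends.join (Nat.succ_pos (l + 1)) h2)
    rw [add_comm E, Multiset.singleton_add, add_assoc U] at p2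
    exact p2

theorem pads (h : Connectors Adm B) (d : ℕ) : ∀ (S T : G) (l : ℕ), 0 < l → ∀ (Used : Finset (G ⊕ G)), #Used + 2 * d ≤ B →
    ∃ T' U, Extends {(S, T, l)} {(S, T', l + d)} U ∧ Fresh Adm Used U (2 * d) := by
  induction d with
  | zero => exact fun S T l _ Used _ => ⟨T, 0, Extends.refl _, Fresh.zero⟩
  | succ d ih =>
    intro S T l hl Used hU
    obtain ⟨T', U, h1, h2⟩ := ih S T l hl Used (by omega)
    obtain ⟨v, hv⟩ := h.pad T' _ (h2.card_union.trans (by omega))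
    exact ⟨v, _, h1.trans (Extends.pad (by omega)), (h2.add hv).mono (by omega)⟩

theorem line (h : Connectors Adm B) {m : ℕ} (E : Multiset (G × G × ℕ)) (hE : Short E) (hE0 : E ≠ 0)
    (hm : 6 * Multiset.card E ≤ m) (Used : Finset (G ⊕ G)) (hU : #Used + 3 * m ≤ B) :
    ∃ S T U, Extends E {(S, T, m)} U ∧ Fresh Adm Used U (3 * m) := by
  obtain ⟨S, T, l, U, h1, h2, h3, h4⟩ := h.chunk E hE hE0 Used (by omega)
  have := h4.card_union
  obtain ⟨T', U', h5, h6⟩ := h.pads (m - l) S T l h2 (Used ∪ U.toFinset) (by omega)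
  rw [show l + (m - l) = m by omega] at h5
  exact ⟨S, T', _, h1.trans h5, (h4.add h6).mono (by omega)⟩

theorem lines (h : Connectors Adm B) {m g : ℕ} (hg : 6 * g ≤ m) (N : ℕ) : ∀ (E : Multiset (G × G × ℕ)), Short E →
    Multiset.card E ≤ g * N → ∀ (Used : Finset (G ⊕ G)), #Used + 3 * m * N ≤ B →
    ∃ E' U, (∀ e ∈ E', e.2.2 = m) ∧ Multiset.card E' ≤ N ∧ Extends E E' U ∧ Fresh Adm Used U (3 * m * N) := by
  induction N with
  | zero =>
    intro E _ hE Used _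
    obtain rfl : E = 0 := by simpa using hE
    exact ⟨0, 0, by simp, by simp, Extends.refl _, Fresh.zero⟩
  | succ N ih =>
    intro E hS hE Used hU
    rw [mul_add, mul_one] at hU hE
    obtain ⟨l, rfl⟩ := Quot.exists_rep E
    have hl : ((l.take g : List _) : Multiset (G × G × ℕ)) + ((l.drop g : List _) : Multiset (G × G × ℕ)) = Quot.mk _ l := by
      rw [Multiset.coe_add, List.take_append_drop]; rfl
    rw [← hl] at hS hE ⊢
    have hE2 : Multiset.card ((l.drop g : List _) : Multiset (G × G × ℕ)) ≤ g * N := by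
      simp at hE ⊢; omega
    obtain ⟨E', U, h1, h2, h3, h4⟩ := ih _ (fun e he => hS e (Multiset.mem_add.2 (Or.inr he))) hE2 Used (by omega)
    by_cases h0 : ((l.take g : List _) : Multiset (G × G × ℕ)) = 0
    · rw [h0, zero_add]
      exact ⟨E', U, h1, by omega, h3, h4.mono (by rw [mul_add]; omega)⟩
    have := h4.card_union
    obtain ⟨S, T, V, h5, h6⟩ := h.line (m := m) ((l.take g : List _) : Multiset (G × G × ℕ))
      (fun e he => hS e (Multiset.mem_add.2 (Or.inl he))) h0 (by
        have : Multiset.card ((l.take g : List _) : Multiset (G × G × ℕ)) ≤ g := by simp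
        omega) (Used ∪ U.toFinset) (by omega)
    refine ⟨{(S, T, m)} + E', U + V, ?_, by simp; omega, ?_, (h4.add h6).mono (by rw [mul_add]; omega)⟩
    · intro e he
      rcases Multiset.mem_add.1 he with he | he
      · rw [Multiset.mem_singleton.1 he]
      · exact h1 e he
    · rw [add_comm U]
      exact h5.add h3

end Connectors

theorem exists_absorber {Adm : Set (G ⊕ G)} {tokV tokP : G → Multiset (G ⊕ G)} {OkV OkP : G → Prop} {B : ℕ}
    (hV : ItemSupply Adm tokV OkV B) (hP : ItemSupply Adm tokP OkP B) (hC : Connectors Adm B) {L aF aP m g N : ℕ}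
    {F P : Finset G} (hF : ∀ x ∈ F, OkV x) (hPP : ∀ x ∈ P, OkP x) (hcF : #F ≤ 2 ^ L) (hcP : #P ≤ 2 ^ L)
    (haF : aF ≤ 2 ^ L) (haP : aP ≤ 2 ^ L) (hg : 6 * g ≤ m) (hgN : 88 * (L + 1) * 2 ^ L ≤ g * N)
    (Used : Finset (G ⊕ G)) (hU : #Used + (88 * (L + 1) * 2 ^ L + 3 * m * N) ≤ B) :
    ∃ E U, (∀ e ∈ E, e.2.2 = m) ∧ Multiset.card E ≤ N ∧ Fresh Adm Used U (88 * (L + 1) * 2 ^ L + 3 * m * N) ∧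
      ∀ D ⊆ F, #D = aF → ∀ D' ⊆ P, #D' = aP →
        Realizes E (U + (∑ x ∈ F \ D, tokV x + ∑ x ∈ P \ D', tokP x)) := by
  have hcost : 88 * (L + 1) * 2 ^ L = 44 * (L + 1) * 2 ^ L + 44 * (L + 1) * 2 ^ L := by ring
  rw [hcost] at hgN hU ⊢
  obtain ⟨E₁, M₁, a1, a2, a3, a4⟩ := hV.absorber L aF F hF hcF haF Used (by omega)
  have c1 := a3.card_union
  obtain ⟨E₂, M₂, b1, b2, b3, b4⟩ := hP.absorber L aP P hPP hcP haP (Used ∪ M₁.toFinset) (by omega)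
  have c2 := (a3.add b3).card_union
  obtain ⟨E, U, d1, d2, d3, d4⟩ := hC.lines hg N (E₁ + E₂) (a1.add b1) (by rw [Multiset.card_add]; omega)
    (Used ∪ (M₁ + M₂).toFinset) (by omega)
  refine ⟨E, M₁ + M₂ + U, d1, d2, (a3.add b3).add d4, fun D hD hDc D' hD' hDc' => ?_⟩
  have := d3 0 _ (by simpa using (a4 D hD hDc).add (b4 D' hD' hDc'))
  rw [add_zero] at this
  convert this using 1
  abel

end AbsorberAssembly

section Gadgets

open Finset

variable {G : Type} [AddCommGroup G] [DecidableEq G]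

/-- The token multiset of a list of tokens, as an explicit sum of singletons. -/
def tokens (l : List (G ⊕ G)) : Multiset (G ⊕ G) := (l.map fun a => ({a} : Multiset (G ⊕ G))).sum

theorem tokens_eq_coe (l : List (G ⊕ G)) : tokens l = (l : Multiset (G ⊕ G)) := by
  induction l with
  | nil => rfl
  | cons a l ih => rw [tokens, List.map_cons, List.sum_cons, ← tokens, ih]; rfl

theorem Realizes.congr {E E' : Multiset (G × G × ℕ)} {M M' : Multiset (G ⊕ G)} (h : Realizes E M)
    (hE : E = E') (hM : M' = M) : Realizes E' M' := hE ▸ hM.symm ▸ h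

/-- The private tokens of the three-way vertex switch. -/
def vertexPrivate (x₁ x₂ x₃ s s' : G) : List (G ⊕ G) :=
  [Sum.inl s, Sum.inl (x₁ + x₃ - s), Sum.inl (x₁ + x₂ - s), Sum.inl (s + x₃ - x₂), Sum.inl s', Sum.inl (x₁ + x₃ - s'),
    Sum.inr (x₁ - s), Sum.inr (x₂ - s), Sum.inr (x₃ - x₂), Sum.inr (x₁ + x₂ - s - s'), Sum.inr (s + x₃ - x₂ - s')]

theorem realizes_vertexSwitch (x₁ x₂ x₃ s s' : G) : ∀ y ∈ [({Sum.inl x₃} : Multiset (G ⊕ G)), {Sum.inl x₂}, {Sum.inl x₁}],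
    Realizes ({(s, x₁ + x₃ - s, 4)} + {(s', x₁ + x₃ - s', 3)}) (tokens (vertexPrivate x₁ x₂ x₃ s s') + y) := by
  intro y hy
  simp only [List.mem_cons, List.not_mem_nil, or_false] at hy
  rcases hy with rfl | rfl | rfl
  · refine Realizes.congr ((Realizes.path [s, s + x₃ - x₂, x₃, x₁ + x₃ - s]).add (Realizes.path [s', x₁ + x₂ - s, x₁ + x₃ - s'])) rfl ?_
    simp only [pathTokens, tokens, vertexPrivate, List.map_cons, List.map_nil, List.sum_cons, List.sum_nil,
      show s + x₃ - x₂ - s = x₃ - x₂ by abel, show x₃ - (s + x₃ - x₂) = x₂ - s by abel,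
      show x₁ + x₃ - s - x₃ = x₁ - s by abel, show x₁ + x₃ - s' - (x₁ + x₂ - s) = s + x₃ - x₂ - s' by abel]
    abel
  · refine Realizes.congr ((Realizes.path [s, x₂, x₁ + x₂ - s, x₁ + x₃ - s]).add (Realizes.path [s', s + x₃ - x₂, x₁ + x₃ - s'])) rfl ?_
    simp only [pathTokens, tokens, vertexPrivate, List.map_cons, List.map_nil, List.sum_cons, List.sum_nil,
      show x₁ + x₂ - s - x₂ = x₁ - s by abel, show x₁ + x₃ - s - (x₁ + x₂ - s) = x₃ - x₂ by abel,
      show x₁ + x₃ - s' - (s + x₃ - x₂) = x₁ + x₂ - s - s' by abel]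
    abel
  · refine Realizes.congr ((Realizes.path [s, x₁, x₁ + x₂ - s, x₁ + x₃ - s]).add (Realizes.path [s', s + x₃ - x₂, x₁ + x₃ - s'])) rfl ?_
    simp only [pathTokens, tokens, vertexPrivate, List.map_cons, List.map_nil, List.sum_cons, List.sum_nil,
      show x₁ + x₂ - s - x₁ = x₂ - s by abel, show x₁ + x₃ - s - (x₁ + x₂ - s) = x₃ - x₂ by abel,
      show x₁ + x₃ - s' - (s + x₃ - x₂) = x₁ + x₂ - s - s' by abel]
    abel

/-- A path of three vertices through exactly one of `x`, `x'`. -/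
theorem realizes_switch (x x' s : G) : ∀ y ∈ [({Sum.inl x} : Multiset (G ⊕ G)), {Sum.inl x'}],
    Realizes {(s, x + x' - s, 3)} (tokens [Sum.inl s, Sum.inl (x + x' - s), Sum.inr (x - s), Sum.inr (x' - s)] + y) := by
  intro y hy
  simp only [List.mem_cons, List.not_mem_nil, or_false] at hy
  rcases hy with rfl | rfl
  · refine Realizes.congr (Realizes.path [s, x, x + x' - s]) rfl ?_
    simp only [pathTokens, tokens, List.map_cons, List.map_nil, List.sum_cons, List.sum_nil, show x + x' - s - x = x' - s by abel]
    abel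
  · refine Realizes.congr (Realizes.path [s, x', x + x' - s]) rfl ?_
    simp only [pathTokens, tokens, List.map_cons, List.map_nil, List.sum_cons, List.sum_nil, show x + x' - s - x' = x - s by abel]
    abel

/-- The tokens of a pair of colours with sum `w`. -/
def pairTok (w c : G) : Multiset (G ⊕ G) := {Sum.inr c} + {Sum.inr (w - c)}

theorem realizes_slot (w c s : G) : Realizes {(s, s + w, 3)} (tokens [Sum.inl s, Sum.inl (s + w), Sum.inl (s + c)] + pairTok w c) := by
  refine Realizes.congr (Realizes.path [s, s + c, s + w]) rfl ?_
  simp only [pathTokens, pairTok, tokens, List.map_cons, List.map_nil, List.sum_cons, List.sum_nil, show s + c - s = c by abel,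
    show s + w - (s + c) = w - c by abel]
  abel

/-- The private tokens of the three-way pair switch. -/
def pairPrivate (w c₁ c₂ c₃ s s₁ s₂ : G) : List (G ⊕ G) :=
  [Sum.inl s, Sum.inl (s + w), Sum.inl (s + c₁), Sum.inl (s + c₂), Sum.inl (s + c₃),
    Sum.inl s₁, Sum.inl (s + c₁ + (s + c₂) - s₁), Sum.inr (s + c₁ - s₁), Sum.inr (s + c₂ - s₁),
    Sum.inl s₂, Sum.inl (s + c₂ + (s + c₃) - s₂), Sum.inr (s + c₂ - s₂), Sum.inr (s + c₃ - s₂)]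

theorem realizes_pairSwitch (w c₁ c₂ c₃ s s₁ s₂ : G) : ∀ y ∈ [pairTok w c₁, pairTok w c₂, pairTok w c₃],
    Realizes ({(s, s + w, 3)} + {(s₁, s + c₁ + (s + c₂) - s₁, 3)} + {(s₂, s + c₂ + (s + c₃) - s₂, 3)})
      (tokens (pairPrivate w c₁ c₂ c₃ s s₁ s₂) + y) := by
  intro y hy
  simp only [List.mem_cons, List.not_mem_nil, or_false] at hy
  have h1 := realizes_switch (s + c₁) (s + c₂) s₁
  have h2 := realizes_switch (s + c₂) (s + c₃) s₂
  rcases hy with rfl | rfl | rfl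
  · refine Realizes.congr (((realizes_slot w c₁ s).add (h1 {Sum.inl (s + c₂)} (by simp))).add (h2 {Sum.inl (s + c₃)} (by simp))) rfl ?_
    simp only [tokens, pairPrivate, List.map_cons, List.map_nil, List.sum_cons, List.sum_nil]
    abel
  · refine Realizes.congr (((realizes_slot w c₂ s).add (h1 {Sum.inl (s + c₁)} (by simp))).add (h2 {Sum.inl (s + c₃)} (by simp))) rfl ?_
    simp only [tokens, pairPrivate, List.map_cons, List.map_nil, List.sum_cons, List.sum_nil]
    abel
  · refine Realizes.congr (((realizes_slot w c₃ s).add (h1 {Sum.inl (s + c₁)} (by simp))).add (h2 {Sum.inl (s + c₂)} (by simp))) rfl ?_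
    simp only [tokens, pairPrivate, List.map_cons, List.map_nil, List.sum_cons, List.sum_nil]
    abel

end Gadgets

section Shapes

open Finset

/-- Classes of vertices and colours in the first random labelling. -/
inductive Cls | F | Va | Vb | P | NP | Ca | T
  deriving DecidableEq

namespace Cls

/-- Whether a class consists of colours. -/
def isCol : Cls → Bool
  | F => false
  | Va => false
  | Vb => false
  | _ => true

end Cls

/-- A system of `h` linear forms in `r` unknowns, each with a prescribed class. -/
structure Shape where
  r : ℕ
  h : ℕ
  A : Fin h → Fin r → ℤ
  cls : Fin h → Cls

variable {G : Type} [AddCommGroup G] [Fintype G] [DecidableEq G]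

namespace Shape

/-- The values of the forms, as tokens. -/
def pos (S : Shape) (g : Fin S.h → G) (p : Fin S.r → G) (i : Fin S.h) : G ⊕ G :=
  if (S.cls i).isCol then Sum.inr (∑ j, S.A i j • p j + g i) else Sum.inl (∑ j, S.A i j • p j + g i)

/-- Every form has a coefficient `± 1`. -/
def Valid (S : Shape) : Prop := ∀ i, ∃ j, (S.A i j).natAbs = 1

instance (S : Shape) : Decidable S.Valid := inferInstanceAs (Decidable (∀ _, _))

open Classical in
/-- The nondegenerate values of the unknowns. -/
noncomputable def nondeg (S : Shape) (g : Fin S.h → G) : Finset (Fin S.r → G) :=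
  univ.filter fun p => Function.Injective (S.pos g p)

/-- The expected proportion of solutions. -/
noncomputable def density (S : Shape) {α : Type} [Fintype α] (lab : Cls → Finset α) : ℝ :=
  ∏ i, ((#(lab (S.cls i)) : ℝ) / Fintype.card α)

open Classical in
/-- The labelling `ω` has roughly the expected number of solutions of each system of shape `S`. -/
def Good (S : Shape) {α : Type} [Fintype α] (lab : Cls → Finset α) (τ : ℝ) (ω : G ⊕ G → α) : Prop :=
  ∀ g : Fin S.h → G, |(#{p ∈ S.nondeg g | ∀ i, ω (S.pos g p i) ∈ lab (S.cls i)} : ℝ) -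
    #(S.nondeg g) * S.density lab| ≤ τ * (S.h * (Fintype.card G : ℝ) ^ (S.r - 1))

end Shape

theorem card_filter_sum_smul_le {r : ℕ} (B : Fin r → ℤ) {j : Fin r} (hj : (B j).natAbs = 1) (x : G) :
    #{p : Fin r → G | ∑ l, B l • p l = x} ≤ Fintype.card G ^ (r - 1) := by
  have hc : Fintype.card ({l : Fin r // l ≠ j} → G) = Fintype.card G ^ (r - 1) := by
    rw [Fintype.card_fun, Fintype.card_subtype_compl]; simp
  rw [← hc, ← card_univ]
  refine card_le_card_of_injOn (fun p l => p l) (fun _ _ => mem_coe.2 (mem_univ _)) ?_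
  intro p hp q hq hpq
  simp only [coe_filter, mem_univ, true_and, Set.mem_ofPred_eq] at hp hq
  have hne : ∀ l, l ≠ j → p l = q l := fun l hl => congrFun hpq ⟨l, hl⟩
  rw [← add_sum_erase _ _ (mem_univ j)] at hp hq
  rw [← hq, sum_congr rfl fun l hl => by rw [hne l (ne_of_mem_erase hl)]] at hp
  have hp := add_right_cancel hp
  funext l
  by_cases hl : l = j
  · subst hl
    rcases Int.natAbs_eq (B l) with h | h <;> rw [hj] at h <;> simpa [h] using hp
  · exact hne l hl

theorem card_pos_eq_le (S : Shape) (hS : S.Valid) (g : Fin S.h → G) (x : G ⊕ G) (i : Fin S.h) :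
    #{p : Fin S.r → G | S.pos g p i = x} ≤ Fintype.card G ^ (S.r - 1) := by
  obtain ⟨j, hj⟩ := hS i
  refine (card_le_card (monotone_filter_right _ fun p _ hp => ?_)).trans
    (card_filter_sum_smul_le (S.A i) hj (Sum.elim id id x - g i))
  rw [← hp, Shape.pos]
  split <;> simp

theorem exists_good_labelling {α : Type} [Fintype α] [DecidableEq α] [Nonempty α] (lab : Cls → Finset α) {N : ℕ} (S : Fin N → Shape)
    (hS : ∀ i, (S i).Valid) (H : ℕ) (hH : ∀ i, (S i).h ≤ H) (hH' : ∀ i, 0 < (S i).h) (τ : ℝ) (hτ : 0 ≤ τ)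
    (h : 2 * (N * (Fintype.card G : ℝ) ^ H) * Real.exp (-τ ^ 2 / (4 * Fintype.card G)) < 1) :
    ∃ ω : G ⊕ G → α, ∀ i, (S i).Good lab τ ω := by
  classical
  have hn : 0 < Fintype.card G := Fintype.card_pos
  obtain ⟨ω, hω⟩ := exists_labelling (Ω := G ⊕ G) (α := α) (ι := Σ i : Fin N, (Fin (S i).h → G))
    (fun q ω => (#{p ∈ (S q.1).nondeg q.2 | ∀ i, ω ((S q.1).pos q.2 p i) ∈ lab ((S q.1).cls i)} : ℝ))
    (fun q => (S q.1).h * (Fintype.card G : ℝ) ^ ((S q.1).r - 1))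
    (fun q => by have := hH' q.1; positivity) (fun q ω x v => by
      refine abs_card_filter_sub_update_le _ _ (fun i => lab ((S q.1).cls i)) _ (fun x => ?_) ω x v
      have : #{p ∈ (S q.1).nondeg q.2 | ∃ i, (S q.1).pos q.2 p i = x} ≤ (S q.1).h * Fintype.card G ^ ((S q.1).r - 1) := by
        calc _ ≤ #((univ : Finset (Fin (S q.1).h)).biUnion fun i => {p : Fin (S q.1).r → G | (S q.1).pos q.2 p i = x}) := by
              refine card_le_card fun p hp => ?_
              simp only [mem_filter, mem_biUnion, mem_univ, true_and] at hp ⊢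
              exact hp.2
          _ ≤ _ := (card_biUnion_le_card_mul _ _ _ fun i _ => card_pos_eq_le _ (hS _) _ _ i).trans (by simp)
      exact_mod_cast this) τ hτ (by
      refine lt_of_le_of_lt ?_ h
      have e1 : (2 * (Fintype.card (G ⊕ G) : ℝ)) = 4 * Fintype.card G := by rw [Fintype.card_sum]; push_cast; ring
      rw [e1]
      gcongr
      rw [Fintype.card_sigma]
      push_cast
      calc _ ≤ ∑ i : Fin N, (Fintype.card G : ℝ) ^ H := by
            refine sum_le_sum fun i _ => ?_
            rw [Fintype.card_fun, Fintype.card_fin]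
            push_cast
            exact pow_le_pow_right₀ (by exact_mod_cast hn) (hH i)
        _ = _ := by simp)
  refine ⟨ω, fun i g => ?_⟩
  have := hω ⟨i, g⟩
  dsimp only at this
  rw [average_card_filter ((S i).nondeg g) ((S i).pos g) (fun p hp => by simpa [Shape.nondeg] using hp)
    (fun j => lab ((S i).cls j))] at this
  rw [Shape.density]
  convert this

/-- Good labellings provide solutions avoiding a small set of tokens. -/
theorem Shape.Good.exists {S : Shape} {α : Type} [Fintype α] {lab : Cls → Finset α} {τ : ℝ} {ω : G ⊕ G → α}
    (hω : S.Good lab τ ω) (hS : S.Valid) (hr : 0 < S.r) (g : Fin S.h → G)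
    (hcol : ∀ i j, i < j → (S.cls i).isCol = (S.cls j).isCol → (¬ ∃ l, (S.A i l - S.A j l).natAbs = 1) →
      #{p : Fin S.r → G | S.pos g p i = S.pos g p j} ≤ Fintype.card G ^ (S.r - 1))
    (Used : Finset (G ⊕ G)) (hnum : S.h * τ + S.h * #Used < (Fintype.card G - (S.h : ℝ) ^ 2) * S.density lab) :
    ∃ p, Function.Injective (S.pos g p) ∧ ∀ i, ω (S.pos g p i) ∈ lab (S.cls i) ∧ S.pos g p i ∉ Used := by
  classical
  set n := Fintype.card G with hn
  have hn0 : 0 < n := Fintype.card_pos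
  have hcol' : ∀ i j, i ≠ j → #{p : Fin S.r → G | S.pos g p i = S.pos g p j} ≤ n ^ (S.r - 1) := by
    suffices H : ∀ i j, i < j → #{p : Fin S.r → G | S.pos g p i = S.pos g p j} ≤ n ^ (S.r - 1) by
      intro i j hij
      rcases lt_or_gt_of_ne hij with h | h
      · exact H i j h
      · simpa only [eq_comm] using H j i h
    intro i j hij
    by_cases hc : (S.cls i).isCol = (S.cls j).isCol
    · by_cases hl : ∃ l, (S.A i l - S.A j l).natAbs = 1
      · obtain ⟨l, hl⟩ := hl
        refine (card_le_card (monotone_filter_right _ fun p _ hp => ?_)).trans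
          (card_filter_sum_smul_le (fun l => S.A i l - S.A j l) hl (g j - g i))
        simp only [sub_smul, sum_sub_distrib]
        have hp : S.pos g p i = S.pos g p j := hp
        rw [Shape.pos, Shape.pos, hc] at hp
        split at hp <;> simp only [Sum.inr.injEq, Sum.inl.injEq] at hp <;>
        · rw [sub_eq_sub_iff_add_eq_add, hp]; abel
      · exact hcol i j hij hc hl
    · rw [filter_false_of_mem]
      · simp
      · intro p _ hp
        rw [Shape.pos, Shape.pos] at hp
        rcases hi : (S.cls i).isCol <;> rcases hj : (S.cls j).isCol <;> simp_all
  have hT : n ^ S.r ≤ #(S.nondeg g) + S.h * S.h * n ^ (S.r - 1) := by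
    have h1 : Fintype.card (Fin S.r → G) = n ^ S.r := by simp [hn]
    rw [← h1, ← card_univ, ← card_filter_add_card_filter_not (fun p => Function.Injective (S.pos g p))]
    refine Nat.add_le_add_left ?_ _
    calc _ ≤ #(((univ : Finset (Fin S.h × Fin S.h)).filter fun q => q.1 ≠ q.2).biUnion
          fun q => {p : Fin S.r → G | S.pos g p q.1 = S.pos g p q.2}) := by
          refine card_le_card fun p hp => ?_
          simp only [mem_filter, mem_univ, true_and, Function.Injective, not_forall] at hp
          obtain ⟨i, j, h1, h2⟩ := hp
          simp only [mem_biUnion, mem_filter, mem_univ, true_and]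
          exact ⟨(i, j), h2, h1⟩
      _ ≤ #((univ : Finset (Fin S.h × Fin S.h)).filter fun q => q.1 ≠ q.2) * n ^ (S.r - 1) :=
          card_biUnion_le_card_mul _ _ _ fun q hq => hcol' _ _ (mem_filter.1 hq).2
      _ ≤ _ := by
          refine Nat.mul_le_mul_right _ ((card_filter_le _ _).trans ?_)
          simp
  by_contra hcon
  push Not at hcon
  have hsub : #{p ∈ S.nondeg g | ∀ i, ω (S.pos g p i) ∈ lab (S.cls i)} ≤ S.h * #Used * n ^ (S.r - 1) := by
    calc _ ≤ #((univ ×ˢ Used : Finset (Fin S.h × (G ⊕ G))).biUnion fun q => {p : Fin S.r → G | S.pos g p q.1 = q.2}) := by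
          refine card_le_card fun p hp => ?_
          rw [mem_filter, Shape.nondeg, mem_filter] at hp
          obtain ⟨i, hi⟩ := hcon p hp.1.2
          simp only [mem_biUnion, mem_filter, mem_univ, true_and, mem_product]
          exact ⟨(i, _), hi (hp.2 i), rfl⟩
      _ ≤ #(univ ×ˢ Used : Finset (Fin S.h × (G ⊕ G))) * n ^ (S.r - 1) :=
          card_biUnion_le_card_mul _ _ _ fun q _ => card_pos_eq_le S hS _ _ _
      _ = _ := by simp
  have hdens : 0 ≤ S.density lab := prod_nonneg fun i _ => by positivity
  have h1 := (abs_le.1 (hω g)).1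
  have hpow : (n : ℝ) ^ S.r = n * n ^ (S.r - 1) := by
    rw [← pow_succ', Nat.sub_add_cancel hr]
  have hT' : (n : ℝ) * n ^ (S.r - 1) ≤ #(S.nondeg g) + S.h * S.h * n ^ (S.r - 1) := by
    rw [← hpow]; exact_mod_cast hT
  have hsub' : (#{p ∈ S.nondeg g | ∀ i, ω (S.pos g p i) ∈ lab (S.cls i)} : ℝ) ≤ S.h * #Used * n ^ (S.r - 1) := by
    exact_mod_cast hsub
  have hM : (0 : ℝ) < (n : ℝ) ^ (S.r - 1) := by positivity
  have h2 : (n - (S.h : ℝ) ^ 2) * (n : ℝ) ^ (S.r - 1) * S.density lab ≤ #(S.nondeg g) * S.density lab :=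
    mul_le_mul_of_nonneg_right (by linarith) hdens
  have h3 := mul_lt_mul_of_pos_right hnum hM
  rw [← hn] at h1
  linarith

end Shapes

set_option linter.unusedSimpArgs false

section ShapeList

open Finset

/-- Two linked vertex switches sharing two fresh vertices. -/
def vertexRowShape : Shape where
  r := 6
  h := 24
  A :=
    ![![0, 0, 1, 0, 0, 0],
    ![0, 1, -1, 0, 0, 0],
    ![1, 1, -1, 0, 0, 0],
    ![-1, 0, 1, 0, 0, 0],
    ![0, 0, 0, 1, 0, 0],
    ![0, 1, 0, -1, 0, 0],
    ![0, 1, -1, 0, 0, 0],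
    ![1, 0, -1, 0, 0, 0],
    ![-1, 0, 0, 0, 0, 0],
    ![1, 1, -1, -1, 0, 0],
    ![-1, 0, 1, -1, 0, 0],
    ![0, 0, 0, 0, 1, 0],
    ![1, 0, 0, 0, -1, 0],
    ![1, 1, 0, 0, -1, 0],
    ![0, -1, 0, 0, 1, 0],
    ![0, 0, 0, 0, 0, 1],
    ![1, 0, 0, 0, 0, -1],
    ![1, 0, 0, 0, -1, 0],
    ![0, 1, 0, 0, -1, 0],
    ![0, -1, 0, 0, 0, 0],
    ![1, 1, 0, 0, -1, -1],
    ![0, -1, 0, 0, 1, -1],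
    ![1, 0, 0, 0, 0, 0],
    ![0, 1, 0, 0, 0, 0]]
  cls := ![.Va, .Va, .Va, .Va, .Va, .Va, .Ca, .Ca, .Ca, .Ca, .Ca, .Va, .Va, .Va, .Va, .Va, .Va, .Ca, .Ca, .Ca, .Ca, .Ca, .Va, .Va]

/-- A chain of two vertex switches. -/
def vertexBaseShape : Shape where
  r := 3
  h := 9
  A := ![![0, 1, 0],
    ![1, -1, 0],
    ![0, -1, 0],
    ![1, -1, 0],
    ![0, 0, 1],
    ![1, 0, -1],
    ![1, 0, -1],
    ![0, 0, -1],
    ![1, 0, 0]]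
  cls := ![.Va, .Va, .Ca, .Ca, .Va, .Va, .Ca, .Ca, .Va]

/-- A single vertex. -/
def vertexShape : Shape where
  r := 1
  h := 1
  A := ![![1]]
  cls := ![.Va]

/-- Two linked pair switches sharing two fresh pairs. -/
def pairRowShape : Shape where
  r := 8
  h := 30
  A :=
    ![![0, 0, 1, 0, 0, 0, 0, 0],
    ![0, 0, 1, 0, 0, 0, 0, 0],
    ![0, 0, 1, 0, 0, 0, 0, 0],
    ![1, 0, 1, 0, 0, 0, 0, 0],
    ![0, 1, 1, 0, 0, 0, 0, 0],
    ![0, 0, 0, 1, 0, 0, 0, 0],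
    ![1, 0, 2, -1, 0, 0, 0, 0],
    ![0, 0, 1, -1, 0, 0, 0, 0],
    ![1, 0, 1, -1, 0, 0, 0, 0],
    ![0, 0, 0, 0, 1, 0, 0, 0],
    ![1, 1, 2, 0, -1, 0, 0, 0],
    ![1, 0, 1, 0, -1, 0, 0, 0],
    ![0, 1, 1, 0, -1, 0, 0, 0],
    ![0, 0, 0, 0, 0, 1, 0, 0],
    ![0, 0, 0, 0, 0, 1, 0, 0],
    ![0, 0, 0, 0, 0, 1, 0, 0],
    ![1, 0, 0, 0, 0, 1, 0, 0],
    ![0, 1, 0, 0, 0, 1, 0, 0],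
    ![0, 0, 0, 0, 0, 0, 1, 0],
    ![1, 0, 0, 0, 0, 2, -1, 0],
    ![0, 0, 0, 0, 0, 1, -1, 0],
    ![1, 0, 0, 0, 0, 1, -1, 0],
    ![0, 0, 0, 0, 0, 0, 0, 1],
    ![1, 1, 0, 0, 0, 2, 0, -1],
    ![1, 0, 0, 0, 0, 1, 0, -1],
    ![0, 1, 0, 0, 0, 1, 0, -1],
    ![1, 0, 0, 0, 0, 0, 0, 0],
    ![-1, 0, 0, 0, 0, 0, 0, 0],
    ![0, 1, 0, 0, 0, 0, 0, 0],
    ![0, -1, 0, 0, 0, 0, 0, 0]]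
  cls := ![.Va, .Va, .Va, .Va, .Va, .Va, .Va, .Ca, .Ca, .Va, .Va, .Ca, .Ca, .Va, .Va, .Va, .Va, .Va, .Va, .Va, .Ca, .Ca, .Va, .Va, .Ca, .Ca, .Ca, .Ca, .Ca, .Ca]

/-- A chain of two pair switches. -/
def pairBaseShape : Shape where
  r := 5
  h := 18
  A := ![![0, 1, 0, 0, 0],
    ![0, 1, 0, 0, 0],
    ![0, 1, 0, 0, 0],
    ![1, 1, 0, 0, 0],
    ![0, 0, 1, 0, 0],
    ![1, 2, -1, 0, 0],
    ![0, 1, -1, 0, 0],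
    ![1, 1, -1, 0, 0],
    ![0, 0, 0, 1, 0],
    ![0, 0, 0, 1, 0],
    ![1, 0, 0, 1, 0],
    ![0, 0, 0, 1, 0],
    ![0, 0, 0, 0, 1],
    ![1, 0, 0, 2, -1],
    ![1, 0, 0, 1, -1],
    ![0, 0, 0, 1, -1],
    ![1, 0, 0, 0, 0],
    ![-1, 0, 0, 0, 0]]
  cls := ![.Va, .Va, .Va, .Va, .Va, .Va, .Ca, .Ca, .Va, .Va, .Va, .Va, .Va, .Va, .Ca, .Ca, .Ca, .Ca]

/-- A pair of colours with prescribed sum. -/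
def pairShape : Shape where
  r := 1
  h := 2
  A := ![![1],
    ![-1]]
  cls := ![.Ca, .Ca]

/-- A connecting path with two interior vertices. -/
def connShape : Shape where
  r := 2
  h := 5
  A := ![![1, 0],
    ![1, 0],
    ![0, 1],
    ![-1, 1],
    ![0, -1]]
  cls := ![.Va, .Ca, .Va, .Ca, .Ca]

/-- A vertex prolonging a path. -/
def padShape : Shape where
  r := 1
  h := 2
  A := ![![1],
    ![1]]
  cls := ![.Va, .Ca]

variable {G : Type} [AddCommGroup G] [Fintype G] [DecidableEq G]

theorem vertexRowShape_pos (x x' : G) (p : Fin 6 → G) : List.ofFn (vertexRowShape.pos ![0, x, 0, x, 0, x, 0, 0, x, 0, x, 0, x', 0, x', 0, x', 0, 0, x', 0, x', 0, 0] p) =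
    [Sum.inl (p 2), Sum.inl (p 1 + x - p 2), Sum.inl (p 1 + p 0 - p 2), Sum.inl (p 2 + x - p 0), Sum.inl (p 3), Sum.inl (p 1 + x - p 3), Sum.inr (p 1 - p 2), Sum.inr (p 0 - p 2), Sum.inr (x - p 0), Sum.inr (p 1 + p 0 - p 2 - p 3), Sum.inr (p 2 + x - p 0 - p 3), Sum.inl (p 4), Sum.inl (p 0 + x' - p 4), Sum.inl (p 0 + p 1 - p 4), Sum.inl (p 4 + x' - p 1), Sum.inl (p 5), Sum.inl (p 0 + x' - p 5), Sum.inr (p 0 - p 4), Sum.inr (p 1 - p 4), Sum.inr (x' - p 1), Sum.inr (p 0 + p 1 - p 4 - p 5), Sum.inr (p 4 + x' - p 1 - p 5), Sum.inl (p 0), Sum.inl (p 1)] := by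
  simp [vertexRowShape, Shape.pos, Cls.isCol, List.ofFn_succ, Fin.sum_univ_succ]
  try abel_nf
  try trivial

theorem vertexRowShape_valid : vertexRowShape.Valid := by decide

theorem vertexBaseShape_pos (x x' : G) (p : Fin 3 → G) : List.ofFn (vertexBaseShape.pos ![0, x, x, 0, 0, x', 0, x', 0] p) =
    [Sum.inl (p 1), Sum.inl (x + p 0 - p 1), Sum.inr (x - p 1), Sum.inr (p 0 - p 1), Sum.inl (p 2), Sum.inl (p 0 + x' - p 2), Sum.inr (p 0 - p 2), Sum.inr (x' - p 2), Sum.inl (p 0)] := by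
  simp [vertexBaseShape, Shape.pos, Cls.isCol, List.ofFn_succ, Fin.sum_univ_succ]
  try abel_nf
  try trivial

theorem vertexBaseShape_valid : vertexBaseShape.Valid := by decide

theorem vertexShape_pos (p : Fin 1 → G) : List.ofFn (vertexShape.pos ![0] p) =
    [Sum.inl (p 0)] := by
  simp [vertexShape, Shape.pos, Cls.isCol, List.ofFn_succ, Fin.sum_univ_succ]
  try abel_nf
  try trivial

theorem vertexShape_valid : vertexShape.Valid := by decide

theorem pairRowShape_pos (w c c' : G) (p : Fin 8 → G) : List.ofFn (pairRowShape.pos ![0, w, c, 0, 0, 0, c, c, 0, 0, 0, 0, 0, 0, w, c', 0, 0, 0, c', c', 0, 0, 0, 0, 0, 0, w, 0, w] p) =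
    [Sum.inl (p 2), Sum.inl (p 2 + w), Sum.inl (p 2 + c), Sum.inl (p 2 + p 0), Sum.inl (p 2 + p 1), Sum.inl (p 3), Sum.inl (p 2 + c + p 2 + p 0 - p 3), Sum.inr (p 2 + c - p 3), Sum.inr (p 2 + p 0 - p 3), Sum.inl (p 4), Sum.inl (p 2 + p 0 + p 2 + p 1 - p 4), Sum.inr (p 2 + p 0 - p 4), Sum.inr (p 2 + p 1 - p 4), Sum.inl (p 5), Sum.inl (p 5 + w), Sum.inl (p 5 + c'), Sum.inl (p 5 + p 0), Sum.inl (p 5 + p 1), Sum.inl (p 6), Sum.inl (p 5 + c' + p 5 + p 0 - p 6), Sum.inr (p 5 + c' - p 6), Sum.inr (p 5 + p 0 - p 6), Sum.inl (p 7), Sum.inl (p 5 + p 0 + p 5 + p 1 - p 7), Sum.inr (p 5 + p 0 - p 7), Sum.inr (p 5 + p 1 - p 7), Sum.inr (p 0), Sum.inr (w - p 0), Sum.inr (p 1), Sum.inr (w - p 1)] := by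
  simp [pairRowShape, Shape.pos, Cls.isCol, List.ofFn_succ, Fin.sum_univ_succ]
  try abel_nf
  try trivial

theorem pairRowShape_valid : pairRowShape.Valid := by decide

theorem pairBaseShape_pos (w c c' : G) (p : Fin 5 → G) : List.ofFn (pairBaseShape.pos ![0, w, c, 0, 0, c, c, 0, 0, w, 0, c', 0, c', 0, c', 0, w] p) =
    [Sum.inl (p 1), Sum.inl (p 1 + w), Sum.inl (p 1 + c), Sum.inl (p 1 + p 0), Sum.inl (p 2), Sum.inl (p 1 + c + p 1 + p 0 - p 2), Sum.inr (p 1 + c - p 2), Sum.inr (p 1 + p 0 - p 2), Sum.inl (p 3), Sum.inl (p 3 + w), Sum.inl (p 3 + p 0), Sum.inl (p 3 + c'), Sum.inl (p 4), Sum.inl (p 3 + p 0 + p 3 + c' - p 4), Sum.inr (p 3 + p 0 - p 4), Sum.inr (p 3 + c' - p 4), Sum.inr (p 0), Sum.inr (w - p 0)] := by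
  simp [pairBaseShape, Shape.pos, Cls.isCol, List.ofFn_succ, Fin.sum_univ_succ]
  try abel_nf
  try trivial

theorem pairBaseShape_valid : pairBaseShape.Valid := by decide

theorem pairShape_pos (w : G) (p : Fin 1 → G) : List.ofFn (pairShape.pos ![0, w] p) =
    [Sum.inr (p 0), Sum.inr (w - p 0)] := by
  simp [pairShape, Shape.pos, Cls.isCol, List.ofFn_succ, Fin.sum_univ_succ]
  try abel_nf
  try trivial

theorem pairShape_valid : pairShape.Valid := by decide

theorem connShape_pos (S T : G) (p : Fin 2 → G) : List.ofFn (connShape.pos ![0, -T, 0, 0, S] p) =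
    [Sum.inl (p 0), Sum.inr (p 0 - T), Sum.inl (p 1), Sum.inr (p 1 - p 0), Sum.inr (S - p 1)] := by
  simp [connShape, Shape.pos, Cls.isCol, List.ofFn_succ, Fin.sum_univ_succ]
  try abel_nf
  try trivial

theorem connShape_valid : connShape.Valid := by decide

theorem padShape_pos (T : G) (p : Fin 1 → G) : List.ofFn (padShape.pos ![0, -T] p) =
    [Sum.inl (p 0), Sum.inr (p 0 - T)] := by
  simp [padShape, Shape.pos, Cls.isCol, List.ofFn_succ, Fin.sum_univ_succ]
  try abel_nf
  try trivial

theorem padShape_valid : padShape.Valid := by decide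

end ShapeList

section Supply

open Finset

variable {G : Type} [AddCommGroup G] [Fintype G] [DecidableEq G]

/-- The tokens available to the absorber. -/
def admissible {α : Type} (lab : Cls → Finset α) (ω : G ⊕ G → α) : Set (G ⊕ G) :=
  {a | ω a ∈ lab (Sum.elim (fun _ => Cls.Va) (fun _ => Cls.Ca) a)}

/-- Numerical conditions under which good labellings provide gadgets avoiding `B` tokens. -/
structure Ample (G : Type) [Fintype G] {α : Type} [Fintype α] (lab : Cls → Finset α) (τ : ℝ) (B : ℕ) : Prop where
  nonneg : 0 ≤ τ
  vertex : (1 : ℝ) / 64 ≤ #(lab .Va) / Fintype.card α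
  colour : (1 : ℝ) / 64 ≤ #(lab .Ca) / Fintype.card α
  bound : 30 * τ + 30 * (B + 2) < ((Fintype.card G : ℝ) - 900) * (1 / 64) ^ 30

variable {α : Type} [Fintype α] {lab : Cls → Finset α} {τ : ℝ} {ω : G ⊕ G → α} {B : ℕ}

theorem Shape.Good.exists_fresh {S : Shape} (hA : Ample G lab τ B) (hω : S.Good lab τ ω) (hS : S.Valid)
    (hr : 0 < S.r) (hh : S.h ≤ 30) (hcls : ∀ i, S.cls i = .Va ∨ S.cls i = .Ca) (g : Fin S.h → G)
    {l : (Fin S.r → G) → List (G ⊕ G)} (hl : ∀ p, List.ofFn (S.pos g p) = l p)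
    (hcol : ∀ i j : Fin S.h, i < j → (S.cls i).isCol = (S.cls j).isCol → (¬ ∃ l, (S.A i l - S.A j l).natAbs = 1) →
      #{p : Fin S.r → G | (l p)[i.val]? = (l p)[j.val]?} ≤ Fintype.card G ^ (S.r - 1))
    (Used : Finset (G ⊕ G)) (hU : #Used ≤ B + 2) :
    ∃ p, Fresh (admissible lab ω) Used (tokens (l p)) S.h := by
  have hd : ∀ i, (1 : ℝ) / 64 ≤ #(lab (S.cls i)) / Fintype.card α := fun i => by
    rcases hcls i with h | h <;> rw [h]
    exacts [hA.vertex, hA.colour]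
  have hdens : ((1 : ℝ) / 64) ^ 30 ≤ S.density lab := by
    calc ((1 : ℝ) / 64) ^ 30 ≤ (1 / 64) ^ S.h := pow_le_pow_of_le_one (by norm_num) (by norm_num) hh
      _ = ∏ _i : Fin S.h, (1 : ℝ) / 64 := by simp
      _ ≤ _ := prod_le_prod (fun _ _ => by norm_num) fun i _ => hd i
  have hh' : (S.h : ℝ) ≤ 30 := by exact_mod_cast hh
  have hU' : (#Used : ℝ) ≤ B + 2 := by exact_mod_cast hU
  have hb := hA.bound
  have hτ := hA.nonneg
  have hn : 0 < (Fintype.card G : ℝ) - 900 := by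
    by_contra hcon
    have : ((Fintype.card G : ℝ) - 900) * (1 / 64) ^ 30 ≤ 0 := mul_nonpos_of_nonpos_of_nonneg (by linarith) (by positivity)
    have : (0 : ℝ) ≤ B := by positivity
    linarith
  obtain ⟨p, hp, hp'⟩ := hω.exists hS hr g (fun i j h h' h'' => by simpa [← hl] using hcol i j h h' h'') Used (by
    calc (S.h : ℝ) * τ + S.h * #Used ≤ 30 * τ + 30 * (B + 2) := by gcongr
      _ < _ := hb
      _ ≤ (Fintype.card G - (S.h : ℝ) ^ 2) * S.density lab := by
        refine mul_le_mul ?_ hdens (by positivity) ?_ <;> nlinarith)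
  refine ⟨p, ?_⟩
  rw [tokens_eq_coe, ← hl]
  refine ⟨?_, ?_, ?_, by simp⟩
  · rw [Multiset.coe_nodup, List.nodup_ofFn]; exact hp
  · intro a ha
    rw [Multiset.mem_coe, List.mem_ofFn] at ha
    obtain ⟨i, rfl⟩ := ha
    have h1 := (hp' i).1
    simp only [admissible, Set.mem_ofPred_eq]
    have : (Sum.elim (fun _ => Cls.Va) (fun _ => Cls.Ca) (S.pos g p i)) = S.cls i := by
      rcases hcls i with h | h <;> simp [Shape.pos, h, Cls.isCol]
    rwa [this]
  · intro a ha
    rw [Multiset.mem_coe, List.mem_ofFn] at ha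
    obtain ⟨i, rfl⟩ := ha
    exact (hp' i).2

theorem card_filter_le_of_double {r : ℕ} {w : G} (hw : #{c : G | c + c = w} ≤ 1) (j : Fin r) (Q : (Fin r → G) → Prop)
    [DecidablePred Q] (hQ : ∀ p, Q p → p j + p j = w) : #{p : Fin r → G | Q p} ≤ Fintype.card G ^ (r - 1) := by
  calc _ ≤ #(({c : G | c + c = w} : Finset G).biUnion fun c => {p : Fin r → G | ∑ l, (Pi.single j 1 : Fin r → ℤ) l • p l = c}) := by
        refine card_le_card fun p hp => ?_
        simp only [mem_biUnion, mem_filter, mem_univ, true_and]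
        refine ⟨p j, hQ p (by simpa using hp), ?_⟩
        simp [Pi.single_apply, ite_smul]
    _ ≤ _ := card_biUnion_le_card_mul _ _ _ fun c _ => card_filter_sum_smul_le _ (j := j) (by simp) c
    _ ≤ _ := by simpa using Nat.mul_le_mul_right (Fintype.card G ^ (r - 1)) hw

theorem card_filter_le_of_false {r : ℕ} (Q : (Fin r → G) → Prop)
    [DecidablePred Q] (hQ : ∀ p, ¬ Q p) : #{p : Fin r → G | Q p} ≤ Fintype.card G ^ (r - 1) := by
  rw [filter_false_of_mem fun p _ => hQ p]; simp

theorem Short.singleton {a : G × G × ℕ} (h : 0 < a.2.2 ∧ a.2.2 ≤ 4) : Short ({a} : Multiset (G × G × ℕ)) := by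
  intro e he
  rw [Multiset.mem_singleton] at he
  exact he ▸ h

theorem Fresh.of_subset {Adm : Set (G ⊕ G)} {Used Used' : Finset (G ⊕ G)} {M : Multiset (G ⊕ G)} {c : ℕ}
    (h : Fresh Adm Used' M c) (hU : Used ⊆ Used') : Fresh Adm Used M c :=
  ⟨h.nodup, h.adm, fun a ha ha' => h.fresh a ha (hU ha'), h.card_le⟩

theorem itemSupply_vertex (hA : Ample G lab τ B) (h1 : vertexRowShape.Good lab τ ω) (h2 : vertexBaseShape.Good lab τ ω)
    (h3 : vertexShape.Good lab τ ω) :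
    ItemSupply (admissible lab ω) (fun v => {Sum.inl v}) (fun _ => True) B where
  row x x' _ _ Used hU := by
    have hrig : ∀ i j, i < j → (vertexRowShape.cls i).isCol = (vertexRowShape.cls j).isCol →
      ∃ l, (vertexRowShape.A i l - vertexRowShape.A j l).natAbs = 1 := by decide
    obtain ⟨(p : Fin 6 → G), hp⟩ := h1.exists_fresh hA vertexRowShape_valid (by decide) (by decide) (by decide)
      ![0, x, 0, x, 0, x, 0, 0, x, 0, x, 0, x', 0, x', 0, x', 0, 0, x', 0, x', 0, 0]
      (vertexRowShape_pos x x') (fun i j h h' h'' => absurd (hrig i j h h') h'') Used (by omega)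
    refine ⟨p 0, p 1, ({(p 2, p 1 + x - p 2, 4)} + {(p 3, p 1 + x - p 3, 3)}) + ({(p 4, p 0 + x' - p 4, 4)} + {(p 5, p 0 + x' - p 5, 3)}),
      tokens (vertexPrivate (p 1) (p 0) x (p 2) (p 3)) + tokens (vertexPrivate (p 0) (p 1) x' (p 4) (p 5)), trivial, trivial,
      ?_, by simp, ?_, ?_⟩
    · exact ((Short.singleton (by simp)).add (Short.singleton (by simp))).add ((Short.singleton (by simp)).add (Short.singleton (by simp)))
    · convert hp.mono (show vertexRowShape.h ≤ 40 by decide) using 1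
      simp only [tokens, vertexPrivate, List.map_cons, List.map_nil, List.sum_cons, List.sum_nil]
      abel
    · intro y hy y' hy'
      have r1 := realizes_vertexSwitch (p 1) (p 0) x (p 2) (p 3) y hy
      have r2 := realizes_vertexSwitch (p 0) (p 1) x' (p 4) (p 5) y' (by
        simp only [List.mem_cons, List.not_mem_nil, or_false] at hy' ⊢; tauto)
      exact (r1.add r2).congr rfl (by abel)
  base x x' _ _ Used hU := by
    have hrig : ∀ i j, i < j → (vertexBaseShape.cls i).isCol = (vertexBaseShape.cls j).isCol →
      ∃ l, (vertexBaseShape.A i l - vertexBaseShape.A j l).natAbs = 1 := by decide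
    obtain ⟨(p : Fin 3 → G), hp⟩ := h2.exists_fresh hA vertexBaseShape_valid (by decide) (by decide) (by decide)
      ![0, x, x, 0, 0, x', 0, x', 0]
      (vertexBaseShape_pos x x') (fun i j h h' h'' => absurd (hrig i j h h') h'') Used (by omega)
    have r1 := realizes_switch x (p 0) (p 1)
    have r2 := realizes_switch (p 0) x' (p 2)
    refine ⟨{(p 1, x + p 0 - p 1, 3)} + {(p 2, p 0 + x' - p 2, 3)}, _, ?_, by simp, hp.mono (by decide), ?_, ?_⟩
    · exact (Short.singleton (by simp)).add (Short.singleton (by simp))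
    · refine ((r1 {Sum.inl x} (by simp)).add (r2 {Sum.inl (p 0)} (by simp))).congr rfl ?_
      simp only [tokens, List.map_cons, List.map_nil, List.sum_cons, List.sum_nil]
      abel
    · refine ((r1 {Sum.inl (p 0)} (by simp)).add (r2 {Sum.inl x'} (by simp))).congr rfl ?_
      simp only [tokens, List.map_cons, List.map_nil, List.sum_cons, List.sum_nil]
      abel
  item Used hU := by
    obtain ⟨(p : Fin 1 → G), hp⟩ := h3.exists_fresh hA vertexShape_valid (by decide) (by decide) (by decide)
      ![0] vertexShape_pos (fun i j h => absurd h (by revert i j; decide)) Used (by omega)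
    exact ⟨p 0, trivial, hp.mono (by decide)⟩

theorem connectors_of_good (hA : Ample G lab τ B) (h1 : connShape.Good lab τ ω) (h2 : padShape.Good lab τ ω) :
    Connectors (admissible lab ω) B where
  conn S T Used hU := by
    have hrig : ∀ i j, i < j → (connShape.cls i).isCol = (connShape.cls j).isCol →
      ∃ l, (connShape.A i l - connShape.A j l).natAbs = 1 := by decide
    obtain ⟨(p : Fin 2 → G), hp⟩ := h1.exists_fresh hA connShape_valid (by decide) (by decide) (by decide)
      ![0, -T, 0, 0, S] (connShape_pos S T) (fun i j h h' h'' => absurd (hrig i j h h') h'') Used (by omega)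
    refine ⟨p 0, p 1, ?_⟩
    refine (congrArg (fun M => Fresh _ _ M 5) ?_).mp hp
    simp only [tokens, List.map_cons, List.map_nil, List.sum_cons, List.sum_nil]
    abel
  pad T Used hU := by
    have hrig : ∀ i j, i < j → (padShape.cls i).isCol = (padShape.cls j).isCol →
      ∃ l, (padShape.A i l - padShape.A j l).natAbs = 1 := by decide
    obtain ⟨(p : Fin 1 → G), hp⟩ := h2.exists_fresh hA padShape_valid (by decide) (by decide) (by decide)
      ![0, -T] (padShape_pos T) (fun i j h h' h'' => absurd (hrig i j h h') h'') Used (by omega)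
    exact ⟨p 0, hp⟩

theorem realizes_pairSwitch_two (w c₁ c₂ s s₁ : G) : ∀ y ∈ [pairTok w c₁, pairTok w c₂],
    Realizes ({(s, s + w, 3)} + {(s₁, s + c₁ + (s + c₂) - s₁, 3)})
      (tokens [Sum.inl s, Sum.inl (s + w), Sum.inl (s + c₁), Sum.inl (s + c₂), Sum.inl s₁,
        Sum.inl (s + c₁ + (s + c₂) - s₁), Sum.inr (s + c₁ - s₁), Sum.inr (s + c₂ - s₁)] + y) := by
  intro y hy
  simp only [List.mem_cons, List.not_mem_nil, or_false] at hy
  have h1 := realizes_switch (s + c₁) (s + c₂) s₁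
  rcases hy with rfl | rfl
  · refine ((realizes_slot w c₁ s).add (h1 {Sum.inl (s + c₂)} (by simp))).congr rfl ?_
    simp only [tokens, List.map_cons, List.map_nil, List.sum_cons, List.sum_nil]
    abel
  · refine ((realizes_slot w c₂ s).add (h1 {Sum.inl (s + c₁)} (by simp))).congr rfl ?_
    simp only [tokens, List.map_cons, List.map_nil, List.sum_cons, List.sum_nil]
    abel

theorem itemSupply_pair {w : G} (hw0 : w ≠ 0) (hw : #{c : G | c + c = w} ≤ 1) (hA : Ample G lab τ B)
    (h1 : pairRowShape.Good lab τ ω) (h2 : pairBaseShape.Good lab τ ω) (h3 : pairShape.Good lab τ ω) :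
    ItemSupply (admissible lab ω) (pairTok w) (fun c => c ≠ 0 ∧ c ≠ w) B where
  row c c' hc hc' Used hU := by
    have hbad : ∀ i j, i < j → (pairRowShape.cls i).isCol = (pairRowShape.cls j).isCol →
      (¬∃ l, (pairRowShape.A i l - pairRowShape.A j l).natAbs = 1) → (i.val, j.val) ∈
      [(0, 1), (0, 2), (1, 2), (13, 14), (13, 15), (14, 15), (26, 27), (28, 29)] := by decide
    have hU' : #(Used ∪ {Sum.inr 0, Sum.inr w}) ≤ B + 2 :=
      (card_union_le _ _).trans (Nat.add_le_add hU card_le_two)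
    obtain ⟨(p : Fin 8 → G), hp⟩ := h1.exists_fresh hA pairRowShape_valid (by decide) (by decide) (by decide)
      ![0, w, c, 0, 0, 0, c, c, 0, 0, 0, 0, 0, 0, w, c', 0, 0, 0, c', c', 0, 0, 0, 0, 0, 0, w, 0, w]
      (pairRowShape_pos w c c') (fun i j h h' h'' => by
        have hb := hbad i j h h' h''
        revert hb
        generalize i.val = a
        generalize j.val = b
        intro hb
        simp only [List.mem_cons, List.not_mem_nil, or_false, Prod.mk.injEq] at hb
        rcases hb with ⟨rfl, rfl⟩ | ⟨rfl, rfl⟩ | ⟨rfl, rfl⟩ | ⟨rfl, rfl⟩ | ⟨rfl, rfl⟩ | ⟨rfl, rfl⟩ | ⟨rfl, rfl⟩ | ⟨rfl, rfl⟩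
        · refine card_filter_le_of_false _ fun p hp => hw0 ?_
          simpa using hp
        · refine card_filter_le_of_false _ fun p hp => hc.1 ?_
          simpa [eq_comm] using hp
        · refine card_filter_le_of_false _ fun p hp => hc.2 ?_
          simpa [eq_comm] using hp
        · refine card_filter_le_of_false _ fun p hp => hw0 ?_
          simpa using hp
        · refine card_filter_le_of_false _ fun p hp => hc'.1 ?_
          simpa [eq_comm] using hp
        · refine card_filter_le_of_false _ fun p hp => hc'.2 ?_
          simpa [eq_comm] using hp
        · refine card_filter_le_of_double hw (r := 8) 0 _ fun p hp => ?_
          have : p 0 = w - p 0 := by simpa using hp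
          nth_rw 1 [this]; abel
        · refine card_filter_le_of_double hw (r := 8) 1 _ fun p hp => ?_
          have : p 1 = w - p 1 := by simpa using hp
          nth_rw 1 [this]; abel)
       (Used ∪ {Sum.inr 0, Sum.inr w}) hU'
    have hok : ∀ a ∈ [p 0, p 1], a ≠ 0 ∧ a ≠ w := fun a ha => by
      have := hp.fresh (Sum.inr a) (by
        simp only [List.mem_cons, List.not_mem_nil, or_false] at ha
        rcases ha with rfl | rfl <;> simp [tokens])
      simp only [mem_union, mem_insert, mem_singleton, not_or, Sum.inr.injEq] at this
      exact this.2
    refine ⟨p 0, p 1, ({(p 2, p 2 + w, 3)} + {(p 3, p 2 + c + (p 2 + p 0) - p 3, 3)} + {(p 4, p 2 + p 0 + (p 2 + p 1) - p 4, 3)}) +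
      ({(p 5, p 5 + w, 3)} + {(p 6, p 5 + c' + (p 5 + p 0) - p 6, 3)} + {(p 7, p 5 + p 0 + (p 5 + p 1) - p 7, 3)}),
      tokens (pairPrivate w c (p 0) (p 1) (p 2) (p 3) (p 4)) + tokens (pairPrivate w c' (p 0) (p 1) (p 5) (p 6) (p 7)),
      hok _ (by simp), hok _ (by simp), ?_, by simp, ?_, ?_⟩
    · exact (((Short.singleton (by simp)).add (Short.singleton (by simp))).add (Short.singleton (by simp))).add
        (((Short.singleton (by simp)).add (Short.singleton (by simp))).add (Short.singleton (by simp)))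
    · convert (hp.of_subset subset_union_left).mono (show pairRowShape.h ≤ 40 by decide) using 1
      simp only [tokens, pairPrivate, pairTok, List.map_cons, List.map_nil, List.sum_cons, List.sum_nil, ← add_assoc]
      abel
    · intro y hy y' hy'
      exact ((realizes_pairSwitch w c (p 0) (p 1) (p 2) (p 3) (p 4) y hy).add
        (realizes_pairSwitch w c' (p 0) (p 1) (p 5) (p 6) (p 7) y' hy')).congr rfl (by abel)
  base c c' hc hc' Used hU := by
    have hbad : ∀ i j, i < j → (pairBaseShape.cls i).isCol = (pairBaseShape.cls j).isCol →
      (¬∃ l, (pairBaseShape.A i l - pairBaseShape.A j l).natAbs = 1) → (i.val, j.val) ∈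
      [(0, 1), (0, 2), (1, 2), (8, 9), (8, 11), (9, 11), (16, 17)] := by decide
    obtain ⟨(p : Fin 5 → G), hp⟩ := h2.exists_fresh hA pairBaseShape_valid (by decide) (by decide) (by decide)
      ![0, w, c, 0, 0, c, c, 0, 0, w, 0, c', 0, c', 0, c', 0, w]
      (pairBaseShape_pos w c c') (fun i j h h' h'' => by
        have hb := hbad i j h h' h''
        revert hb
        generalize i.val = a
        generalize j.val = b
        intro hb
        simp only [List.mem_cons, List.not_mem_nil, or_false, Prod.mk.injEq] at hb
        rcases hb with ⟨rfl, rfl⟩ | ⟨rfl, rfl⟩ | ⟨rfl, rfl⟩ | ⟨rfl, rfl⟩ | ⟨rfl, rfl⟩ | ⟨rfl, rfl⟩ | ⟨rfl, rfl⟩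
        · refine card_filter_le_of_false _ fun p hp => hw0 ?_
          simpa using hp
        · refine card_filter_le_of_false _ fun p hp => hc.1 ?_
          simpa [eq_comm] using hp
        · refine card_filter_le_of_false _ fun p hp => hc.2 ?_
          simpa [eq_comm] using hp
        · refine card_filter_le_of_false _ fun p hp => hw0 ?_
          simpa using hp
        · refine card_filter_le_of_false _ fun p hp => hc'.1 ?_
          simpa [eq_comm] using hp
        · refine card_filter_le_of_false _ fun p hp => hc'.2 ?_
          simpa [eq_comm] using hp
        · refine card_filter_le_of_double hw (r := 5) 0 _ fun p hp => ?_
          have : p 0 = w - p 0 := by simpa using hp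
          nth_rw 1 [this]; abel)
       Used (by omega)
    have r1 := realizes_pairSwitch_two w c (p 0) (p 1) (p 2)
    have r2 := realizes_pairSwitch_two w (p 0) c' (p 3) (p 4)
    refine ⟨({(p 1, p 1 + w, 3)} + {(p 2, p 1 + c + (p 1 + p 0) - p 2, 3)}) +
      ({(p 3, p 3 + w, 3)} + {(p 4, p 3 + p 0 + (p 3 + c') - p 4, 3)}), _, ?_, by simp, hp.mono (by decide), ?_, ?_⟩
    · exact ((Short.singleton (by simp)).add (Short.singleton (by simp))).add ((Short.singleton (by simp)).add (Short.singleton (by simp)))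
    · refine ((r1 (pairTok w c) (by simp)).add (r2 (pairTok w (p 0)) (by simp))).congr rfl ?_
      simp only [tokens, pairTok, List.map_cons, List.map_nil, List.sum_cons, List.sum_nil, ← add_assoc]
      abel
    · refine ((r1 (pairTok w (p 0)) (by simp)).add (r2 (pairTok w c') (by simp))).congr rfl ?_
      simp only [tokens, pairTok, List.map_cons, List.map_nil, List.sum_cons, List.sum_nil, ← add_assoc]
      abel
  item Used hU := by
    have hbad : ∀ i j, i < j → (pairShape.cls i).isCol = (pairShape.cls j).isCol →
      (¬∃ l, (pairShape.A i l - pairShape.A j l).natAbs = 1) → (i.val, j.val) ∈ [(0, 1)] := by decide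
    have hU' : #(Used ∪ {Sum.inr 0, Sum.inr w}) ≤ B + 2 :=
      (card_union_le _ _).trans (Nat.add_le_add hU card_le_two)
    obtain ⟨(p : Fin 1 → G), hp⟩ := h3.exists_fresh hA pairShape_valid (by decide) (by decide) (by decide) ![0, w]
      (pairShape_pos w) (fun i j h h' h'' => by
        have hb := hbad i j h h' h''
        revert hb
        generalize i.val = a
        generalize j.val = b
        intro hb
        simp only [List.mem_cons, List.not_mem_nil, or_false, Prod.mk.injEq] at hb
        obtain ⟨rfl, rfl⟩ := hb
        refine card_filter_le_of_double hw (r := 1) 0 _ fun p hp => ?_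
        have : p 0 = w - p 0 := by simpa using hp
        nth_rw 1 [this]; abel)  (Used ∪ {Sum.inr 0, Sum.inr w}) hU'
    have hok : p 0 ≠ 0 ∧ p 0 ≠ w := by
      have := hp.fresh (Sum.inr (p 0)) (by simp [tokens])
      simp only [mem_union, mem_insert, mem_singleton, not_or, Sum.inr.injEq] at this
      exact this.2
    refine ⟨p 0, hok, ?_⟩
    convert (hp.of_subset subset_union_left).mono (show pairShape.h ≤ 2 by decide) using 1
    simp [pairTok, tokens]

end Supply

section Cycles

open Finset

variable {G : Type} [AddCommGroup G] [DecidableEq G]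

/-- The vertices and colours used by a directed cycle. -/
def cycleTokens (l : List G) : Multiset (G ⊕ G) :=
  pathTokens l + {Sum.inr (l.headD 0 - l.getLastD 0)}

theorem pathTokens_add_singleton (x y : G) (l : List G) :
    pathTokens (x :: l) + {Sum.inr (y - (x :: l).getLastD 0)} =
      (((x :: l).map Sum.inl : List (G ⊕ G)) : Multiset (G ⊕ G)) +
        ((List.zipWith (fun a b => Sum.inr (b - a)) (x :: l) (l ++ [y]) : List (G ⊕ G)) : Multiset (G ⊕ G)) := by
  induction l generalizing x with
  | nil => simp [pathTokens]
  | cons z l ih =>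
    have := ih z
    simp only [pathTokens, List.map_cons, ← Multiset.cons_coe, ← Multiset.singleton_add, List.cons_append,
      List.zipWith_cons_cons, List.getLastD_cons] at this ⊢
    rw [add_assoc, this]
    abel

theorem map_formPerm {l : List G} (hl : l.Nodup) : l.map l.formPerm = l.rotate 1 := by
  refine List.ext_getElem (by simp) fun i h _ => ?_
  rw [List.getElem_map, List.formPerm_apply_getElem _ hl, List.getElem_rotate]

theorem cycleTokens_eq {l : List G} (hl : l.Nodup) (h0 : l ≠ []) :
    cycleTokens l = ((l.map Sum.inl : List (G ⊕ G)) : Multiset (G ⊕ G)) + ((l.map fun v => Sum.inr (l.formPerm v - v) : List (G ⊕ G)) : Multiset (G ⊕ G)) := by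
  obtain ⟨x, l, rfl⟩ := List.exists_cons_of_ne_nil h0
  rw [cycleTokens, List.headD_cons, pathTokens_add_singleton]
  congr 2
  have : l ++ [x] = (x :: l).map (x :: l).formPerm := by rw [map_formPerm hl]; simp
  rw [this, List.zipWith_map_right, List.zipWith_self]

theorem map_inl_le_pathTokens (l : List G) : ((l.map Sum.inl : List (G ⊕ G)) : Multiset (G ⊕ G)) ≤ pathTokens l := by
  cases l with
  | nil => simp [pathTokens]
  | cons x l =>
    induction l generalizing x with
    | nil => simp [pathTokens]
    | cons z l ih =>
      rw [pathTokens, List.map_cons, ← Multiset.cons_coe, ← Multiset.singleton_add, add_assoc]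
      exact Multiset.add_le_add_left (le_add_left (ih z))

/-- A family of vertex-disjoint cycles of length `k` with distinct colours gives the required permutation. -/
theorem exists_perm_of_cycles [Fintype G] {k : ℕ} (hk : 2 ≤ k) (Cyc : List (List G)) (hlen : ∀ l ∈ Cyc, l.length = k)
    (hcard : Cyc.length * k = Fintype.card G - 1)
    (hnd : ((Cyc.map cycleTokens).sum).Nodup) (h0 : Sum.inl 0 ∉ (Cyc.map cycleTokens).sum) :
    ∃ σ : Equiv.Perm G, σ.support = univ.erase 0 ∧ (∀ c ∈ σ.cycleType, c = k) ∧
      Set.BijOn (fun v : G => v - σ v) {v : G | v ≠ 0} {v : G | v ≠ 0} := by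
  have hle : ∀ l ∈ Cyc, cycleTokens l ≤ (Cyc.map cycleTokens).sum := fun l hl =>
    List.le_sum_of_mem (List.mem_map_of_mem hl)
  have hnil : ∀ l ∈ Cyc, l ≠ [] := fun l hl h => by have := hlen l hl; simp [h] at this; omega
  have hlnd : ∀ l ∈ Cyc, l.Nodup := fun l hl => by
    have := Multiset.nodup_of_le ((map_inl_le_pathTokens l).trans ((Multiset.le_add_right _ _).trans (hle l hl))) hnd
    exact List.Nodup.of_map _ this
  set σ : Equiv.Perm G := (Cyc.map List.formPerm).prod with hσ
  have hsum : (Cyc.map cycleTokens).sum = ((Cyc.flatten.map Sum.inl : List (G ⊕ G)) : Multiset (G ⊕ G)) +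
      ((Cyc.flatMap (fun l => l.map fun v => Sum.inr (l.formPerm v - v)) : List (G ⊕ G)) : Multiset (G ⊕ G)) := by
    clear hσ hle hcard hnd h0
    induction Cyc with
    | nil => simp
    | cons l L ih =>
      rw [List.map_cons, List.sum_cons, ih (fun l hl => hlen l (List.mem_cons_of_mem _ hl)) (fun l hl => hnil l (List.mem_cons_of_mem _ hl))
        (fun l hl => hlnd l (List.mem_cons_of_mem _ hl)), cycleTokens_eq (hlnd l (List.mem_cons_self ..)) (hnil l (List.mem_cons_self ..))]
      simp only [List.flatten_cons, List.map_append, List.flatMap_cons, ← Multiset.coe_add]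
      abel
  rw [hsum] at hnd h0
  obtain ⟨hn1, hn2, -⟩ := Multiset.nodup_add.1 hnd
  have hflat : Cyc.flatten.Nodup := List.Nodup.of_map _ hn1
  have hpw : Cyc.Pairwise fun a b => a.Disjoint b := (List.nodup_flatten.1 hflat).2
  have hfs : ∀ l ∈ Cyc, (l.formPerm).support = l.toFinset := fun l hl =>
    List.support_formPerm_of_nodup _ (hlnd l hl) fun x hx => by
      have := hlen l hl; rw [hx] at this; simp at this; omega
  have hdisj : (Cyc.map List.formPerm).Pairwise Equiv.Perm.Disjoint := by
    rw [List.pairwise_map]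
    refine List.Pairwise.imp_of_mem (fun {a b} ha hb hab => ?_) hpw
    rw [Equiv.Perm.disjoint_iff_disjoint_support]
    rw [hfs a ha, hfs b hb]
    exact disjoint_left.2 fun x hx hx' => hab (List.mem_toFinset.1 hx) (List.mem_toFinset.1 hx')
  have hcyc : ∀ τ ∈ Cyc.map List.formPerm, τ.IsCycle := fun τ hτ => by
    obtain ⟨l, hl, rfl⟩ := List.mem_map.1 hτ
    exact List.isCycle_formPerm (hlnd l hl) (by rw [hlen l hl]; exact hk)
  have happ : ∀ l ∈ Cyc, ∀ v ∈ l, σ v = l.formPerm v := fun l hl v hv => by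
    refine (Equiv.Perm.eq_on_support_mem_disjoint (List.mem_map_of_mem hl) hdisj v ?_).symm
    rw [hfs l hl]; exact List.mem_toFinset.2 hv
  have hmem : ∀ v, v ∈ Cyc.flatten ↔ v ≠ 0 := by
    have hz : (0 : G) ∉ Cyc.flatten := fun h => h0 (Multiset.mem_add.2 (Or.inl (by simpa using h)))
    have hc : #Cyc.flatten.toFinset = #(univ.erase (0 : G)) := by
      rw [List.toFinset_card_of_nodup hflat, card_erase_of_mem (mem_univ _), card_univ, ← hcard, List.length_flatten,
        List.map_congr_left hlen]
      simp
    have := eq_of_subset_of_card_le (fun v hv => mem_erase.2 ⟨fun h => hz (by simpa [h] using hv), mem_univ _⟩) hc.ge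
    intro v
    rw [← List.mem_toFinset, this]
    simp
  have hcol : (Cyc.flatten.map fun v => (σ v - v)).Nodup := by
    have : Cyc.flatMap (fun l => l.map fun v => (Sum.inr (l.formPerm v - v) : G ⊕ G)) = (Cyc.flatten.map fun v => σ v - v).map Sum.inr := by
      rw [List.map_flatten, List.map_flatten, List.flatMap_def]
      congr 1
      rw [List.map_map]
      refine List.map_congr_left fun l hl => ?_
      simp only [Function.comp, List.map_map]
      exact List.map_congr_left fun v hv => by simp [happ l hl v hv]
    rw [this] at hn2
    exact List.Nodup.of_map _ hn2
  have hsupp : ∀ v, σ v ≠ v ↔ v ≠ 0 := fun v => by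
    constructor
    · rintro h rfl
      refine h ?_
      by_contra hne
      have : (0 : G) ∈ σ.support := Equiv.Perm.mem_support.2 hne
      obtain ⟨τ, hτ, h'⟩ := Equiv.Perm.exists_mem_support_of_mem_support_prod this
      obtain ⟨l, hl, rfl⟩ := List.mem_map.1 hτ
      rw [hfs l hl] at h'
      exact (hmem 0).1 (List.mem_flatten.2 ⟨l, hl, List.mem_toFinset.1 h'⟩) rfl
    · intro h
      obtain ⟨l, hl, hv⟩ := List.mem_flatten.1 ((hmem v).2 h)
      rw [happ l hl v hv, ← Equiv.Perm.mem_support, hfs l hl]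
      exact List.mem_toFinset.2 hv
  have hinj : ∀ v, v ≠ 0 → ∀ v', v' ≠ 0 → v - σ v = v' - σ v' → v = v' := fun v hv v' hv' h =>
    List.inj_on_of_nodup_map hcol ((hmem v).2 hv) ((hmem v').2 hv') (by rw [← neg_sub v, h, neg_sub])
  refine ⟨σ, ?_, ?_, ?_⟩
  · ext v; simp [hsupp]
  · rw [Equiv.Perm.cycleType_eq _ hσ.symm hcyc hdisj]
    intro c hc
    simp only [List.map_map, Multiset.mem_coe, List.mem_map] at hc
    obtain ⟨l, hl, rfl⟩ := hc
    simp only [Function.comp, hfs l hl]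
    rw [List.toFinset_card_of_nodup (hlnd l hl), hlen l hl]
  · have hmaps : Set.MapsTo (fun v : G => v - σ v) {v : G | v ≠ 0} {v : G | v ≠ 0} := fun v hv => by
      simp only [Set.mem_ofPred_eq, sub_ne_zero]
      exact ((hsupp v).2 hv).symm
    have hio : Set.InjOn (fun v : G => v - σ v) {v : G | v ≠ 0} := fun v hv v' hv' h => hinj v hv v' hv' h
    exact ((Set.toFinite _).injOn_iff_bijOn_of_mapsTo hmaps).1 hio

end Cycles

section Links

open Finset

variable {G : Type} [AddCommGroup G] [DecidableEq G]

/-- The sum of the colours in a collection of tokens. -/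
def colourSum : Multiset (G ⊕ G) →+ G :=
  Multiset.sumAddMonoidHom.comp (Multiset.mapAddMonoidHom (Sum.elim 0 id))

@[simp] theorem colourSum_inl (x : G) : colourSum {Sum.inl x} = 0 := by simp [colourSum]

@[simp] theorem colourSum_inr (x : G) : colourSum {Sum.inr x} = x := by simp [colourSum]

theorem colourSum_pathTokens (l : List G) : colourSum (pathTokens l) = l.getLastD 0 - l.headD 0 := by
  cases l with
  | nil => simp [pathTokens]
  | cons x l =>
    induction l generalizing x with
    | nil => simp [pathTokens]
    | cons z l ih =>
      rw [pathTokens, map_add, map_add, ih z, colourSum_inl, colourSum_inr]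
      simp

theorem Realizes.colourSum_eq {E : Multiset (G × G × ℕ)} {M : Multiset (G ⊕ G)} (h : Realizes E M) :
    colourSum M = (E.map fun e => e.2.1 - e.1).sum := by
  obtain ⟨P, rfl, rfl⟩ := h
  rw [map_multiset_sum, Multiset.map_map, Multiset.map_map]
  congr 1
  exact Multiset.map_congr rfl fun l _ => colourSum_pathTokens l

/-- `X` consists of `v` vertices and `v + 1` colours of a path leading from `b` to `a`. -/
structure IsLink (b a : G) (v : ℕ) (X : Multiset (G ⊕ G)) : Prop where
  prolong : ∃ x X', X = X' + {Sum.inr (a - x)} ∧ ∀ S l, 0 < l → Extends {(S, b, l)} {(S, x, l + v)} X'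
  colourSum_eq : colourSum X = a - b

theorem IsLink.start {b a c : G} (h : a = b + c) : IsLink b a 0 {Sum.inr c} :=
  ⟨⟨b, 0, by simp [h], fun _ _ _ => Extends.refl _⟩, by simp [h]⟩

theorem IsLink.cons {b a y c : G} {v : ℕ} {X : Multiset (G ⊕ G)} (h : IsLink y a v X) (hy : y = b + c) :
    IsLink b a (v + 1) ({Sum.inl y} + {Sum.inr c} + X) := by
  obtain ⟨⟨x, X', rfl, hX⟩, h'⟩ := h
  refine ⟨⟨x, {Sum.inl y} + {Sum.inr c} + X', by abel, fun S l hl => ?_⟩, ?_⟩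
  · have := (Extends.pad (s := S) (t := b) (v := y) hl).trans (hX S (l + 1) (by omega))
    rw [show c = y - b by rw [hy]; abel]
    rwa [add_assoc l, add_comm 1 v] at this
  · rw [map_add, h', map_add, colourSum_inl, colourSum_inr, hy]
    abel

theorem chain_links (a b : ℕ → G) (len v : ℕ → ℕ) (X : ℕ → Multiset (G ⊕ G)) (t : ℕ) (hlen : ∀ j ≤ t, 0 < len j)
    (hlink : ∀ j < t, IsLink (b j) (a (j + 1)) (v j) (X j)) :
    Extends (∑ j ∈ range (t + 1), {(a j, b j, len j)})
      {(a 0, b t, ∑ j ∈ range (t + 1), len j + ∑ j ∈ range t, v j)} (∑ j ∈ range t, X j) := by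
  induction t with
  | zero => simpa using Extends.refl _
  | succ t ih =>
    have h1 := ih (fun j hj => hlen j (by omega)) fun j hj => hlink j (by omega)
    obtain ⟨x, X', hX, hX'⟩ := (hlink t (by omega)).prolong
    have h0 : 0 < ∑ j ∈ range (t + 1), len j + ∑ j ∈ range t, v j := by
      rw [sum_range_succ]; have := hlen t (by omega); omega
    have h2 := ((h1.trans (hX' _ _ h0)).add (Extends.refl {(a (t + 1), b (t + 1), len (t + 1))})).trans
      (Extends.join (by omega) (hlen (t + 1) le_rfl))
    rw [sum_range_succ _ (t + 1), sum_range_succ len (t + 1), sum_range_succ v, sum_range_succ X, hX]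
    have e1 : ∑ j ∈ range (t + 1), len j + len (t + 1) + (∑ j ∈ range t, v j + v t) =
        ∑ j ∈ range (t + 1), len j + ∑ j ∈ range t, v j + v t + len (t + 1) := by omega
    have e2 : ∑ j ∈ range t, X j + (X' + {Sum.inr (a (t + 1) - x)}) = ∑ j ∈ range t, X j + X' + 0 + {Sum.inr (a (t + 1) - x)} := by
      abel
    rwa [e1, e2]

theorem Extends.sum {ι : Type} [DecidableEq ι] (s : Finset ι) {E E' : ι → Multiset (G × G × ℕ)} {X : ι → Multiset (G ⊕ G)}
    (h : ∀ i ∈ s, Extends (E i) (E' i) (X i)) : Extends (∑ i ∈ s, E i) (∑ i ∈ s, E' i) (∑ i ∈ s, X i) := by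
  induction s using Finset.induction_on with
  | empty => exact Extends.refl _
  | insert a s ha ih =>
    rw [sum_insert ha, sum_insert ha, sum_insert ha]
    exact (h a (mem_insert_self _ _)).add (ih fun i hi => h i (mem_insert_of_mem hi))

theorem exists_perm_of_links [Fintype G] {r Q k : ℕ} (hk : 2 ≤ k) (hQ : 0 < Q) (a b : ℕ → ℕ → G) (len v : ℕ → ℕ → ℕ)
    (X : ℕ → ℕ → Multiset (G ⊕ G)) (hlen : ∀ i j, 0 < len i j)
    (hlink : ∀ i < r, ∀ j < Q, IsLink (b i j) (a i ((j + 1) % Q)) (v i j) (X i j))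
    (htot : ∀ i < r, ∑ j ∈ range Q, (len i j + v i j) = k) (hcard : r * k = Fintype.card G - 1) {M : Multiset (G ⊕ G)}
    (hM : Realizes (∑ i ∈ range r, ∑ j ∈ range Q, {(a i j, b i j, len i j)}) M)
    (hnd : (M + ∑ i ∈ range r, ∑ j ∈ range Q, X i j).Nodup)
    (h0 : Sum.inl 0 ∉ M + ∑ i ∈ range r, ∑ j ∈ range Q, X i j) :
    ∃ σ : Equiv.Perm G, σ.support = univ.erase 0 ∧ (∀ c ∈ σ.cycleType, c = k) ∧
      Set.BijOn (fun v : G => v - σ v) {v : G | v ≠ 0} {v : G | v ≠ 0} := by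
  obtain ⟨t, rfl⟩ := Nat.exists_eq_succ_of_ne_zero hQ.ne'
  simp only [Nat.succ_eq_add_one] at *
  have hcyc : ∀ i : ℕ, ∃ (x : G) (Y : Multiset (G ⊕ G)), i ∈ range r → Y + {Sum.inr (a i 0 - x)} = ∑ j ∈ range (t + 1), X i j ∧
      Extends (∑ j ∈ range (t + 1), {(a i j, b i j, len i j)}) {(a i 0, x, k)} Y := fun i => by
    by_cases hi : i ∈ range r
    swap
    · exact ⟨0, 0, fun h => absurd h hi⟩
    rw [mem_range] at hi
    obtain ⟨x, X', hX, hX'⟩ := (hlink i hi t (by omega)).prolong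
    rw [Nat.mod_self] at hX
    have h1 := chain_links (a i) (b i) (len i) (v i) (X i) t (fun j _ => hlen i j) fun j hj => by
      have := hlink i hi j (by omega)
      rwa [Nat.mod_eq_of_lt (by omega)] at this
    have hpos : 0 < ∑ j ∈ range (t + 1), len i j + ∑ j ∈ range t, v i j := by
      rw [sum_range_succ]; have := hlen i t; omega
    have h2 := h1.trans (hX' _ _ hpos)
    refine ⟨x, ∑ j ∈ range t, X i j + X', fun _ => ⟨?_, ?_⟩⟩
    · rw [sum_range_succ, hX, add_assoc]
    · convert h2 using 3
      rw [← htot i hi, sum_add_distrib, sum_range_succ (v i)]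
      congr 1
      omega
  choose x Y hY using hcyc
  obtain ⟨P, hP, hP'⟩ := by
    simpa using (Extends.sum (range r) fun i hi => (hY i hi).2) 0 M (by simpa using hM)
  have hsum : (P.map cycleTokens).sum = M + ∑ i ∈ range r, ∑ j ∈ range (t + 1), X i j := by
    have e1 : P.map cycleTokens = P.map fun l => pathTokens l + {Sum.inr ((pathEnds l).1 - (pathEnds l).2.1)} := rfl
    have e2 : (P.map fun l => ({Sum.inr ((pathEnds l).1 - (pathEnds l).2.1)} : Multiset (G ⊕ G))) =
        (P.map pathEnds).map fun e => {Sum.inr (e.1 - e.2.1)} := by rw [Multiset.map_map]; rfl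
    rw [e1, Multiset.sum_map_add, hP', e2, hP, ← sum_congr rfl fun i hi => (hY i hi).1, sum_add_distrib, add_assoc]
    congr 2
    have := map_sum ((Multiset.sumAddMonoidHom (M := Multiset (G ⊕ G))).comp
      (Multiset.mapAddMonoidHom fun e : G × G × ℕ => {Sum.inr (e.1 - e.2.1)})) (fun i => {(a i 0, x i, k)}) (range r)
    simpa only [AddMonoidHom.comp_apply, Multiset.coe_sumAddMonoidHom, Multiset.coe_mapAddMonoidHom, Multiset.map_singleton,
      Multiset.sum_singleton] using this
  induction P using Quotient.inductionOn with
  | h L =>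
    simp only [Multiset.quot_mk_to_coe] at *
    have hlen' : ∀ l ∈ L, l.length = k := fun l hl => by
      have : pathEnds l ∈ ∑ i ∈ range r, ({(a i 0, x i, k)} : Multiset (G × G × ℕ)) := by
        rw [← hP]; exact Multiset.mem_map_of_mem _ (by simpa using hl)
      obtain ⟨i, -, hi⟩ := Multiset.mem_sum.1 this
      rw [Multiset.mem_singleton] at hi
      exact congrArg (fun e => e.2.2) hi
    have hLr : L.length = r := by
      have := congrArg Multiset.card hP
      simpa using this
    rw [Multiset.map_coe, Multiset.sum_coe] at hsum
    refine exists_perm_of_cycles hk L hlen' (by rw [hLr, hcard]) ?_ ?_ <;> rwa [hsum]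

end Links

section LinkSupply

open Finset

variable {G : Type} [AddCommGroup G] [DecidableEq G]

/-- The vertices visited when leaving `b` along the colours in `cs`. -/
def walk (b : G) : List G → List G
  | [] => []
  | c :: cs => (b + c) :: walk (b + c) cs

theorem walk_length (b : G) (cs : List G) : (walk b cs).length = cs.length := by
  induction cs generalizing b with
  | nil => rfl
  | cons c cs ih => simp [walk, ih]

theorem walk_add (x b : G) (cs : List G) : walk (x + b) cs = (walk b cs).map (x + ·) := by
  induction cs generalizing b with
  | nil => rfl
  | cons c cs ih => simp only [walk, List.map_cons, add_assoc, ← ih]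

theorem isLink_walk {b a c : G} {cs : List G} (h : a = b + cs.sum + c) :
    IsLink b a cs.length (((walk b cs).map fun x => {Sum.inl x}).sum + (cs.map fun x => {Sum.inr x}).sum + {Sum.inr c}) := by
  induction cs generalizing b with
  | nil => simpa [walk] using IsLink.start (by simpa using h)
  | cons x cs ih =>
    have := IsLink.cons (ih (b := b + x) (by rw [h, List.sum_cons]; abel)) rfl
    rw [List.length_cons]
    convert this using 1
    simp only [walk, List.map_cons, List.sum_cons]
    abel

/-- Away from any small set there is a vertex `y` whose translates by `A` lie in `F` and which is
joined to `e` and `a` by colours in `P`. -/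
def LinkOp (F P : Finset G) (w : G) (B : ℕ) : Prop :=
  ∀ A : Finset G, #A ≤ 5 → ∀ e a : G, a - e ≠ 0 → a - e ≠ w → ∀ Blocked : Finset G, #Blocked ≤ B →
    ∃ y ∉ Blocked, (∀ x ∈ A, y + x ∈ F) ∧ y - e ∈ P ∧ a - y ∈ P ∧ y - e ≠ a - y

theorem LinkOp.fresh {F P : Finset G} {w : G} {B : ℕ} (h : LinkOp F P w B) {O : List G} (hO : O.length ≤ 5) {e a : G}
    (h0 : a - e ≠ 0) (hw : a - e ≠ w) {Fu Pu Bl : Finset G} (hB : 5 * #Fu + 2 * #Pu + #Bl ≤ B) :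
    ∃ c ∉ Bl, (∀ x ∈ O, e + c + x ∈ F ∧ e + c + x ∉ Fu) ∧ (c ∈ P ∧ c ∉ Pu) ∧
      (a - (e + c) ∈ P ∧ a - (e + c) ∉ Pu) ∧ c ≠ a - (e + c) := by
  have hcard : #(Bl.image (e + ·) ∪ O.toFinset.biUnion (fun o => Fu.image (· - o)) ∪ Pu.image (e + ·) ∪ Pu.image (a - ·)) ≤ B := by
    have h1 : #(O.toFinset.biUnion fun o => Fu.image (· - o)) ≤ 5 * #Fu := by
      refine (card_biUnion_le_card_mul _ _ _ fun o _ => card_image_le).trans ?_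
      exact Nat.mul_le_mul_right _ ((List.toFinset_card_le _).trans hO)
    have h2 := card_union_le (Bl.image (e + ·) ∪ O.toFinset.biUnion (fun o => Fu.image (· - o)) ∪ Pu.image (e + ·)) (Pu.image (a - ·))
    have h3 := card_union_le (Bl.image (e + ·) ∪ O.toFinset.biUnion (fun o => Fu.image (· - o))) (Pu.image (e + ·))
    have h4 := card_union_le (Bl.image (e + ·)) (O.toFinset.biUnion (fun o => Fu.image (· - o)))
    have h5 := card_image_le (s := Bl) (f := (e + ·))
    have h6 := card_image_le (s := Pu) (f := (e + ·))
    have h7 := card_image_le (s := Pu) (f := (a - ·))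
    omega
  obtain ⟨y, hy, hF, hP1, hP2, hne⟩ := h O.toFinset ((List.toFinset_card_le _).trans hO) e a h0 hw _ hcard
  simp only [mem_union, mem_image, mem_biUnion, List.mem_toFinset, not_or, not_exists, not_and] at hy
  have e1 : e + (y - e) = y := by abel
  refine ⟨y - e, fun hm => hy.1.1.1 _ hm e1, fun x hx => ?_, ⟨hP1, fun hm => hy.1.2 _ hm e1⟩, ?_, ?_⟩
  · rw [e1]
    exact ⟨hF x (by simpa using hx), fun hm => hy.1.1.2 x hx _ hm (by abel)⟩
  · rw [e1]
    exact ⟨hP2, fun hm => hy.2 _ hm (by abel)⟩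
  · rwa [e1]

theorem LinkOp.step {F P : Finset G} {w z : G} {B : ℕ} (h : LinkOp F P w B) (hz : z ≠ 0) (hzw : z ≠ w) (e : G) {q : G} (hq : q ≠ 0)
    {Fu Pu Bl : Finset G} (hB : 5 * #Fu + 2 * #Pu + #Bl ≤ B) :
    ∃ c ∉ Bl, ((walk e [c, q]).Nodup ∧ ∀ x ∈ walk e [c, q], x ∈ F ∧ x ∉ Fu) ∧ (c ∈ P ∧ c ∉ Pu) := by
  obtain ⟨c, hc, hF, hP, -⟩ := h.fresh (O := [0, q]) (by simp) (e := e) (a := e + z) (by simpa) (by simpa) hB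
  exact ⟨c, hc, ⟨by simpa [walk] using hq, by simpa [walk] using hF⟩, hP⟩

theorem LinkOp.exists_walk {F P : Finset G} {w z : G} {B : ℕ} (h : LinkOp F P w B) (hz : z ≠ 0) (hzw : z ≠ w) (b : G) {q₁ q₂ q₃ : G}
    (hq₁ : q₁ ≠ 0) (hq₂ : q₂ ≠ 0) {Fu Pu : Finset G} (hB : 5 * #Fu + 2 * #Pu + 100 ≤ B)
    {Bl₁ : Finset G} (hBl₁ : #Bl₁ ≤ 20) {Bl₂ : G → Finset G} (hBl₂ : ∀ c, #(Bl₂ c) ≤ 20) (ds : G → List G) (a : G → G → G)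
    (H : ∀ c₁ ∈ P, c₁ ∉ Bl₁ → ∀ c₂ ∈ P, c₂ ∉ Bl₂ c₁ →
      (0 :: q₃ :: (q₃ + (w - c₁)) :: walk (q₃ + (w - c₁)) (ds c₂)).Nodup ∧ (ds c₂).length ≤ 2 ∧
        a c₁ c₂ - (b + c₁ + q₁ + c₂ + q₂) ≠ 0 ∧ a c₁ c₂ - (b + c₁ + q₁ + c₂ + q₂) ≠ w) :
    ∃ c₁ c₂ c₃ c₄, (walk b ([c₁, q₁, c₂, q₂, c₃, q₃, w - c₁] ++ ds c₂)).Nodup ∧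
      (∀ x ∈ walk b ([c₁, q₁, c₂, q₂, c₃, q₃, w - c₁] ++ ds c₂), x ∈ F ∧ x ∉ Fu) ∧
      [c₁, c₂, c₃, c₄].Nodup ∧ (∀ c ∈ [c₁, c₂, c₃, c₄], c ∈ P ∧ c ∉ Pu) ∧ a c₁ c₂ = b + c₁ + q₁ + c₂ + q₂ + c₃ + c₄ ∧
      (ds c₂).length ≤ 2 := by
  obtain ⟨c₁, hc₁, ⟨hnd₁, hF₁⟩, hP₁⟩ := h.step hz hzw b hq₁ (Fu := Fu) (Pu := Pu) (Bl := Bl₁) (by omega)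
  have hF1 : #(Fu ∪ (walk b [c₁, q₁]).toFinset) ≤ #Fu + 2 :=
    (card_union_le _ _).trans (Nat.add_le_add_left ((List.toFinset_card_le _).trans (by simp [walk])) _)
  have hP1 : #(insert c₁ Pu) ≤ #Pu + 1 := card_insert_le _ _
  obtain ⟨c₂, hc₂, ⟨hnd₂, hF₂⟩, hP₂⟩ := h.step hz hzw (b + c₁ + q₁) hq₂ (Fu := Fu ∪ (walk b [c₁, q₁]).toFinset)
    (Pu := insert c₁ Pu) (Bl := Bl₂ c₁) (by have := hBl₂ c₁; omega)
  have hF2 : #(Fu ∪ (walk b [c₁, q₁]).toFinset ∪ (walk (b + c₁ + q₁) [c₂, q₂]).toFinset) ≤ #Fu + 4 := by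
    have h1 := card_union_le (Fu ∪ (walk b [c₁, q₁]).toFinset) (walk (b + c₁ + q₁) [c₂, q₂]).toFinset
    have h2 : #(walk (b + c₁ + q₁) [c₂, q₂]).toFinset ≤ 2 := (List.toFinset_card_le _).trans (by simp [walk])
    omega
  have hP2 : #(insert c₂ (insert c₁ Pu)) ≤ #Pu + 2 := (card_insert_le _ _).trans (by omega)
  obtain ⟨hO, hlen, h0, hw⟩ := H c₁ hP₁.1 hc₁ c₂ hP₂.1 hc₂
  obtain ⟨c₃, -, hF₃, hP₃, hP₄, hne⟩ := h.fresh (O := 0 :: q₃ :: (q₃ + (w - c₁)) :: walk (q₃ + (w - c₁)) (ds c₂))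
    (by simp only [List.length_cons, walk_length]; omega) h0 hw (Fu := Fu ∪ (walk b [c₁, q₁]).toFinset ∪ (walk (b + c₁ + q₁) [c₂, q₂]).toFinset)
    (Pu := insert c₂ (insert c₁ Pu)) (Bl := ∅) (by simp only [card_empty]; omega)
  have hwalk : walk b ([c₁, q₁, c₂, q₂, c₃, q₃, w - c₁] ++ ds c₂) = walk b [c₁, q₁] ++ walk (b + c₁ + q₁) [c₂, q₂] ++
      (0 :: q₃ :: (q₃ + (w - c₁)) :: walk (q₃ + (w - c₁)) (ds c₂)).map (b + c₁ + q₁ + c₂ + q₂ + c₃ + ·) := by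
    rw [List.map_cons, List.map_cons, List.map_cons, ← walk_add]
    simp only [walk, List.cons_append, List.nil_append, add_zero, add_assoc]
  refine ⟨c₁, c₂, c₃, _, ?_, ?_, ?_, ?_, (add_sub_cancel (b + c₁ + q₁ + c₂ + q₂ + c₃) _).symm, hlen⟩
  · rw [hwalk, List.nodup_append', List.nodup_append']
    refine ⟨⟨hnd₁, hnd₂, fun x hx hx' => ?_⟩, hO.map (add_right_injective _), fun x hx hx' => ?_⟩
    · have := (hF₂ x hx').2
      simp only [mem_union, List.mem_toFinset, not_or] at this
      exact this.2 hx
    · obtain ⟨o, ho, rfl⟩ := List.mem_map.1 hx'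
      have := (hF₃ o ho).2
      rw [List.mem_append] at hx
      simp only [mem_union, List.mem_toFinset, not_or] at this
      tauto
  · intro x hx
    rw [hwalk, List.mem_append, List.mem_append] at hx
    rcases hx with (hx | hx) | hx
    · exact hF₁ x hx
    · have := hF₂ x hx
      simp only [mem_union, not_or] at this
      tauto
    · obtain ⟨o, ho, rfl⟩ := List.mem_map.1 hx
      have := hF₃ o ho
      simp only [mem_union, not_or] at this
      tauto
  · simp only [mem_insert, not_or] at hP₂ hP₃ hP₄
    simp only [List.nodup_cons, List.mem_cons, List.not_mem_nil, not_or, or_false, not_false_eq_true, List.nodup_nil, and_true]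
    exact ⟨⟨Ne.symm hP₂.2.1, Ne.symm hP₃.2.2.1, Ne.symm hP₄.2.2.1⟩, ⟨Ne.symm hP₃.2.1, Ne.symm hP₄.2.1⟩, hne⟩
  · simp only [mem_insert, not_or] at hP₂ hP₃ hP₄
    simp only [List.mem_cons, List.not_mem_nil, or_false, forall_eq_or_imp, forall_eq]
    tauto

theorem nodup_offsets {q κ : G} {ds : List G} (hds : (0 :: walk 0 ds).Nodup) (hq : q ≠ 0)
    (h : ∀ o ∈ 0 :: walk 0 ds, κ + o ≠ 0 ∧ κ + o ≠ q) : (0 :: q :: κ :: walk κ ds).Nodup := by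
  have e : κ :: walk κ ds = (0 :: walk 0 ds).map (κ + ·) := by
    rw [List.map_cons, ← walk_add, add_zero]
  rw [e, List.nodup_cons, List.nodup_cons, List.mem_cons, not_or, List.mem_map, List.mem_map]
  exact ⟨⟨hq.symm, fun ⟨o, ho, h'⟩ => (h o ho).1 h'⟩, fun ⟨o, ho, h'⟩ => (h o ho).2 h', hds.map (add_right_injective _)⟩

theorem LinkOp.exists_link {F P : Finset G} {w z : G} {B : ℕ} (h : LinkOp F P w B) (hz : z ≠ 0) (hzw : z ≠ w)
    (hP : ∀ c ∈ P, c ≠ w) (b a : G) {q₁ q₂ q₃ : G} (hq₁ : q₁ ≠ 0) (hq₂ : q₂ ≠ 0) (hq₃ : q₃ ≠ 0) {ds : List G}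
    (hds : (0 :: walk 0 ds).Nodup) (hlen : ds.length ≤ 2) {Fu Pu : Finset G} (hB : 5 * #Fu + 2 * #Pu + 100 ≤ B) :
    ∃ F₁ P₁ X p₁ p₂ p₃, F₁ ⊆ F ∧ Disjoint F₁ Fu ∧ #F₁ = 7 + ds.length ∧ P₁ ⊆ P ∧ Disjoint P₁ Pu ∧ #P₁ = 4 ∧
      p₁ ≠ 0 ∧ p₂ ≠ 0 ∧ p₃ ≠ 0 ∧ IsLink b a (7 + ds.length) X ∧
      X + ({Sum.inr p₁} + {Sum.inr p₂} + {Sum.inr p₃}) = {Sum.inr q₁} + {Sum.inr q₂} + {Sum.inr q₃} +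
        ∑ x ∈ F₁, {Sum.inl x} + ∑ c ∈ P₁, pairTok w c + (ds.map fun d => {Sum.inr d}).sum := by
  have hl : #(0 :: walk 0 ds).toFinset ≤ 3 :=
    (List.toFinset_card_le _).trans (by simp only [List.length_cons, walk_length]; omega)
  have hBl₁ : #((0 :: walk 0 ds).toFinset.image (q₃ + w + ·) ∪ (0 :: walk 0 ds).toFinset.image (w + ·)) ≤ 20 := by
    refine (card_union_le _ _).trans ?_
    have h1 := card_image_le (s := (0 :: walk 0 ds).toFinset) (f := (q₃ + w + ·))
    have h2 := card_image_le (s := (0 :: walk 0 ds).toFinset) (f := (w + ·))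
    omega
  obtain ⟨c₁, c₂, c₃, c₄, hnd, hF, hnd', hPP, ha, -⟩ := h.exists_walk hz hzw b (q₃ := q₃) hq₁ hq₂ hB hBl₁
    (Bl₂ := fun c₁ => {a - (q₃ + (w - c₁)) - ds.sum - (b + c₁ + q₁ + q₂), a - (q₃ + (w - c₁)) - ds.sum - (b + c₁ + q₁ + q₂) - w})
    (fun c => card_le_two.trans (by norm_num)) (fun _ => ds) (fun c₁ _ => a - (q₃ + (w - c₁)) - ds.sum) (by
      intro c₁ _ h1 c₂ _ h2
      simp only [mem_insert, mem_singleton, mem_union, mem_image, List.mem_toFinset, not_or, not_exists, not_and] at h1 h2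
      refine ⟨nodup_offsets hds hq₃ fun o ho => ⟨fun h' => h1.1 o ho ?_, fun h' => h1.2 o ho ?_⟩, hlen, fun h' => h2.1 ?_, fun h' => h2.2 ?_⟩
      · rw [← sub_eq_zero, ← h']; abel
      · rw [← sub_eq_zero, ← sub_eq_zero.2 h']; abel
      · rw [← sub_eq_zero, ← neg_eq_zero, ← h']; abel
      · rw [← sub_eq_zero, ← neg_eq_zero, ← sub_eq_zero.2 h']; abel)
  have hlink : IsLink b a _ _ := isLink_walk (cs := [c₁, q₁, c₂, q₂, c₃, q₃, w - c₁] ++ ds) (c := c₄) (by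
    rw [sub_sub, sub_eq_iff_eq_add] at ha
    rw [ha, List.sum_append]
    simp only [List.sum_cons, List.sum_nil]
    abel)
  rw [show ([c₁, q₁, c₂, q₂, c₃, q₃, w - c₁] ++ ds).length = 7 + ds.length from List.length_append] at hlink
  refine ⟨(walk b ([c₁, q₁, c₂, q₂, c₃, q₃, w - c₁] ++ ds)).toFinset, [c₁, c₂, c₃, c₄].toFinset, _, w - c₂, w - c₃, w - c₄,
    fun x hx => (hF x (List.mem_toFinset.1 hx)).1, disjoint_left.2 fun x hx => (hF x (List.mem_toFinset.1 hx)).2, ?_,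
    fun x hx => (hPP x (List.mem_toFinset.1 hx)).1, disjoint_left.2 fun x hx => (hPP x (List.mem_toFinset.1 hx)).2, ?_, ?_, ?_, ?_, hlink, ?_⟩
  · rw [List.toFinset_card_of_nodup hnd, walk_length, List.length_append]; rfl
  · rw [List.toFinset_card_of_nodup hnd']; rfl
  · exact sub_ne_zero.2 (hP _ (hPP _ (by simp)).1).symm
  · exact sub_ne_zero.2 (hP _ (hPP _ (by simp)).1).symm
  · exact sub_ne_zero.2 (hP _ (hPP _ (by simp)).1).symm
  · rw [List.sum_toFinset _ hnd, List.sum_toFinset _ hnd']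
    simp only [List.map_append, List.sum_append, List.map_cons, List.map_nil, List.sum_cons, List.sum_nil, pairTok]
    abel

theorem LinkOp.exists_last_link {F P : Finset G} {w z : G} {B : ℕ} (h : LinkOp F P w B) (hz : z ≠ 0) (hzw : z ≠ w)
    (hP : ∀ c ∈ P, c ≠ w) {b a q₁ q₂ q₃ : G} (hq₁ : q₁ ≠ 0) (hq₂ : q₂ ≠ 0) (hq₃ : q₃ ≠ 0)
    (hab : a = b + (q₁ + q₂ + q₃ + (w + w + w))) {Fu Pu : Finset G} (hB : 5 * #Fu + 2 * #Pu + 100 ≤ B) :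
    ∃ F₁ P₁ X, F₁ ⊆ F ∧ Disjoint F₁ Fu ∧ #F₁ = 8 ∧ P₁ ⊆ P ∧ Disjoint P₁ Pu ∧ #P₁ = 3 ∧ IsLink b a 8 X ∧
      X = {Sum.inr q₁} + {Sum.inr q₂} + {Sum.inr q₃} + ∑ x ∈ F₁, {Sum.inl x} + ∑ c ∈ P₁, pairTok w c := by
  obtain ⟨c₁, c₂, c₃, c₄, hnd, hF, hnd', hPP, -, -⟩ := h.exists_walk hz hzw b (q₃ := q₃) hq₁ hq₂ hB
    (Bl₁ := {q₃ + w, w}) (card_le_two.trans (by norm_num)) (Bl₂ := fun c₁ => {q₃ + (w - c₁) + w, w - c₁ + w})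
    (fun c => card_le_two.trans (by norm_num)) (fun c₂ => [w - c₂]) (fun c₁ c₂ => b + c₁ + q₁ + c₂ + q₂ + z) (by
      intro c₁ _ h1 c₂ hc₂ h2
      simp only [mem_insert, mem_singleton, not_or] at h1 h2
      refine ⟨nodup_offsets ?_ hq₃ ?_, by simp, by simpa using hz, by simpa using hzw⟩
      · simpa [walk, sub_eq_zero, eq_comm] using hP _ hc₂
      simp only [walk, List.mem_cons, List.not_mem_nil, or_false, forall_eq_or_imp, forall_eq]
      refine ⟨⟨fun h' => h1.1 ?_, fun h' => h1.2 ?_⟩, fun h' => h2.1 ?_, fun h' => h2.2 ?_⟩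
      · rw [← sub_eq_zero, ← neg_eq_zero, ← h']; abel
      · rw [← sub_eq_zero, ← neg_eq_zero, ← sub_eq_zero.2 h']; abel
      · rw [← sub_eq_zero, ← neg_eq_zero, ← h']; abel
      · rw [← sub_eq_zero, ← neg_eq_zero, ← sub_eq_zero.2 h']; abel)
  have hlink : IsLink b a _ _ := isLink_walk (cs := [c₁, q₁, c₂, q₂, c₃, q₃, w - c₁] ++ [w - c₂]) (c := w - c₃) (by
    rw [hab, List.sum_append]
    simp only [List.sum_cons, List.sum_nil]
    abel)
  have hnd3 : [c₁, c₂, c₃].Nodup := hnd'.sublist (by simp)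
  have hPP3 : ∀ c ∈ [c₁, c₂, c₃], c ∈ P ∧ c ∉ Pu := fun c hc => hPP c (by simp at hc ⊢; tauto)
  refine ⟨(walk b ([c₁, q₁, c₂, q₂, c₃, q₃, w - c₁] ++ [w - c₂])).toFinset, [c₁, c₂, c₃].toFinset, _,
    fun x hx => (hF x (List.mem_toFinset.1 hx)).1, disjoint_left.2 fun x hx => (hF x (List.mem_toFinset.1 hx)).2, ?_,
    fun x hx => (hPP3 x (List.mem_toFinset.1 hx)).1, disjoint_left.2 fun x hx => (hPP3 x (List.mem_toFinset.1 hx)).2, ?_, hlink, ?_⟩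
  · rw [List.toFinset_card_of_nodup hnd, walk_length, List.length_append]; rfl
  · rw [List.toFinset_card_of_nodup hnd3]; rfl
  · rw [List.sum_toFinset _ hnd, List.sum_toFinset _ hnd3]
    simp only [List.map_append, List.sum_append, List.map_cons, List.map_nil, List.sum_cons, List.sum_nil, pairTok]
    abel

end LinkSupply

section LinkChain

open Finset

variable {G : Type} [AddCommGroup G] [DecidableEq G]

@[simp] theorem colourSum_pairTok (w c : G) : colourSum (pairTok w c) = w := by
  rw [pairTok, map_add, colourSum_inr, colourSum_inr, add_sub_cancel]

theorem exists_pending_colours {D D' : Finset G} (h0 : (0 : G) ∉ D) {v : ℕ} (hv : v = 8 ∨ v = 9)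
    (hD : D' ⊆ D) (hcard : #D' + (v - 7) ≤ #D) (hnine : v = 9 → #D' + 3 ≤ #D) :
    ∃ ds : List G, (0 :: walk 0 ds).Nodup ∧ ds.length = v - 7 ∧ ∃ D₁, D₁ ⊆ D ∧ #D₁ = #D' + (v - 7) ∧
      ∑ d ∈ D₁, ({Sum.inr d} : Multiset (G ⊕ G)) = ∑ d ∈ D', {Sum.inr d} + (ds.map fun d => {Sum.inr d}).sum := by
  have hsd := card_sdiff_add_card_eq_card hD
  rcases hv with rfl | rfl
  · obtain ⟨d, hd⟩ : (D \ D').Nonempty := card_pos.1 (by omega)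
    rw [mem_sdiff] at hd
    have hd0 : d ≠ 0 := fun h => h0 (h ▸ hd.1)
    refine ⟨[d], by simpa [walk, eq_comm] using hd0, rfl, insert d D', insert_subset hd.1 hD, by rw [card_insert_of_notMem hd.2], ?_⟩
    rw [sum_insert hd.2]
    simp [add_comm]
  · have h3 := hnine rfl
    obtain ⟨d, hd⟩ : (D \ D').Nonempty := card_pos.1 (by omega)
    obtain ⟨d', hd'⟩ : ((D \ D') \ {d, -d}).Nonempty := card_pos.1 (by
      have h1 := le_card_sdiff {d, -d} (D \ D')
      have h2 : #({d, -d} : Finset G) ≤ 2 := card_le_two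
      omega)
    simp only [mem_sdiff, mem_insert, mem_singleton, not_or] at hd hd'
    have hd0 : d ≠ 0 := fun h => h0 (h ▸ hd.1)
    have hd0' : d' ≠ 0 := fun h => h0 (h ▸ hd'.1.1)
    have hsum : d + d' ≠ 0 := fun h => hd'.2.2 (eq_neg_of_add_eq_zero_right h)
    have hn : d' ∉ insert d D' := by simp only [mem_insert, not_or]; exact ⟨hd'.2.1, hd'.1.2⟩
    refine ⟨[d, d'], ?_, rfl, insert d' (insert d D'), insert_subset hd'.1.1 (insert_subset hd.1 hD), ?_, ?_⟩
    · simp only [walk, zero_add, List.nodup_cons, List.mem_cons, List.not_mem_nil, or_false, not_or, not_false_eq_true,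
        List.nodup_nil, and_true]
      exact ⟨⟨hd0.symm, hsum.symm⟩, by simpa using hd0'⟩
    · rw [card_insert_of_notMem hn, card_insert_of_notMem hd.2]
    · rw [sum_insert hn, sum_insert hd.2]
      simp only [List.map_cons, List.map_nil, List.sum_cons, List.sum_nil]
      abel

theorem LinkOp.exists_initial_links {F P D : Finset G} {w z : G} {B t : ℕ} (h : LinkOp F P w B) (hz : z ≠ 0) (hzw : z ≠ w)
    (hP : ∀ c ∈ P, c ≠ w) (hD : (0 : G) ∉ D) (hB : 53 * t + 100 ≤ B) (src tgt : ℕ → G) {v : ℕ → ℕ} (hv : ∀ g < t, v g = 8 ∨ v g = 9)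
    (hcard : #D = 3 + ∑ g ∈ range t, (v g - 7)) (hlast : ∀ g < t, v g = 9 → g + 1 < t) (m : ℕ) (hm : m ≤ t) :
    ∃ (F' P' D' : Finset G) (X : ℕ → Multiset (G ⊕ G)) (q₁ q₂ q₃ : G), F' ⊆ F ∧ #F' = ∑ g ∈ range m, v g ∧ P' ⊆ P ∧ #P' = 4 * m ∧ D' ⊆ D ∧
      #D' = 3 + ∑ g ∈ range m, (v g - 7) ∧ (∀ g < m, IsLink (src g) (tgt g) (v g) (X g)) ∧ q₁ ≠ 0 ∧ q₂ ≠ 0 ∧ q₃ ≠ 0 ∧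
      ∑ g ∈ range m, X g + ({Sum.inr q₁} + {Sum.inr q₂} + {Sum.inr q₃}) =
        ∑ x ∈ F', {Sum.inl x} + ∑ c ∈ P', pairTok w c + ∑ d ∈ D', {Sum.inr d} := by
  induction m with
  | zero =>
    obtain ⟨D', hD', hc⟩ := exists_subset_card_eq (s := D) (n := 3) (by omega)
    obtain ⟨x, y, z, hxy, hxz, hyz, rfl⟩ := card_eq_three.1 hc
    have hne : ∀ x ∈ D, x ≠ 0 := fun x hx h => hD (h ▸ hx)
    refine ⟨∅, ∅, _, fun _ => 0, x, y, z, empty_subset _, by simp, empty_subset _, by simp, hD', by simpa using hc, by simp,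
      hne _ (hD' (by simp)), hne _ (hD' (by simp)), hne _ (hD' (by simp)), ?_⟩
    rw [sum_insert (by simp [hxy, hxz]), sum_insert (by simpa using hyz), sum_singleton, sum_empty, sum_empty,
      range_zero, sum_empty]
    abel
  | succ m ih =>
    obtain ⟨F', P', D', X, q₁, q₂, q₃, hF', hcF, hP', hcP, hD', hcD, hlink, hq₁, hq₂, hq₃, hX⟩ := ih (by omega)
    have hvm := hv m (by omega)
    have hsplit : ∑ g ∈ range (m + 1), (v g - 7) ≤ ∑ g ∈ range t, (v g - 7) :=
      sum_le_sum_of_subset (range_subset_range.2 hm)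
    rw [sum_range_succ] at hsplit
    obtain ⟨ds, hds, hlen, D₁, hD₁, hcD₁, hsD⟩ := exists_pending_colours hD hvm hD' (by omega) fun h9 => by
      have h1 := hlast m (by omega) h9
      have h2 := hv (m + 1) h1
      have h3 : ∑ g ∈ range (m + 2), (v g - 7) ≤ ∑ g ∈ range t, (v g - 7) :=
        sum_le_sum_of_subset (range_subset_range.2 (by omega))
      rw [sum_range_succ, sum_range_succ] at h3
      omega
    have hvs : ∑ g ∈ range m, v g ≤ 9 * m := by
      refine (sum_le_card_nsmul (range m) v 9 fun g hg => ?_).trans (by simp [mul_comm])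
      rcases hv g (by rw [mem_range] at hg; omega) with h | h <;> omega
    obtain ⟨F₁, P₁, Y, p₁, p₂, p₃, hF₁, hdF, hcF₁, hP₁, hdP, hcP₁, hp₁, hp₂, hp₃, hl, hY⟩ :=
      h.exists_link hz hzw hP (src m) (tgt m) hq₁ hq₂ hq₃ hds (by omega) (Fu := F') (Pu := P') (by omega)
    have hv7 : 7 + ds.length = v m := by omega
    rw [hv7] at hl hcF₁
    refine ⟨F' ∪ F₁, P' ∪ P₁, D₁, fun g => if g = m then Y else X g, p₁, p₂, p₃, union_subset hF' hF₁, ?_, union_subset hP' hP₁, ?_,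
      hD₁, ?_, fun g hg => ?_, hp₁, hp₂, hp₃, ?_⟩
    · rw [card_union_of_disjoint hdF.symm, sum_range_succ]; omega
    · rw [card_union_of_disjoint hdP.symm]; omega
    · rw [sum_range_succ]; omega
    · rcases eq_or_ne g m with rfl | hgm
      · simpa using hl
      · simpa [hgm] using hlink g (by omega)
    · rw [sum_range_succ, if_pos rfl, sum_union hdF.symm, sum_union hdP.symm, hsD, add_assoc, hY,
        sum_congr rfl fun g hg => if_neg (by rw [mem_range] at hg; omega)]
      calc _ = (∑ g ∈ range m, X g + ({Sum.inr q₁} + {Sum.inr q₂} + {Sum.inr q₃})) + ∑ x ∈ F₁, {Sum.inl x} + ∑ c ∈ P₁, pairTok w c +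
            (ds.map fun d => {Sum.inr d}).sum := by abel
        _ = _ := by rw [hX]; abel

theorem LinkOp.exists_links {F P D : Finset G} {w z : G} {B t : ℕ} (h : LinkOp F P w B) (hz : z ≠ 0) (hzw : z ≠ w)
    (hP : ∀ c ∈ P, c ≠ w) (hD : (0 : G) ∉ D) (hB : 53 * t + 100 ≤ B) (src tgt : ℕ → G) {v : ℕ → ℕ} (hv : ∀ g < t, v g = 8 ∨ v g = 9)
    (hvt : v t = 8) (hcard : #D = 3 + ∑ g ∈ range t, (v g - 7)) (hlast : ∀ g < t, v g = 9 → g + 1 < t)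
    (hsum : ∑ g ∈ range (t + 1), (tgt g - src g) = (4 * t + 3) • w + ∑ d ∈ D, d) :
    ∃ (F' P' : Finset G) (X : ℕ → Multiset (G ⊕ G)), F' ⊆ F ∧ #F' = ∑ g ∈ range (t + 1), v g ∧ P' ⊆ P ∧ #P' = 4 * t + 3 ∧
      (∀ g ≤ t, IsLink (src g) (tgt g) (v g) (X g)) ∧
      ∑ g ∈ range (t + 1), X g = ∑ x ∈ F', {Sum.inl x} + ∑ c ∈ P', pairTok w c + ∑ d ∈ D, {Sum.inr d} := by
  obtain ⟨F', P', D', X, q₁, q₂, q₃, hF', hcF, hP', hcP, hD', hcD, hlink, hq₁, hq₂, hq₃, hX⟩ :=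
    h.exists_initial_links hz hzw hP hD hB src tgt hv hcard hlast t le_rfl
  obtain rfl : D' = D := eq_of_subset_of_card_le hD' (by omega)
  have hcs := congrArg colourSum hX
  simp only [map_add, map_sum, colourSum_inl, colourSum_inr, colourSum_pairTok, sum_const, hcP, nsmul_zero, zero_add] at hcs
  rw [sum_congr rfl fun g hg => (hlink g (mem_range.1 hg)).colourSum_eq] at hcs
  rw [sum_range_succ] at hsum
  have hvs : ∑ g ∈ range t, v g ≤ 9 * t := by
    refine (sum_le_card_nsmul (range t) v 9 fun g hg => ?_).trans (by simp [mul_comm])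
    rcases hv g (mem_range.1 hg) with h | h <;> omega
  obtain ⟨F₁, P₁, Y, hF₁, hdF, hcF₁, hP₁, hdP, hcP₁, hl, hY⟩ :=
    h.exists_last_link hz hzw hP (b := src t) (a := tgt t) hq₁ hq₂ hq₃ (by
      have e1 : tgt t - src t = (4 * t + 3) • w + ∑ d ∈ D', d - ∑ g ∈ range t, (tgt g - src g) := by rw [← hsum]; abel
      have e2 : q₁ + q₂ + q₃ = (4 * t) • w + ∑ d ∈ D', d - ∑ g ∈ range t, (tgt g - src g) := by rw [← hcs]; abel
      rw [e2, ← sub_eq_iff_eq_add', e1, add_smul]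
      abel) (Fu := F') (Pu := P') (by omega)
  refine ⟨F' ∪ F₁, P' ∪ P₁, fun g => if g = t then Y else X g, union_subset hF' hF₁, ?_, union_subset hP' hP₁, ?_, fun g hg => ?_, ?_⟩
  · rw [card_union_of_disjoint hdF.symm, sum_range_succ]; omega
  · rw [card_union_of_disjoint hdP.symm]; omega
  · rcases eq_or_ne g t with rfl | hgm
    · simpa [hvt] using hl
    · simpa [hgm] using hlink g (by omega)
  · rw [sum_range_succ, if_pos rfl, sum_union hdF.symm, sum_union hdP.symm, hY,
      sum_congr rfl fun g hg => if_neg (by rw [mem_range] at hg; omega)]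
    calc _ = (∑ g ∈ range t, X g + ({Sum.inr q₁} + {Sum.inr q₂} + {Sum.inr q₃})) + ∑ x ∈ F₁, {Sum.inl x} + ∑ c ∈ P₁, pairTok w c := by
          abel
      _ = _ := by rw [hX]; abel

end LinkChain

section Assembly

open Finset

theorem sum_range_mul_eq {M : Type*} [AddCommMonoid M] (f : ℕ → M) (r Q : ℕ) :
    ∑ t ∈ range (r * Q), f t = ∑ i ∈ range r, ∑ j ∈ range Q, f (i * Q + j) := by
  induction r with
  | zero => simp
  | succ r ih => rw [Nat.succ_mul, sum_range_add, ih, sum_range_succ]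

theorem sum_range_cyclic {M : Type*} [AddCommMonoid M] (f : ℕ → M) {Q : ℕ} (hQ : 0 < Q) :
    ∑ j ∈ range Q, f ((j + 1) % Q) = ∑ j ∈ range Q, f j := by
  obtain ⟨t, rfl⟩ := Nat.exists_eq_succ_of_ne_zero hQ.ne'
  rw [Nat.succ_eq_add_one, sum_range_succ, Nat.mod_self, sum_range_succ' f, sum_congr rfl fun j hj => by
    rw [Nat.mod_eq_of_lt (by rw [mem_range] at hj; omega)]]

theorem Multiset.exists_eq_sum_range {α : Type*} (E : Multiset α) (x : α) :
    ∃ f : ℕ → α, E = ∑ i ∈ Finset.range (Multiset.card E), {f i} := by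
  induction E using Multiset.induction_on with
  | empty => exact ⟨fun _ => x, by simp⟩
  | cons a E ih =>
    obtain ⟨f, hf⟩ := ih
    refine ⟨fun i => if i = Multiset.card E then a else f i, ?_⟩
    beta_reduce
    rw [Multiset.card_cons, Finset.sum_range_succ, if_pos rfl, Finset.sum_congr rfl fun i hi => by
      rw [if_neg (by rw [Finset.mem_range] at hi; omega)], ← hf, add_comm, Multiset.singleton_add]

variable {G : Type} [AddCommGroup G] [DecidableEq G]

theorem Realizes.singles (W : Finset G) :
    Realizes (∑ x ∈ W, {(x, x, 1)}) (∑ x ∈ W, ({Sum.inl x} : Multiset (G ⊕ G))) := by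
  induction W using Finset.induction_on with
  | empty => simpa using Realizes.zero
  | insert a s ha ih =>
    rw [sum_insert ha, sum_insert ha]
    exact Realizes.add (by simpa [pathTokens, pathEnds] using Realizes.path [a]) ih

theorem sum_range_lt_nine (Q e : ℕ) (h : e ≤ Q) : ∑ j ∈ range Q, (if j < e then 9 else 8) = 8 * Q + e := by
  have : ∀ j ∈ range Q, (if j < e then 9 else 8) = 8 + if j < e then 1 else 0 := fun j _ => by split <;> rfl
  rw [sum_congr rfl this, sum_add_distrib, sum_const, card_range, ← card_filter, smul_eq_mul, mul_comm]
  congr 1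
  rw [show (range Q).filter (· < e) = range e by ext; simp only [mem_filter, mem_range]; omega, card_range]

theorem exists_perm_of_lines [Fintype G] (hsum : ∑ g : G, g = 0) {k r q m e : ℕ} (hr : 0 < r) (hm : 0 < m) (he : e < q)
    (hk : k = q * (m + 17) + e) (hcard : r * k = Fintype.card G - 1) {F P D W : Finset G} {w z : G} {B : ℕ}
    (h : LinkOp F P w B) (hz : z ≠ 0) (hzw : z ≠ w) (hP : ∀ c ∈ P, c ≠ w) (hD : (0 : G) ∉ D) (hB : 106 * (r * q) + 100 ≤ B)
    (hcD : #D = 2 * (r * q) + r * e + 2) (hcW : #W = r * q)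
    {E : Multiset (G × G × ℕ)} {M₀ : Multiset (G ⊕ G)} (hE : ∀ x ∈ E, x.2.2 = m) (hcE : Multiset.card E = r * q)
    (hreal : ∀ F' ⊆ F, #F' = 16 * (r * q) + r * e → ∀ P' ⊆ P, #P' = 8 * (r * q) - 1 →
      Realizes E (M₀ + (∑ x ∈ F \ F', {Sum.inl x} + ∑ c ∈ P \ P', pairTok w c)))
    (hF : 16 * (r * q) + r * e ≤ #F) (hcP : 8 * (r * q) - 1 ≤ #P)
    (htot : M₀ + (∑ x ∈ F, {Sum.inl x} + ∑ c ∈ P, pairTok w c) + ∑ x ∈ W, {Sum.inl x} + ∑ c ∈ D, {Sum.inr c} =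
      ∑ x ∈ univ.erase 0, {Sum.inl x} + ∑ c ∈ univ.erase 0, {Sum.inr c}) :
    ∃ σ : Equiv.Perm G, σ.support = univ.erase 0 ∧ (∀ c ∈ σ.cycleType, c = k) ∧
      Set.BijOn (fun v : G => v - σ v) {v : G | v ≠ 0} {v : G | v ≠ 0} := by
  set s := r * q with hs
  have hq : 0 < q := by omega
  have hs0 : 0 < s := Nat.mul_pos hr hq
  obtain ⟨f, hf⟩ := E.exists_eq_sum_range (0, 0, 0)
  obtain ⟨x, hx⟩ := W.val.exists_eq_sum_range 0
  rw [card_val, hcW] at hx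
  rw [hcE] at hf
  have hfm : ∀ g < s, (f g).2.2 = m := fun g hg => hE _ (by
    rw [hf]; exact Multiset.mem_sum.2 ⟨g, mem_range.2 hg, Multiset.mem_singleton_self _⟩)
  -- the two kinds of end data
  set pc : ℕ → G × G × ℕ := fun t => if t % 2 = 0 then ((f (t / 2)).1, (f (t / 2)).2.1, m) else (x (t / 2), x (t / 2), 1) with hpc
  have hdouble : ∀ (A : Type) [AddCommMonoid A] (φ : ℕ → A), ∑ t ∈ range (2 * s), φ t =
      ∑ g ∈ range s, φ (2 * g) + ∑ g ∈ range s, φ (2 * g + 1) := fun A _ φ => by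
    rw [mul_comm, sum_range_mul_eq, ← sum_add_distrib]
    exact sum_congr rfl fun g _ => by rw [sum_range_succ, sum_range_one, add_zero, mul_comm]
  have hpe : ∀ g, pc (2 * g) = ((f g).1, (f g).2.1, m) := fun g => by
    simp [hpc]
  have hpo : ∀ g, pc (2 * g + 1) = (x g, x g, 1) := fun g => by
    simp [hpc, show (2 * g + 1) % 2 = 1 by omega, show (2 * g + 1) / 2 = g by omega]
  have hrQ : r * (2 * q) = 2 * s := by rw [hs]; ring
  have hpcsum : ∑ t ∈ range (2 * s), ({pc t} : Multiset (G × G × ℕ)) = E + ∑ y ∈ W, {(y, y, 1)} := by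
    rw [hdouble]
    congr 1
    · rw [hf]
      refine sum_congr rfl fun g hg => ?_
      rw [hpe, ← hfm g (mem_range.1 hg)]
    · rw [sum_congr rfl fun g _ => by rw [hpo g]]
      have := congrArg (Multiset.map fun y : G => (y, y, 1)) hx
      rw [← Multiset.coe_mapAddMonoidHom, map_sum] at this
      simp only [Multiset.coe_mapAddMonoidHom, Multiset.map_singleton] at this
      rw [← this, ← Multiset.sum_map_singleton (W.val.map _), Multiset.map_map]
      rfl
  set Q := 2 * q with hQ
  have hQ0 : 0 < Q := by omega
  have hdiv : ∀ i j, j < Q → (i * Q + j) / Q = i := fun i j hj => by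
    rw [add_comm, Nat.add_mul_div_right _ _ hQ0, Nat.div_eq_of_lt hj, zero_add]
  have hmod : ∀ i j, j < Q → (i * Q + j) % Q = j := fun i j hj => by
    rw [add_comm, Nat.add_mul_mod_self_right, Nat.mod_eq_of_lt hj]
  set v : ℕ → ℕ := fun t => if t % Q < e then 9 else 8 with hv
  have hv89 : ∀ t, v t = 8 ∨ v t = 9 := fun t => by simp only [hv]; split <;> simp
  have hvsum : ∑ t ∈ range (2 * s), v t = 16 * s + r * e := by
    rw [← hrQ, sum_range_mul_eq]
    have : ∀ i ∈ range r, ∑ j ∈ range Q, v (i * Q + j) = 8 * Q + e := fun i _ => by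
      rw [← sum_range_lt_nine Q e (by omega)]
      exact sum_congr rfl fun j hj => by simp only [hv, hmod i j (mem_range.1 hj)]
    rw [sum_congr rfl this, sum_const, card_range, smul_eq_mul, mul_add, hs, hQ]
    ring
  have hlastpos : ∀ c, c < Q → (2 * s - 1 - c) % Q = Q - 1 - c := fun c hc => by
    obtain ⟨r', rfl⟩ := Nat.exists_eq_succ_of_ne_zero hr.ne'
    rw [← hmod r' (Q - 1 - c) (by omega), ← hrQ, Nat.succ_mul]
    congr 1
    omega
  have hvlast : v (2 * s - 1) = 8 := by
    have := hlastpos 0 hQ0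
    simp only [hv]
    rw [if_neg (by rw [Nat.sub_zero] at this; omega)]
  have hsplit : ∑ t ∈ range (2 * s), v t = ∑ t ∈ range (2 * s - 1), v t + 8 := by
    conv_lhs => rw [show 2 * s = 2 * s - 1 + 1 by omega, sum_range_succ, hvlast]
  have hv7 : ∑ t ∈ range (2 * s - 1), v t = ∑ t ∈ range (2 * s - 1), (v t - 7) + (2 * s - 1) * 7 := by
    have e1 : (2 * s - 1) * 7 = ∑ t ∈ range (2 * s - 1), 7 := by simp
    rw [e1, ← sum_add_distrib]
    exact sum_congr rfl fun t _ => by have := hv89 t; omega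
  set tgt : ℕ → G := fun t => (pc (t / Q * Q + (t % Q + 1) % Q)).1 with htgt
  have htgtsum : ∑ t ∈ range (2 * s), tgt t = ∑ t ∈ range (2 * s), (pc t).1 := by
    rw [← hrQ, sum_range_mul_eq, sum_range_mul_eq]
    refine sum_congr rfl fun i _ => ?_
    rw [← sum_range_cyclic (fun j => (pc (i * Q + j)).1) hQ0]
    exact sum_congr rfl fun j hj => by simp only [htgt, hmod i j (mem_range.1 hj), hdiv i j (mem_range.1 hj)]
  -- the total displacement of the links
  have hdisp : ∑ t ∈ range (2 * s - 1 + 1), (tgt t - (pc t).2.1) = (4 * (2 * s - 1) + 3) • w + ∑ d ∈ D, d := by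
    obtain ⟨F', hF', hcF'⟩ := exists_subset_card_eq hF
    obtain ⟨P', hP', hcP'⟩ := exists_subset_card_eq hcP
    have e1 := (hreal F' hF' hcF' P' hP' hcP').colourSum_eq
    have e2 := congrArg colourSum htot
    have e3 : ∑ c ∈ (univ : Finset G).erase 0, c = 0 := (sum_erase univ (f := fun c : G => c) rfl).trans hsum
    simp only [map_add, map_sum, colourSum_inl, colourSum_inr, colourSum_pairTok, sum_const, nsmul_zero, zero_add, add_zero, e3]
      at e1 e2
    have e4 : #P • w = #(P \ P') • w + (8 * s - 1) • w := by
      rw [← add_smul, ← hcP', card_sdiff_add_card_eq_card hP']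
    have e5 : (E.map fun e => e.2.1 - e.1).sum = ∑ t ∈ range (2 * s), ((pc t).2.1 - (pc t).1) := by
      have := congrArg (fun E => (Multiset.map (fun e : G × G × ℕ => e.2.1 - e.1) E).sum) hf
      rw [this, hdouble]
      simp only [hpe, hpo, sub_self, sum_const_zero, add_zero]
      have := map_sum ((Multiset.sumAddMonoidHom (M := G)).comp (Multiset.mapAddMonoidHom fun e : G × G × ℕ => e.2.1 - e.1))
        (fun i => {f i}) (range s)
      simpa only [AddMonoidHom.comp_apply, Multiset.coe_sumAddMonoidHom, Multiset.coe_mapAddMonoidHom, Multiset.map_singleton,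
        Multiset.sum_singleton] using this
    rw [Nat.sub_add_cancel (by omega), sum_sub_distrib, htgtsum, show 4 * (2 * s - 1) + 3 = 8 * s - 1 by omega]
    rw [sum_sub_distrib] at e5
    rw [e4] at e2
    rw [e5] at e1
    have e6 : ∑ t ∈ range (2 * s), (pc t).2.1 = ∑ t ∈ range (2 * s), (pc t).1 + (colourSum M₀ + #(P \ P') • w) := by
      rw [e1]; abel
    rw [e6, ← sub_eq_zero, ← neg_eq_zero, ← e2]
    abel
  obtain ⟨F', P', X, hF', hcF', hP', hcP', hlink, hX⟩ := h.exists_links (t := 2 * s - 1) hz hzw hP hD (by omega)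
    (fun t => (pc t).2.1) tgt (fun g _ => hv89 g) hvlast (by omega) (fun g hg h9 => by
      by_contra hcon
      have h1 := hlastpos 1 (by omega)
      rw [show 2 * s - 1 - 1 = g by omega] at h1
      simp only [hv] at h9
      split at h9 <;> omega) hdisp
  rw [Nat.sub_add_cancel (by omega)] at hcF' hX
  have hR := (hreal F' hF' (by omega) P' hP' (by omega)).add (Realizes.singles W)
  rw [← hpcsum] at hR
  have hall : M₀ + (∑ x ∈ F \ F', {Sum.inl x} + ∑ c ∈ P \ P', pairTok w c) + ∑ x ∈ W, {Sum.inl x} + ∑ t ∈ range (2 * s), X t =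
      ∑ x ∈ univ.erase 0, {Sum.inl x} + ∑ c ∈ univ.erase 0, {Sum.inr c} := by
    rw [← htot, hX, ← sum_sdiff hF', ← sum_sdiff hP']
    abel
  have hnodup : (∑ x ∈ univ.erase (0 : G), {Sum.inl x} + ∑ c ∈ univ.erase (0 : G), {Sum.inr c} : Multiset (G ⊕ G)) =
      (Finset.disjSum ((univ : Finset G).erase 0) ((univ : Finset G).erase 0)).val := by
    rw [Finset.val_disjSum, Multiset.disjSum, ← Multiset.sum_map_singleton (Multiset.map Sum.inl _),
      ← Multiset.sum_map_singleton (Multiset.map Sum.inr _), Multiset.map_map, Multiset.map_map]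
    rfl
  have hXX : ∑ t ∈ range (2 * s), X t = ∑ i ∈ range r, ∑ j ∈ range Q, X (i * Q + j) := by rw [← hrQ, sum_range_mul_eq]
  rw [hXX] at hall
  refine exists_perm_of_links (r := r) (Q := Q) (k := k) ?_ hQ0 (fun i j => (pc (i * Q + j)).1) (fun i j => (pc (i * Q + j)).2.1)
    (fun i j => (pc (i * Q + j)).2.2) (fun i j => v (i * Q + j)) (fun i j => X (i * Q + j)) (fun i j => ?_)
    (fun i hi j hj => ?_) (fun i hi => ?_) hcard (M := M₀ + (∑ x ∈ F \ F', {Sum.inl x} + ∑ c ∈ P \ P', pairTok w c) + ∑ x ∈ W, {Sum.inl x}) ?_ ?_ ?_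
  · have : 1 * 18 ≤ q * (m + 17) := Nat.mul_le_mul hq (by omega)
    omega
  · simp only [hpc]
    split
    · exact hm
    · exact one_pos
  · have hlt : i * Q + j < 2 * s := by
      rw [← hrQ]
      have : (i + 1) * Q ≤ r * Q := Nat.mul_le_mul_right _ hi
      rw [Nat.succ_mul] at this
      omega
    have := hlink (i * Q + j) (by omega)
    simpa only [htgt, hmod i j hj, hdiv i j hj] using this
  · rw [sum_add_distrib]
    have e1 : ∑ j ∈ range Q, v (i * Q + j) = 8 * Q + e := by
      rw [← sum_range_lt_nine Q e (by omega)]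
      exact sum_congr rfl fun j hj => by simp only [hv, hmod i j (mem_range.1 hj)]
    have e2 : ∑ j ∈ range Q, (pc (i * Q + j)).2.2 = q * (m + 1) := by
      rw [hQ, mul_comm 2 q, sum_range_mul_eq]
      have : ∀ g ∈ range q, ∑ j ∈ range 2, (pc (i * (q * 2) + (g * 2 + j))).2.2 = m + 1 := fun g _ => by
        rw [sum_range_succ, sum_range_one, show i * (q * 2) + (g * 2 + 0) = 2 * (i * q + g) by ring,
          show i * (q * 2) + (g * 2 + 1) = 2 * (i * q + g) + 1 by ring, hpe, hpo]
      rw [sum_congr rfl this]; simp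
    rw [e1, e2, hk, hQ]; ring
  · rwa [← sum_range_mul_eq (fun t => {((pc t).1, (pc t).2.1, (pc t).2.2)}), hrQ]
  · rw [hall, hnodup]; exact Finset.nodup _
  · rw [hall, hnodup, Finset.mem_val, Finset.inl_mem_disjSum]
    exact notMem_erase _ _

end Assembly

section Lines

open Finset

variable {G : Type} [AddCommGroup G] [DecidableEq G]

theorem sum_tokens_eq_val_disjSum (A B : Finset G) :
    (∑ x ∈ A, {Sum.inl x} + ∑ c ∈ B, {Sum.inr c} : Multiset (G ⊕ G)) = (A.disjSum B).val := by
  rw [Finset.val_disjSum, Multiset.disjSum, ← Multiset.sum_map_singleton (Multiset.map Sum.inl _),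
    ← Multiset.sum_map_singleton (Multiset.map Sum.inr _), Multiset.map_map, Multiset.map_map]
  rfl

theorem Multiset.Nodup.exists_tokens {M : Multiset (G ⊕ G)} (h : M.Nodup) :
    ∃ A B : Finset G, M = (A.disjSum B).val ∧ #A = M.countP (fun a => a.isLeft) ∧ #B = M.countP (fun a => a.isRight) := by
  have hM : M = (M.toFinset.toLeft.disjSum M.toFinset.toRight).val := by
    rw [Finset.toLeft_disjSum_toRight, Multiset.toFinset_val, h.dedup]
  refine ⟨_, _, hM, ?_, ?_⟩
  all_goals
    generalize M.toFinset.toLeft = A at hM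
    generalize M.toFinset.toRight = B at hM
    rw [hM, Finset.val_disjSum, Multiset.disjSum, Multiset.countP_add, Multiset.countP_map, Multiset.countP_map]
    simp

theorem countP_isLeft_pathTokens (l : List G) : (pathTokens l).countP (fun a => a.isLeft) = l.length := by
  induction l with
  | nil => simp [pathTokens]
  | cons a l ih =>
    cases l with
    | nil => rfl
    | cons b l =>
      rw [pathTokens, Multiset.countP_add, ih, Multiset.countP_add, List.length_cons (a := a), add_comm]
      rfl

theorem countP_isRight_pathTokens (l : List G) : (pathTokens l).countP (fun a => a.isRight) = l.length - 1 := by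
  induction l with
  | nil => simp [pathTokens]
  | cons a l ih =>
    cases l with
    | nil => rfl
    | cons b l =>
      rw [pathTokens, Multiset.countP_add, ih, Multiset.countP_add, List.length_cons (a := a), List.length_cons, add_comm]
      rfl

/-- A family of vertex-disjoint rainbow paths with `j + 1` vertices, indexed by their last vertices, with vertices in `V`
and colours in `C`. -/
structure Lines (S : Finset G) (j : ℕ) (p : G → List G) (V C : Finset G) : Prop where
  length_eq : ∀ x ∈ S, (p x).length = j + 1
  last : ∀ x ∈ S, ∃ l, p x = l ++ [x]
  nodup : (∑ x ∈ S, pathTokens (p x)).Nodup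
  vertex_mem : ∀ v, Sum.inl v ∈ ∑ x ∈ S, pathTokens (p x) → v ∈ V
  colour_mem : ∀ c, Sum.inr c ∈ ∑ x ∈ S, pathTokens (p x) → c ∈ C

namespace Lines

variable {S V C : Finset G} {j : ℕ} {p : G → List G}

theorem mono (h : Lines S j p V C) {S' : Finset G} (hS : S' ⊆ S) : Lines S' j p V C where
  length_eq x hx := h.length_eq x (hS hx)
  last x hx := h.last x (hS hx)
  nodup := Multiset.nodup_of_le (sum_le_sum_of_subset hS) h.nodup
  vertex_mem v hv := h.vertex_mem v (Multiset.subset_of_le (sum_le_sum_of_subset hS) hv)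
  colour_mem v hv := h.colour_mem v (Multiset.subset_of_le (sum_le_sum_of_subset hS) hv)

theorem exists_tokens (h : Lines S j p V C) : ∃ U D : Finset G, ∑ x ∈ S, pathTokens (p x) = (U.disjSum D).val ∧
    U ⊆ V ∧ D ⊆ C ∧ #U = (j + 1) * #S ∧ #D = j * #S := by
  obtain ⟨U, D, e, hU, hD⟩ := h.nodup.exists_tokens
  refine ⟨U, D, e, fun v hv => h.vertex_mem v ?_, fun v hv => h.colour_mem v ?_, ?_, ?_⟩
  · rw [e]; simpa using hv
  · rw [e]; simpa using hv
  · rw [hU, ← Multiset.coe_countPAddMonoidHom, map_sum]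
    simp only [Multiset.coe_countPAddMonoidHom, countP_isLeft_pathTokens]
    rw [sum_congr rfl h.length_eq, sum_const, smul_eq_mul, mul_comm]
  · rw [hD, ← Multiset.coe_countPAddMonoidHom, map_sum]
    simp only [Multiset.coe_countPAddMonoidHom, countP_isRight_pathTokens]
    rw [sum_congr rfl fun x hx => by rw [h.length_eq x hx, Nat.add_sub_cancel], sum_const, smul_eq_mul, mul_comm]

theorem step (h : Lines S j p V C) {B C' : Finset G} (hB : Disjoint V B) (hC : C' ⊆ C)
    (hC' : ∀ c ∈ C', Sum.inr c ∉ ∑ x ∈ S, pathTokens (p x)) {M : Finset (G × G)} (hM : IsRainbowMatching S B C' M) :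
    ∃ p', Lines (M.image Prod.snd) (j + 1) p' (V ∪ B) C := by
  have hex : ∀ y : G, ∃ x, y ∈ M.image Prod.snd → (x, y) ∈ M := fun y => by
    by_cases hy : y ∈ M.image Prod.snd
    · obtain ⟨q, hq, rfl⟩ := mem_image.1 hy
      exact ⟨q.1, fun _ => hq⟩
    · exact ⟨0, fun h => absurd h hy⟩
  choose μ hμ using hex
  have hμM : ∀ q ∈ M, μ q.2 = q.1 := fun q hq =>
    congrArg Prod.fst (hM.snd_inj _ (hμ q.2 (mem_image_of_mem _ hq)) _ hq rfl)
  have hsum : ∑ y ∈ M.image Prod.snd, pathTokens (p (μ y) ++ [y]) =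
      ∑ x ∈ M.image Prod.fst, pathTokens (p x) +
        ((M.image Prod.snd).disjSum (M.image fun q => q.2 - q.1)).val := by
    rw [← sum_tokens_eq_val_disjSum, sum_image fun q hq q' hq' => hM.snd_inj q hq q' hq',
      sum_image fun q hq q' hq' => hM.fst_inj q hq q' hq', sum_image fun q hq q' hq' => hM.snd_inj q hq q' hq',
      sum_image fun q hq q' hq' => hM.sub_inj q hq q' hq', ← sum_add_distrib, ← sum_add_distrib]
    refine sum_congr rfl fun q hq => ?_
    rw [hμM q hq]
    obtain ⟨l, hl⟩ := h.last _ (hM.fst_mem q hq)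
    rw [hl, pathTokens_append, pathTokens]
    abel
  have hle : ∑ x ∈ M.image Prod.fst, pathTokens (p x) ≤ ∑ x ∈ S, pathTokens (p x) :=
    sum_le_sum_of_subset (image_subset_iff.2 hM.fst_mem)
  refine ⟨fun y => p (μ y) ++ [y], fun y hy => ?_, fun y hy => ⟨_, rfl⟩, ?_, fun v hv => ?_, fun c hc => ?_⟩
  · rw [List.length_append, h.length_eq _ (hM.fst_mem _ (hμ y hy))]; rfl
  · rw [hsum]
    refine (Multiset.nodup_of_le hle h.nodup).add_iff (Finset.nodup _) |>.2 ?_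
    rw [Multiset.disjoint_left]
    intro a ha ha'
    have ha := Multiset.subset_of_le hle ha
    rw [Finset.mem_val] at ha'
    cases a with
    | inl v =>
      rw [inl_mem_disjSum, mem_image] at ha'
      obtain ⟨q, hq, rfl⟩ := ha'
      exact disjoint_left.1 hB (h.vertex_mem _ ha) (hM.snd_mem q hq)
    | inr c =>
      rw [inr_mem_disjSum, mem_image] at ha'
      obtain ⟨q, hq, rfl⟩ := ha'
      exact hC' _ (hM.sub_mem q hq) ha
  · rw [hsum, Multiset.mem_add, Finset.mem_val, inl_mem_disjSum, mem_image] at hv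
    rcases hv with hv | ⟨q, hq, rfl⟩
    · exact mem_union_left _ (h.vertex_mem v (Multiset.subset_of_le hle hv))
    · exact mem_union_right _ (hM.snd_mem q hq)
  · rw [hsum, Multiset.mem_add, Finset.mem_val, inr_mem_disjSum, mem_image] at hc
    rcases hc with hv | ⟨q, hq, rfl⟩
    · exact h.colour_mem c (Multiset.subset_of_le hle hv)
    · exact hC (hM.sub_mem q hq)

end Lines

theorem Lines.exists_chain {B : ℕ → Finset G} {C : Finset G} {m ℓ d : ℕ} (hd : ∀ i j, i < j → j < m → Disjoint (B i) (B j))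
    (h0 : ℓ + (m - 1) * d ≤ #(B 0))
    (hstep : ∀ j, j + 1 < m → ∀ A ⊆ B j, #A = ℓ + (m - 1 - j) * d → ∀ C' ⊆ C, #C' + j * #A = #C →
      ∃ M, IsRainbowMatching A (B (j + 1)) C' M ∧ #A < #M + d) (j : ℕ) (hj : j < m) :
    ∃ S p, Lines S j p ((range (j + 1)).biUnion B) C ∧ S ⊆ B j ∧ #S = ℓ + (m - 1 - j) * d := by
  induction j with
  | zero =>
    obtain ⟨S, hS, hcS⟩ := exists_subset_card_eq h0
    have hsum : ∑ x ∈ S, pathTokens [x] = (S.disjSum ∅).val := by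
      rw [← sum_tokens_eq_val_disjSum, sum_empty, add_zero]; rfl
    refine ⟨S, fun x => [x], ⟨fun x _ => rfl, fun x _ => ⟨[], rfl⟩, ?_, fun v hv => ?_, fun c hc => ?_⟩, hS, hcS⟩
    · rw [hsum]; exact Finset.nodup _
    · rw [hsum, Finset.mem_val, inl_mem_disjSum] at hv
      simpa using hS hv
    · rw [hsum, Finset.mem_val, inr_mem_disjSum] at hc
      simp at hc
  | succ j ih =>
    obtain ⟨S, p, hp, hS, hcS⟩ := ih (by omega)
    obtain ⟨U, D, e, -, hD, -, hcD⟩ := hp.exists_tokens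
    obtain ⟨M, hM, hcM⟩ := hstep j hj S hS hcS (C \ D) sdiff_subset (by
      rw [← hcD, card_sdiff_add_card_eq_card hD])
    obtain ⟨p', hp'⟩ := hp.step (B := B (j + 1)) (C' := C \ D) (by
      rw [disjoint_biUnion_left]
      exact fun i hi => hd i (j + 1) (by simpa using hi) hj) sdiff_subset (fun c hc hc' => by
        rw [e, Finset.mem_val, inr_mem_disjSum] at hc'
        exact (mem_sdiff.1 hc).2 hc') hM
    have hcard : #(M.image Prod.snd) = #M := card_image_of_injOn fun q hq q' hq' => hM.snd_inj q hq q' hq'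
    obtain ⟨S', hS', hcS'⟩ := exists_subset_card_eq (s := M.image Prod.snd) (n := ℓ + (m - 1 - (j + 1)) * d) (by
      rw [hcard]
      have : m - 1 - j = m - 1 - (j + 1) + 1 := by omega
      rw [this, add_mul, one_mul] at hcS
      omega)
    refine ⟨S', p', ?_, hS'.trans (image_subset_iff.2 hM.snd_mem), hcS'⟩
    rw [range_add_one, biUnion_insert, union_comm]
    exact hp'.mono hS'

/-- Layers joined by nearly perfect rainbow matchings contain many disjoint rainbow paths. -/
theorem exists_lines {B : ℕ → Finset G} {C : Finset G} {m ℓ d : ℕ} (hm : 0 < m)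
    (hd : ∀ i j, i < j → j < m → Disjoint (B i) (B j)) (h0 : ℓ + (m - 1) * d ≤ #(B 0))
    (hstep : ∀ j, j + 1 < m → ∀ A ⊆ B j, #A = ℓ + (m - 1 - j) * d → ∀ C' ⊆ C, #C' + j * #A = #C →
      ∃ M, IsRainbowMatching A (B (j + 1)) C' M ∧ #A < #M + d) :
    ∃ (E : Multiset (G × G × ℕ)) (U D : Finset G), (∀ e ∈ E, e.2.2 = m) ∧ Multiset.card E = ℓ ∧
      U ⊆ (range m).biUnion B ∧ D ⊆ C ∧ #U = m * ℓ ∧ #D = (m - 1) * ℓ ∧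
      Realizes E (∑ x ∈ U, {Sum.inl x} + ∑ c ∈ D, {Sum.inr c}) := by
  obtain ⟨S, p, hp, -, hcS⟩ := Lines.exists_chain hd h0 hstep (m - 1) (by omega)
  obtain ⟨U, D, e, hU, hD, hcU, hcD⟩ := hp.exists_tokens
  rw [Nat.sub_self, zero_mul, add_zero] at hcS
  rw [Nat.sub_add_cancel hm] at hU hcU hp
  rw [hcS] at hcU hcD
  refine ⟨∑ x ∈ S, {pathEnds (p x)}, U, D, fun e he => ?_, by simp [hcS], hU, hD, hcU, hcD, ?_⟩
  · obtain ⟨x, hx, hxe⟩ := Multiset.mem_sum.1 he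
    rw [Multiset.mem_singleton.1 hxe]
    have := hp.length_eq x hx
    simp only [pathEnds, this]
    omega
  · rw [sum_tokens_eq_val_disjSum, ← e]
    exact Realizes.sum S fun x _ => Realizes.path (p x)

end Lines

section LineShape

open Finset

variable {G : Type} [AddCommGroup G] [Fintype G] [DecidableEq G]

namespace Cls

/-- The vertex or colour `x`, according to the class. -/
def tok (c : Cls) (x : G) : G ⊕ G := if c.isCol then Sum.inr x else Sum.inl x

/-- The first label of a class. -/
def lo (c : ℕ) : Cls → ℕ
  | F => 0
  | Va => 1
  | Vb => c + 1
  | P => 0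
  | NP => 1
  | Ca => 1
  | T => 32 * c + 1

/-- One more than the last label of a class. -/
def hi (c : ℕ) : Cls → ℕ
  | F => 1
  | Va => c + 1
  | Vb => 64 * c
  | P => 1
  | NP => 64 * c
  | Ca => 32 * c + 1
  | T => 64 * c

/-- The labels of a class, out of `64 * c` labels. -/
def labels (c : ℕ) (x : Cls) : Finset (Fin (64 * c)) := {i | x.lo c ≤ i.val ∧ i.val < x.hi c}

theorem mem_labels {c : ℕ} {x : Cls} {i : Fin (64 * c)} : i ∈ labels c x ↔ x.lo c ≤ i.val ∧ i.val < x.hi c := by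
  simp [labels]

theorem card_labels {c : ℕ} (hc : 0 < c) (x : Cls) : #(labels c x) = x.hi c - x.lo c := by
  have h : x.hi c ≤ 64 * c := by cases x <;> simp only [hi] <;> omega
  rw [labels, ← Nat.card_Ico, ← card_map Fin.valEmbedding]
  congr 1
  ext i
  simp only [mem_map, mem_filter, mem_univ, true_and, Fin.valEmbedding_apply, mem_Ico]
  exact ⟨by rintro ⟨a, ha, rfl⟩; exact ha, fun hi' => ⟨⟨i, by omega⟩, hi', rfl⟩⟩

/-- The proportion of labels in a class. -/
noncomputable def dens (c : ℕ) (x : Cls) : ℝ := (#(labels c x) : ℝ) / (64 * c)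

theorem dens_nonneg (c : ℕ) (x : Cls) : 0 ≤ x.dens c := by unfold dens; positivity

theorem dens_le_one (c : ℕ) (x : Cls) : x.dens c ≤ 1 := by
  refine div_le_one_of_le₀ ?_ (by positivity)
  have := card_le_univ (labels c x)
  rw [Fintype.card_fin] at this
  exact_mod_cast this

end Cls

/-- A system of affine forms in one unknown. -/
abbrev lineShape {h : ℕ} (c : Fin h → ℤ) (cls : Fin h → Cls) : Shape := ⟨1, h, fun i _ => c i, cls⟩

theorem lineShape_valid {h : ℕ} {c : Fin h → ℤ} (hc : ∀ i, (c i).natAbs = 1) (cls : Fin h → Cls) : (lineShape c cls).Valid :=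
  fun i => ⟨0, hc i⟩

open Classical in
theorem Shape.Good.line {q : ℕ} {τ : ℝ} {ω : G ⊕ G → Fin (64 * q)} {h : ℕ} {c : Fin h → ℤ} {cls : Fin h → Cls}
    (hω : (lineShape c cls).Good (Cls.labels q) τ ω) (g : Fin h → G) :
    |(#{y : G | Function.Injective (fun i => (cls i).tok (c i • y + g i)) ∧
      ∀ i, ω ((cls i).tok (c i • y + g i)) ∈ Cls.labels q (cls i)} : ℝ) -
      #{y : G | Function.Injective (fun i => (cls i).tok (c i • y + g i))} * ∏ i, (cls i).dens q| ≤ τ * h := by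
  have h1 := hω g
  have e : ∀ p : Fin 1 → G, (lineShape c cls).pos g p = fun i => (cls i).tok (c i • p 0 + g i) := fun p => by
    funext i
    simp only [Shape.pos, lineShape, Cls.tok]
    rw [show ∑ j : Fin 1, c i • p j = c i • p 0 from Fin.sum_univ_one _]
  have hcard : ∀ (Q : G → Prop) [DecidablePred Q], #{p : Fin 1 → G | Q (p 0)} = #{y : G | Q y} := fun Q _ => by
    refine card_bij (fun p _ => p 0) (fun p hp => by simpa using hp) (fun p _ p' _ h => ?_) (fun y hy => ⟨fun _ => y, by simpa using hy, rfl⟩)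
    funext i
    rwa [Subsingleton.elim i 0]
  have e1 : #((lineShape c cls).nondeg g) = #{y : G | Function.Injective (fun i => (cls i).tok (c i • y + g i))} := by
    refine Eq.trans ?_ (hcard fun y => Function.Injective (fun i => (cls i).tok (c i • y + g i)))
    congr 1
    ext p
    rw [Shape.nondeg, mem_filter, mem_filter, e]
  have e2 : #{p ∈ (lineShape c cls).nondeg g | ∀ i, ω ((lineShape c cls).pos g p i) ∈ Cls.labels q ((lineShape c cls).cls i)} =
      #{y : G | Function.Injective (fun i => (cls i).tok (c i • y + g i)) ∧
        ∀ i, ω ((cls i).tok (c i • y + g i)) ∈ Cls.labels q (cls i)} := by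
    refine Eq.trans ?_ (hcard fun y => Function.Injective (fun i => (cls i).tok (c i • y + g i)) ∧
        ∀ i, ω ((cls i).tok (c i • y + g i)) ∈ Cls.labels q (cls i))
    congr 1
    ext p
    rw [Shape.nondeg, mem_filter, mem_filter, mem_filter, e, and_assoc]
  have e3 : (lineShape c cls).density (Cls.labels q) = ∏ i, (cls i).dens q := by
    simp only [Shape.density, Cls.dens, Fintype.card_fin]
    push_cast
    rfl
  have e4 : τ * ((lineShape c cls).h * (Fintype.card G : ℝ) ^ ((lineShape c cls).r - 1)) = τ * h := by
    rw [show (lineShape c cls).r - 1 = 0 from rfl, pow_zero, mul_one]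
  rw [e1, e3, e4] at h1
  rw [← e2]
  convert h1

variable {q : ℕ} {τ : ℝ} {ω : G ⊕ G → Fin (64 * q)}

/-- The elements of a class. -/
def Cls.members (ω : G ⊕ G → Fin (64 * q)) (x : Cls) : Finset G := {y | ω (x.tok y) ∈ x.labels q}

theorem Cls.mem_members {x : Cls} {y : G} : y ∈ x.members ω ↔ ω (x.tok y) ∈ x.labels q := by
  simp [Cls.members]

theorem Shape.Good.size {x : Cls} (hω : (lineShape ![1] ![x]).Good (Cls.labels q) τ ω) :
    |(#(x.members ω) : ℝ) - Fintype.card G * x.dens q| ≤ τ := by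
  classical
  have := hω.line ![0]
  rw [filter_true_of_mem fun y _ => Function.injective_of_subsingleton _] at this
  simpa [Cls.members, Function.injective_of_subsingleton] using this

theorem Cls.tok_injective {x : Cls} : Function.Injective (x.tok : G → G ⊕ G) := by
  intro a b h
  simp only [Cls.tok] at h
  split at h
  · exact Sum.inr_injective h
  · exact Sum.inl_injective h

theorem Shape.Good.codegree {x : Cls} (hω : (lineShape ![1, 1] ![x, x]).Good (Cls.labels q) τ ω) {g : G} (hg : g ≠ 0) :
    |(#{y ∈ x.members ω | y + g ∈ x.members ω} : ℝ) - Fintype.card G * x.dens q ^ 2| ≤ τ * 2 := by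
  classical
  have := hω.line ![0, g]
  have hinj : ∀ y : G, Function.Injective (fun i : Fin 2 => (![x, x] i).tok (![(1 : ℤ), 1] i • y + ![0, g] i)) := fun y => by
    intro i j h
    fin_cases i <;> fin_cases j <;> simp_all [Cls.tok_injective.eq_iff]
  rw [filter_true_of_mem fun y _ => hinj y] at this
  simp only [hinj, true_and, Fin.forall_fin_two, Fin.prod_univ_two] at this
  simp only [Matrix.cons_val_zero, Matrix.cons_val_one, one_smul, add_zero] at this
  rw [Cls.members, filter_filter]
  simpa [sq, Cls.mem_members] using this

end LineShape

section LinkSupply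

open Finset

variable {G : Type} [AddCommGroup G] [Fintype G] [DecidableEq G]

theorem exists_card_double_le_one (hn : 3 ≤ Fintype.card G) : ∃ w : G, w ≠ 0 ∧ #{c : G | c + c = w} ≤ 1 := by
  by_contra! hcon
  have h1 : Fintype.card G = ∑ w : G, #{c : G | c + c = w} := by
    rw [← card_univ]
    exact card_eq_sum_card_fiberwise fun _ _ => mem_coe.2 (mem_univ _)
  have h2 : ∑ w ∈ (univ : Finset G).erase 0, 2 ≤ ∑ w ∈ (univ : Finset G).erase 0, #{c : G | c + c = w} :=
    sum_le_sum fun w hw => hcon w (ne_of_mem_erase hw)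
  rw [sum_const, card_erase_of_mem (mem_univ _), card_univ, smul_eq_mul] at h2
  have h3 := sum_erase_add (univ : Finset G) (fun w => #{c : G | c + c = w}) (mem_univ 0)
  omega

theorem two_mul_card_double_le {e a : G} (h : a ≠ e) : 2 * #{y : G | y + y = e + a} ≤ Fintype.card G := by
  by_cases ht : ∃ t : G, t + t ≠ 0
  · obtain ⟨t, ht⟩ := ht
    have hd : Disjoint ({y : G | y + y = e + a} : Finset G) (({y : G | y + y = e + a} : Finset G).map (addRightEmbedding t)) := by
      rw [disjoint_left]
      rintro y hy hy'
      simp only [mem_map, mem_filter, mem_univ, true_and, addRightEmbedding_apply] at hy hy'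
      obtain ⟨x, hx, rfl⟩ := hy'
      refine ht (add_left_cancel (a := x + x) ?_)
      rw [add_zero]
      exact (by abel : x + x + (t + t) = x + t + (x + t)).trans (hy.trans hx.symm)
    have := card_le_univ (({y : G | y + y = e + a} : Finset G) ∪ ({y : G | y + y = e + a} : Finset G).map (addRightEmbedding t))
    rw [card_union_of_disjoint hd, card_map] at this
    omega
  · push Not at ht
    rw [filter_false_of_mem]
    · simp
    · intro y _ hy
      rw [ht] at hy
      refine h (add_left_cancel (a := e) ?_)
      rw [ht, ← hy]

variable {q : ℕ} {τ : ℝ} {ω : G ⊕ G → Fin (64 * q)}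

/-- The colours `c` for which `{c, w - c}` is a pair reserved for links. -/
def linkColours (ω : G ⊕ G → Fin (64 * q)) (w : G) : Finset G :=
  {c | ω (Sum.inr c) ∈ Cls.labels q .P ∧ ω (Sum.inr (w - c)) ∈ Cls.labels q .NP ∧ c ≠ 0 ∧ c ≠ w}

theorem mem_linkColours {w c : G} : c ∈ linkColours ω w ↔
    ω (Sum.inr c) ∈ Cls.labels q .P ∧ ω (Sum.inr (w - c)) ∈ Cls.labels q .NP ∧ c ≠ 0 ∧ c ≠ w := by
  simp [linkColours]

theorem Cls.dens_P (hq : 0 < q) : Cls.dens q .P = 1 / (64 * q) := by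
  rw [Cls.dens, Cls.card_labels hq]; simp [Cls.hi, Cls.lo]

theorem Cls.dens_F (hq : 0 < q) : Cls.dens q .F = 1 / (64 * q) := by
  rw [Cls.dens, Cls.card_labels hq]; simp [Cls.hi, Cls.lo]

theorem Cls.dens_NP (hq : 0 < q) : Cls.dens q .NP = 1 - 1 / (64 * q) := by
  rw [Cls.dens, Cls.card_labels hq]
  simp only [Cls.hi, Cls.lo]
  rw [Nat.cast_sub (by omega)]
  push_cast
  have : (q : ℝ) ≠ 0 := by positivity
  field_simp

theorem linkOp_of_good (hq : 0 < q) {w : G} (hw : #{c : G | c + c = w} ≤ 1) {B : ℕ}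
    (hω : (lineShape ![1, 1, 1, 1, 1, 1, -1, -1, 1] ![.F, .F, .F, .F, .F, .P, .NP, .P, .NP]).Good (Cls.labels q) τ ω)
    (hn : 5 ≤ Fintype.card G)
    (hB : 9 * τ + B + 9 < ((Fintype.card G : ℝ) / 2 - 2) * ((1 / (64 * q)) ^ 7 * (1 / 4))) :
    LinkOp ((Cls.members ω .F).erase 0) (linkColours ω w) w B := by
  classical
  intro A hA e a h0 hne Bl hBl
  obtain ⟨A', hAA', hA'⟩ := exists_superset_card_eq hA (by simpa using hn)
  obtain ⟨α, hα, hαA⟩ : ∃ α : Fin 5 → G, Function.Injective α ∧ ∀ x ∈ A', ∃ i, α i = x := by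
    refine ⟨fun i => (A'.equivFinOfCardEq hA').symm i, Subtype.val_injective.comp (Equiv.injective _), fun x hx => ?_⟩
    exact ⟨A'.equivFinOfCardEq hA' ⟨x, hx⟩, by simp⟩
  have key := hω.line ![α 0, α 1, α 2, α 3, α 4, -e, w + e, a, w - a]
  set N : Finset G := {y : G | Function.Injective fun i =>
    (![.F, .F, .F, .F, .F, .P, .NP, .P, .NP] i : Cls).tok
      ((![1, 1, 1, 1, 1, 1, -1, -1, 1] i : ℤ) • y + ![α 0, α 1, α 2, α 3, α 4, -e, w + e, a, w - a] i)} with hN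
  set S : Finset G := {y : G | (Function.Injective fun i =>
    (![.F, .F, .F, .F, .F, .P, .NP, .P, .NP] i : Cls).tok
      ((![1, 1, 1, 1, 1, 1, -1, -1, 1] i : ℤ) • y + ![α 0, α 1, α 2, α 3, α 4, -e, w + e, a, w - a] i)) ∧
    ∀ i, ω ((![.F, .F, .F, .F, .F, .P, .NP, .P, .NP] i : Cls).tok
      ((![1, 1, 1, 1, 1, 1, -1, -1, 1] i : ℤ) • y + ![α 0, α 1, α 2, α 3, α 4, -e, w + e, a, w - a] i)) ∈
        Cls.labels q (![.F, .F, .F, .F, .F, .P, .NP, .P, .NP] i)} with hS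
  have hNc : ∀ y, y ∉ N → y + y = e + a ∨ (y - e) + (y - e) = w ∨ (a - y) + (a - y) = w := by
    intro y hy
    by_contra! hcon
    obtain ⟨c1, c2, c3⟩ := hcon
    refine hy (mem_filter.2 ⟨mem_univ _, ?_⟩)
    rw [← List.nodup_ofFn]
    simp only [List.ofFn_succ, List.ofFn_zero, Matrix.cons_val_zero, Matrix.cons_val_succ, Cls.tok, Cls.isCol]
    have gen : ∀ {x y z t : G}, x = y → z - t = x - y → z = t := fun h e => by
      rw [h, sub_self, sub_eq_zero] at e
      exact e
    simp [hα.eq_iff]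
    refine ⟨⟨fun h => c2 (gen h (by abel)), fun h => c1 (gen h (by abel)), fun h => hne (gen h (by abel))⟩,
      ⟨fun h => hne (gen h.symm (by abel)), fun h => c1 (gen h.symm (by abel))⟩, fun h => c3 (gen h (by abel))⟩
  have hNcard : Fintype.card G ≤ 2 * #N + 4 := by
    have h1 : #(univ \ N) ≤ #{y : G | y + y = e + a} + (#{y : G | (y - e) + (y - e) = w} + #{y : G | (a - y) + (a - y) = w}) := by
      refine (card_le_card fun y hy => ?_).trans ((card_union_le _ _).trans (Nat.add_le_add_left (card_union_le _ _) _))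
      simpa only [mem_union, mem_filter, mem_univ, true_and] using hNc y (mem_sdiff.1 hy).2
    have h2 : #{y : G | (y - e) + (y - e) = w} ≤ 1 := (card_le_card_of_injOn (fun y => y - e) (fun y hy => by simpa using hy)
      (sub_left_injective.injOn)).trans hw
    have h3 : #{y : G | (a - y) + (a - y) = w} ≤ 1 := (card_le_card_of_injOn (fun y => a - y) (fun y hy => by simpa using hy)
      (sub_right_injective.injOn)).trans hw
    have h4 := two_mul_card_double_le (e := e) (a := a) (fun h => h0 (by rw [h, sub_self]))
    have h5 := card_sdiff_add_card_eq_card (subset_univ N)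
    rw [card_univ] at h5
    omega
  have hdens : ∏ i, Cls.dens q (![.F, .F, .F, .F, .F, .P, .NP, .P, .NP] i) = (1 / (64 * q) : ℝ) ^ 7 * (1 - 1 / (64 * q)) ^ 2 := by
    simp only [Fin.prod_univ_succ, Matrix.cons_val_zero, Matrix.cons_val_succ, Cls.dens_F hq, Cls.dens_P hq, Cls.dens_NP hq,
      univ_eq_empty, prod_empty]
    ring
  rw [hdens] at key
  set δ : ℝ := 1 / (64 * q) with hδ
  have hδ0 : 0 < δ := by positivity
  have hδ1 : δ ≤ 1 / 64 := by
    refine one_div_le_one_div_of_le (by norm_num) ?_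
    have : (1 : ℝ) ≤ q := by exact_mod_cast hq
    linarith
  have hS' : (B : ℝ) + 9 < #S := by
    have h1 := (abs_le.1 key).1
    have h2 : ((Fintype.card G : ℝ) / 2 - 2) * (δ ^ 7 * (1 / 4)) ≤ #N * (δ ^ 7 * (1 - δ) ^ 2) := by
      have h3 : (Fintype.card G : ℝ) / 2 - 2 ≤ #N := by
        have : (Fintype.card G : ℝ) ≤ 2 * #N + 4 := by exact_mod_cast hNcard
        linarith
      have h4 : (1 : ℝ) / 4 ≤ (1 - δ) ^ 2 := by nlinarith
      calc _ ≤ #N * (δ ^ 7 * (1 / 4)) := mul_le_mul_of_nonneg_right h3 (by positivity)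
        _ ≤ _ := by gcongr
    push_cast at h1
    linarith
  have hbad : #(Bl ∪ (A'.image (fun x => -x) ∪ {e, a, e + w, a - w})) ≤ B + 9 := by
    have h1 : #({e, a, e + w, a - w} : Finset G) ≤ 4 := card_le_four
    have h2 : #(A'.image fun x => -x) ≤ 5 := card_image_le.trans hA'.le
    have := card_union_le Bl (A'.image (fun x => -x) ∪ {e, a, e + w, a - w})
    have := card_union_le (A'.image (fun x => -x)) {e, a, e + w, a - w}
    omega
  obtain ⟨y, hyS, hyb⟩ : ∃ y ∈ S, y ∉ Bl ∪ (A'.image (fun x => -x) ∪ {e, a, e + w, a - w}) := by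
    by_contra! hcon
    have h1 : #S ≤ B + 9 := (card_le_card hcon).trans hbad
    have : (#S : ℝ) ≤ B + 9 := by exact_mod_cast h1
    linarith
  simp only [mem_union, mem_image, mem_insert, mem_singleton, not_or, not_exists, not_and] at hyb
  obtain ⟨b0, b1, b2, b3, b4, b5⟩ := hyb
  obtain ⟨-, hinj, hlab⟩ := mem_filter.1 hyS
  have l0 := hlab 0; have l1 := hlab 1; have l2 := hlab 2; have l3 := hlab 3; have l4 := hlab 4
  have l5 := hlab 5; have l6 := hlab 6; have l7 := hlab 7; have l8 := hlab 8
  simp [Cls.tok, Cls.isCol] at l0 l1 l2 l3 l4 l5 l6 l7 l8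
  refine ⟨y, b0, fun x hx => ?_, ?_, ?_, ?_⟩
  · obtain ⟨i, rfl⟩ := hαA x (hAA' hx)
    refine mem_erase.2 ⟨fun h => b1 (α i) (hAA' hx) (neg_eq_of_add_eq_zero_left h), Cls.mem_members.2 ?_⟩
    simp only [Cls.tok, Cls.isCol]
    fin_cases i
    exacts [l0, l1, l2, l3, l4]
  · rw [mem_linkColours]
    refine ⟨by rw [sub_eq_add_neg]; exact l5, ?_, sub_ne_zero.2 b2, fun h => b4 ?_⟩
    · rw [show w - (y - e) = -y + (w + e) by abel]; exact l6
    · rw [← h]; abel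
  · rw [mem_linkColours]
    refine ⟨by rw [show a - y = -y + a by abel]; exact l7, ?_, sub_ne_zero.2 (Ne.symm b3), fun h => b5 ?_⟩
    · rw [show w - (a - y) = y + (w - a) by abel]; exact l8
    · rw [← h]; abel
  · intro h
    have h1 : (5 : Fin 9) = 7 := hinj (by simp [Cls.tok, Cls.isCol, ← sub_eq_add_neg, h]; abel)
    exact absurd h1 (by decide)

end LinkSupply

section Frames

open Finset

variable {G : Type} [AddCommGroup G] [Fintype G] [DecidableEq G] {q : ℕ} {τ : ℝ} {ω : G ⊕ G → Fin (64 * q)}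

theorem Cls.dens_Va (hq : 0 < q) : Cls.dens q .Va = 1 / 64 := by
  rw [Cls.dens, Cls.card_labels hq]
  simp only [Cls.hi, Cls.lo, Nat.add_sub_cancel]
  field_simp

theorem Cls.dens_Ca (hq : 0 < q) : Cls.dens q .Ca = 1 / 2 := by
  rw [Cls.dens, Cls.card_labels hq]
  simp only [Cls.hi, Cls.lo, Nat.add_sub_cancel]
  push_cast
  field_simp
  norm_num

theorem Cls.dens_Vb (hq : 0 < q) : Cls.dens q .Vb = 63 / 64 - 1 / (64 * q) := by
  rw [Cls.dens, Cls.card_labels hq]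
  simp only [Cls.hi, Cls.lo]
  rw [Nat.cast_sub (by omega)]
  push_cast
  field_simp
  ring

theorem Cls.dens_T (hq : 0 < q) : Cls.dens q .T = 1 / 2 - 1 / (64 * q) := by
  rw [Cls.dens, Cls.card_labels hq]
  simp only [Cls.hi, Cls.lo]
  rw [Nat.cast_sub (by omega)]
  push_cast
  field_simp
  ring

theorem card_linkColours (hq : 0 < q) {w : G} (hw : #{c : G | c + c = w} ≤ 1)
    (hω : (lineShape ![1, -1] ![.P, .NP]).Good (Cls.labels q) τ ω) :
    (Fintype.card G : ℝ) * (1 / (64 * q)) / 2 - 2 * τ - 3 ≤ #(linkColours ω w) ∧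
      (#(linkColours ω w) : ℝ) ≤ Fintype.card G * (1 / (64 * q)) + 2 * τ := by
  classical
  have key := hω.line ![0, w]
  set N : Finset G := {y : G | Function.Injective fun i : Fin 2 => (![.P, .NP] i : Cls).tok ((![1, -1] i : ℤ) • y + ![0, w] i)} with hN
  set S : Finset G := {y : G | (Function.Injective fun i : Fin 2 => (![.P, .NP] i : Cls).tok ((![1, -1] i : ℤ) • y + ![0, w] i)) ∧
    ∀ i : Fin 2, ω ((![.P, .NP] i : Cls).tok ((![1, -1] i : ℤ) • y + ![0, w] i)) ∈ Cls.labels q (![.P, .NP] i)} with hS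
  have hP : ∀ {i : Fin (64 * q)}, i ∈ Cls.labels q .P → i ∉ Cls.labels q .NP := by
    intro i; simp only [Cls.mem_labels, Cls.lo, Cls.hi]; omega
  have hmem : ∀ y, y ∈ S ↔ ω (Sum.inr y) ∈ Cls.labels q .P ∧ ω (Sum.inr (w - y)) ∈ Cls.labels q .NP := by
    intro y
    have e1 : (![Cls.P, .NP] 0).tok ((![1, -1] (0 : Fin 2) : ℤ) • y + ![0, w] 0) = Sum.inr y := by simp [Cls.tok, Cls.isCol]
    have e2 : (![Cls.P, .NP] 1).tok ((![1, -1] (1 : Fin 2) : ℤ) • y + ![0, w] 1) = Sum.inr (w - y) := by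
      simp [Cls.tok, Cls.isCol]; abel
    rw [hS, mem_filter]
    simp only [mem_univ, true_and, Fin.forall_fin_two, e1, e2]
    refine ⟨fun h => h.2, fun h => ⟨?_, h⟩⟩
    intro i j hij
    have hne : (Sum.inr y : G ⊕ G) ≠ Sum.inr (w - y) := fun h' => hP h.1 (by rw [h']; exact h.2)
    fin_cases i <;> fin_cases j
    · rfl
    · exact absurd (e1.symm.trans (hij.trans e2)) hne
    · exact absurd (e1.symm.trans (hij.symm.trans e2)) hne
    · rfl
  have hNc : Fintype.card G ≤ #N + 1 := by
    have h1 : #(univ \ N) ≤ #{c : G | c + c = w} := by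
      refine card_le_card fun y hy => ?_
      by_contra hcon
      refine (mem_sdiff.1 hy).2 (mem_filter.2 ⟨mem_univ _, ?_⟩)
      rw [mem_filter] at hcon
      have hne : (Sum.inr y : G ⊕ G) ≠ Sum.inr (-y + w) := fun h' => hcon ⟨mem_univ _, by
        nth_rw 1 [Sum.inr_injective h']; abel⟩
      intro i j hij
      fin_cases i <;> fin_cases j <;> simp_all [Cls.tok, Cls.isCol]
    have h5 := card_sdiff_add_card_eq_card (subset_univ N)
    rw [card_univ] at h5
    omega
  have hN2 := card_le_univ N
  have hdens : ∏ i : Fin 2, Cls.dens q (![.P, .NP] i) = (1 / (64 * q) : ℝ) * (1 - 1 / (64 * q)) := by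
    simp [Fin.prod_univ_two, Cls.dens_P hq, Cls.dens_NP hq]
  rw [hdens] at key
  set δ : ℝ := 1 / (64 * q) with hδ
  have hδ0 : 0 < δ := by positivity
  have hδ1 : δ ≤ 1 / 64 := by
    refine one_div_le_one_div_of_le (by norm_num) ?_
    have : (1 : ℝ) ≤ q := by exact_mod_cast hq
    linarith
  have hsub : linkColours ω w ⊆ S := fun y hy => by
    rw [mem_linkColours] at hy
    exact (hmem y).2 ⟨hy.1, hy.2.1⟩
  have hsup : S ⊆ linkColours ω w ∪ {0, w} := fun y hy => by
    have := (hmem y).1 hy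
    rw [mem_union, mem_linkColours, mem_insert, mem_singleton]
    tauto
  have h1 : (#(linkColours ω w) : ℝ) ≤ #S := by exact_mod_cast card_le_card hsub
  have h2 : (#S : ℝ) ≤ #(linkColours ω w) + 2 := by
    have := (card_le_card hsup).trans ((card_union_le _ _).trans (Nat.add_le_add_left card_le_two _))
    exact_mod_cast this
  have h3 : (Fintype.card G : ℝ) ≤ #N + 1 := by exact_mod_cast hNc
  have h4 : (#N : ℝ) ≤ Fintype.card G := by exact_mod_cast hN2
  have h5 := abs_le.1 key
  push_cast at h5
  have h6 : (#N : ℝ) * (δ * (1 - δ)) ≤ Fintype.card G * δ := by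
    have : (#N : ℝ) * (δ * (1 - δ)) ≤ #N * δ := mul_le_mul_of_nonneg_left (by nlinarith) (by positivity)
    nlinarith
  have h7 : (Fintype.card G : ℝ) * δ / 2 - 1 ≤ #N * (δ * (1 - δ)) := by
    have : (#N : ℝ) * (δ * (1 / 2)) ≤ #N * (δ * (1 - δ)) :=
      mul_le_mul_of_nonneg_left (mul_le_mul_of_nonneg_left (by linarith) hδ0.le) (by positivity)
    nlinarith
  constructor <;> linarith [h5.1, h5.2]

/-- A partition of the vertices and the colours supporting every phase of the construction. -/
structure Frame (w : G) (F P Va Vb T : Finset G) (Adm : Set (G ⊕ G)) (q : ℕ) (τ E : ℝ) (B B' : ℕ) : Prop where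
  zero_notMem : 0 ∉ F
  cover : ∀ v, v ≠ 0 → v ∈ F ∨ v ∈ Va ∨ v ∈ Vb
  disjoint_F_Va : Disjoint F Va
  disjoint_F_Vb : Disjoint F Vb
  disjoint_Va_Vb : Disjoint Va Vb
  pair : ∀ c ∈ P, c ≠ 0 ∧ c ≠ w ∧ w - c ∉ P
  disjoint_T_P : Disjoint T P
  adm_vertex : ∀ v, Sum.inl v ∈ Adm → v ∈ Va
  adm_colour : ∀ c, Sum.inr c ∈ Adm → c ∉ T ∧ c ∉ P
  card_F : (Fintype.card G : ℝ) * (1 / (64 * q)) - τ - 1 ≤ #F ∧ (#F : ℝ) ≤ Fintype.card G * (1 / (64 * q)) + τ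
  card_P : (Fintype.card G : ℝ) * (1 / (64 * q)) / 2 - 2 * τ - 3 ≤ #P ∧ (#P : ℝ) ≤ Fintype.card G * (1 / (64 * q)) + 2 * τ
  card_Va : |(#Va : ℝ) - Fintype.card G * (1 / 64)| ≤ τ
  card_Vb : |(#Vb : ℝ) - Fintype.card G * (63 / 64 - 1 / (64 * q))| ≤ τ
  codegree_Va : ∀ g : G, g ≠ 0 → |(#{y ∈ Va | y + g ∈ Va} : ℝ) - Fintype.card G * (1 / 64) ^ 2| ≤ τ * 2
  codegree_Vb : ∀ g : G, g ≠ 0 → |(#{y ∈ Vb | y + g ∈ Vb} : ℝ) - Fintype.card G * (63 / 64 - 1 / (64 * q)) ^ 2| ≤ τ * 2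
  mixing : IsMixing T (1 / 2 - 1 / (64 * q)) E
  vertex_supply : ItemSupply Adm (fun v => {Sum.inl v}) (fun _ => True) B
  pair_supply : ItemSupply Adm (pairTok w) (fun c => c ≠ 0 ∧ c ≠ w) B
  connectors : Connectors Adm B
  link : LinkOp F P w B'

theorem exists_frame {q : ℕ} (hq : 2 ≤ q) {τ E : ℝ} {B B' : ℕ} (hτ : 1 ≤ τ) (hn : 5 ≤ Fintype.card G) (hE : 0 ≤ E)
    (hE' : 4 * (Fintype.card G : ℝ) ^ 3 * (2 * τ) ≤ E ^ 2)
    (hexp : 2 * (17 * (Fintype.card G : ℝ) ^ 30) * Real.exp (-τ ^ 2 / (4 * Fintype.card G)) < 1)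
    (hB : 30 * τ + 30 * (B + 2) < ((Fintype.card G : ℝ) - 900) * (1 / 64) ^ 30)
    (hB' : 9 * τ + B' + 9 < ((Fintype.card G : ℝ) / 2 - 2) * ((1 / (64 * q)) ^ 7 * (1 / 4))) :
    ∃ (w : G) (F P Va Vb T : Finset G) (Adm : Set (G ⊕ G)), Frame w F P Va Vb T Adm q τ E B B' := by
  have hq0 : 0 < q := by omega
  have hτ0 : 0 ≤ τ := by linarith
  obtain ⟨w, hw0, hw⟩ := exists_card_double_le_one (G := G) (by omega)
  have : NeZero (64 * q) := ⟨by omega⟩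
  obtain ⟨ω, hω⟩ := exists_good_labelling (G := G) (Cls.labels q)
    ![lineShape ![1] ![.F], lineShape ![1] ![.Va], lineShape ![1] ![.Vb], lineShape ![1] ![.T],
      lineShape ![1, 1] ![.Va, .Va], lineShape ![1, 1] ![.Vb, .Vb], lineShape ![1, 1] ![.T, .T],
      lineShape ![1, -1] ![.P, .NP],
      lineShape ![1, 1, 1, 1, 1, 1, -1, -1, 1] ![.F, .F, .F, .F, .F, .P, .NP, .P, .NP],
      vertexRowShape, vertexBaseShape, vertexShape, pairRowShape, pairBaseShape, pairShape, connShape, padShape]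
    (by
      intro i
      fin_cases i
      exacts [lineShape_valid (by decide) _, lineShape_valid (by decide) _, lineShape_valid (by decide) _,
        lineShape_valid (by decide) _, lineShape_valid (by decide) _, lineShape_valid (by decide) _,
        lineShape_valid (by decide) _, lineShape_valid (by decide) _, lineShape_valid (by decide) _,
        vertexRowShape_valid, vertexBaseShape_valid, vertexShape_valid, pairRowShape_valid, pairBaseShape_valid,
        pairShape_valid, connShape_valid, padShape_valid])
    30 (by decide) (by decide) τ hτ0 (by exact_mod_cast hexp)
  have hA : Ample G (Cls.labels q) τ B := by
    refine ⟨hτ0, ?_, ?_, hB⟩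
    · have := Cls.dens_Va hq0
      rw [Cls.dens] at this
      rw [Fintype.card_fin]
      push_cast
      exact this.ge
    · have := Cls.dens_Ca hq0
      rw [Cls.dens] at this
      rw [Fintype.card_fin]
      push_cast
      rw [this]
      norm_num
  have gF : |(#(Cls.F.members ω) : ℝ) - _| ≤ τ := Shape.Good.size (hω 0)
  have gVa : |(#(Cls.Va.members ω) : ℝ) - _| ≤ τ := Shape.Good.size (hω 1)
  have gVb : |(#(Cls.Vb.members ω) : ℝ) - _| ≤ τ := Shape.Good.size (hω 2)
  have gT : |(#(Cls.T.members ω) : ℝ) - _| ≤ τ := Shape.Good.size (hω 3)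
  have hP := card_linkColours hq0 hw (hω 7)
  rw [Cls.dens_F hq0] at gF
  rw [Cls.dens_Va hq0] at gVa
  rw [Cls.dens_Vb hq0] at gVb
  rw [Cls.dens_T hq0] at gT
  have hδ0 : (0 : ℝ) ≤ 1 / 2 - 1 / (64 * q) := by
    rw [← Cls.dens_T hq0]; exact Cls.dens_nonneg _ _
  have hδ1 : (1 : ℝ) / 2 - 1 / (64 * q) ≤ 1 := by
    rw [← Cls.dens_T hq0]; exact Cls.dens_le_one _ _
  refine ⟨w, (Cls.F.members ω).erase 0, linkColours ω w, Cls.Va.members ω, Cls.Vb.members ω, Cls.T.members ω,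
    admissible (Cls.labels q) ω, notMem_erase _ _, fun v hv => ?_, ?_, ?_, ?_, fun c hc => ?_, ?_, fun v hv => ?_, fun c hc => ?_, ?_,
    hP, gVa, gVb, fun g hg => ?_, fun g hg => ?_, ?_,
    itemSupply_vertex hA (hω 9) (hω 10) (hω 11), itemSupply_pair hw0 hw hA (hω 12) (hω 13) (hω 14),
    connectors_of_good hA (hω 15) (hω 16), linkOp_of_good hq0 hw (hω 8) hn hB'⟩
  · simp only [mem_erase, Cls.mem_members, Cls.tok, Cls.isCol, Cls.mem_labels, Cls.lo, Cls.hi]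
    have := (ω (Sum.inl v)).2
    simp only [hv, ne_eq, not_false_eq_true, true_and, Bool.false_eq_true, if_false]
    omega
  · rw [disjoint_left]
    intro v
    simp only [mem_erase, Cls.mem_members, Cls.tok, Cls.isCol, Cls.mem_labels, Cls.lo, Cls.hi, Bool.false_eq_true, if_false]
    omega
  · rw [disjoint_left]
    intro v
    simp only [mem_erase, Cls.mem_members, Cls.tok, Cls.isCol, Cls.mem_labels, Cls.lo, Cls.hi, Bool.false_eq_true, if_false]
    omega
  · rw [disjoint_left]
    intro v
    simp only [Cls.mem_members, Cls.tok, Cls.isCol, Cls.mem_labels, Cls.lo, Cls.hi, Bool.false_eq_true, if_false]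
    omega
  · rw [mem_linkColours] at hc
    refine ⟨hc.2.2.1, hc.2.2.2, fun h => ?_⟩
    rw [mem_linkColours] at h
    have h1 := hc.2.1
    have h2 := h.1
    simp only [Cls.mem_labels, Cls.lo, Cls.hi] at h1 h2
    omega
  · rw [disjoint_left]
    intro v
    rw [mem_linkColours]
    simp only [Cls.mem_members, Cls.tok, Cls.isCol, Cls.mem_labels, Cls.lo, Cls.hi, if_true]
    omega
  · simp only [admissible, Set.mem_ofPred_eq, Sum.elim_inl, Cls.mem_labels, Cls.lo, Cls.hi] at hv
    simp only [Cls.mem_members, Cls.tok, Cls.isCol, Cls.mem_labels, Cls.lo, Cls.hi, Bool.false_eq_true, if_false]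
    exact hv
  · simp only [admissible, Set.mem_ofPred_eq, Sum.elim_inr, Cls.mem_labels, Cls.lo, Cls.hi] at hc
    rw [mem_linkColours]
    simp only [Cls.mem_members, Cls.tok, Cls.isCol, Cls.mem_labels, Cls.lo, Cls.hi, if_true]
    omega
  · have h1 : #((Cls.F.members ω).erase 0) ≤ #(Cls.F.members ω) := card_le_card (erase_subset _ _)
    have h2 : #(Cls.F.members ω) - 1 ≤ #((Cls.F.members ω).erase 0) := pred_card_le_card_erase
    have h1' : (#((Cls.F.members ω).erase 0) : ℝ) ≤ #(Cls.F.members ω) := by exact_mod_cast h1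
    have h2' : (#(Cls.F.members ω) : ℝ) ≤ #((Cls.F.members ω).erase 0) + 1 := by
      have : #(Cls.F.members ω) ≤ #((Cls.F.members ω).erase 0) + 1 := by omega
      exact_mod_cast this
    have := abs_le.1 gF
    constructor <;> linarith [this.1, this.2]
  · have := Shape.Good.codegree (hω 4) hg
    rwa [Cls.dens_Va hq0] at this
  · have := Shape.Good.codegree (hω 5) hg
    rwa [Cls.dens_Vb hq0] at this
  · refine isMixing_of_codegree _ _ (2 * τ) _ hδ0 hδ1 (by linarith) ?_ (fun g hg => ?_) hE hE'
    · linarith [(abs_le.1 gT).1]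
    · have := Shape.Good.codegree (hω 6) hg
      rw [Cls.dens_T hq0] at this
      linarith [(abs_le.1 this).2]

end Frames

section Layers

open Finset

variable {G : Type} [AddCommGroup G] [Fintype G] [DecidableEq G]

/-- Partition into `m` layers meeting prescribed sets in about the expected size, with about the expected codegrees. -/
theorem exists_layers {m : ℕ} (hm : 0 < m) {N : ℕ} (Y : Fin N → Finset G) {τ : ℝ} (hτ : 0 ≤ τ)
    (h : 2 * (N * (m * (Fintype.card G : ℝ))) * Real.exp (-τ ^ 2 / (2 * Fintype.card G)) < 1) :
    ∃ ω : G → ℕ, ∀ i, ∀ j < m, |(#{y ∈ Y i | ω y = j} : ℝ) - #(Y i) / m| ≤ 2 * τ ∧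
      ∀ g : G, g ≠ 0 → |(#{y ∈ {y ∈ Y i | ω y = j} | y + g ∈ {y ∈ Y i | ω y = j}} : ℝ) -
        #{y ∈ Y i | y + g ∈ Y i} / m ^ 2| ≤ 2 * τ := by
  classical
  have : NeZero m := ⟨hm.ne'⟩
  obtain ⟨ω, hω⟩ := exists_labelling (Ω := G) (α := Fin m) (ι := Fin N × Fin m × G)
    (fun q ω => (#{y ∈ {y ∈ Y q.1 | y + q.2.2 ∈ Y q.1} | ∀ i : Fin 2, ω (![y, y + q.2.2] i) ∈ (fun _ => {q.2.1} : Fin 2 → Finset (Fin m)) i} : ℝ))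
    (fun _ => 2) (fun _ => by norm_num) (fun q ω x v => by
      refine abs_card_filter_sub_update_le _ _ (fun _ => {q.2.1}) _ (fun x => ?_) ω x v
      have : #{y ∈ {y ∈ Y q.1 | y + q.2.2 ∈ Y q.1} | ∃ i, (![y, y + q.2.2] : Fin 2 → G) i = x} ≤ #({x, x - q.2.2} : Finset G) := by
        refine card_le_card fun y hy => ?_
        rw [mem_filter, Fin.exists_fin_two] at hy
        rw [mem_insert, mem_singleton]
        exact hy.2.imp (fun h => h) fun h => eq_sub_of_add_eq h
      exact_mod_cast this.trans card_le_two) τ hτ (by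
      refine lt_of_le_of_lt (le_of_eq ?_) h
      simp only [Fintype.card_prod, Fintype.card_fin]
      push_cast
      ring)
  suffices H : ∀ i j, |(#{y ∈ Y i | ω y = j} : ℝ) - #(Y i) / m| ≤ 2 * τ ∧
      ∀ g : G, g ≠ 0 → |(#{y ∈ {y ∈ Y i | ω y = j} | y + g ∈ {y ∈ Y i | ω y = j}} : ℝ) -
        #{y ∈ Y i | y + g ∈ Y i} / m ^ 2| ≤ 2 * τ by
    exact ⟨fun y => ω y, fun i j hj => by simpa only [Fin.ext_iff] using H i ⟨j, hj⟩⟩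
  refine fun i j => ⟨?_, fun g hg => ?_⟩
  · have h1 := hω ⟨i, j, 0⟩
    have e : ∀ ω : G → Fin m, #{y ∈ {y ∈ Y i | y + 0 ∈ Y i} | ∀ l : Fin 2, ω (![y, y + 0] l) ∈ (fun _ => {j} : Fin 2 → Finset (Fin m)) l} =
        #{y ∈ Y i | ∀ l : Fin 1, ω ((fun _ => y : Fin 1 → G) l) ∈ (fun _ => {j} : Fin 1 → Finset (Fin m)) l} := by
      intro ω
      congr 1
      ext y
      simp [Fin.forall_fin_two]
    simp only [e] at h1
    rw [average_card_filter (Y i) (fun y _ => y) (fun _ _ => Function.injective_of_subsingleton _) (fun _ => {j})] at h1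
    simp only [mem_singleton, forall_const, univ_unique, prod_singleton, card_singleton, Nat.cast_one, Fintype.card_fin,
      mul_one_div] at h1
    linarith
  · have h1 := hω ⟨i, j, g⟩
    dsimp only at h1
    rw [average_card_filter {y ∈ Y i | y + g ∈ Y i} (fun y => ![y, y + g]) (fun y _ a b hab => by
      fin_cases a <;> fin_cases b <;> simp_all) (fun _ => {j})] at h1
    have e : #{y ∈ {y ∈ Y i | y + g ∈ Y i} | ∀ l : Fin 2, ω (![y, y + g] l) ∈ (fun _ => {j} : Fin 2 → Finset (Fin m)) l} =
        #{y ∈ {y ∈ Y i | ω y = j} | y + g ∈ {y ∈ Y i | ω y = j}} := by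
      congr 1
      ext y
      simp only [mem_filter, Fin.forall_fin_two, mem_singleton, Matrix.cons_val_zero, Matrix.cons_val_one]
      tauto
    rw [e] at h1
    simp only [Fin.prod_univ_two, card_singleton, Nat.cast_one, Fintype.card_fin] at h1
    rw [show (1 : ℝ) / m * (1 / m) = 1 / m ^ 2 by ring, mul_one_div] at h1
    linarith

end Layers

section Stages

open Finset

variable {G : Type} [AddCommGroup G] [Fintype G] [DecidableEq G]

theorem isMixing_layer {Y : Finset G} {β τ E : ℝ} {m : ℕ} (hm : 0 < m) {ω : G → ℕ} {j : ℕ} (hβ0 : 0 ≤ β) (hβ1 : β ≤ 1)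
    (hτ : 1 ≤ τ) (hY : |(#Y : ℝ) - Fintype.card G * β| ≤ τ)
    (hcod : ∀ g : G, g ≠ 0 → |(#{y ∈ Y | y + g ∈ Y} : ℝ) - Fintype.card G * β ^ 2| ≤ τ * 2)
    (hω : |(#{y ∈ Y | ω y = j} : ℝ) - #Y / m| ≤ 2 * τ)
    (hω' : ∀ g : G, g ≠ 0 → |(#{y ∈ {y ∈ Y | ω y = j} | y + g ∈ {y ∈ Y | ω y = j}} : ℝ) -
        #{y ∈ Y | y + g ∈ Y} / m ^ 2| ≤ 2 * τ) (hE : 0 ≤ E) (hE' : 4 * (Fintype.card G : ℝ) ^ 3 * (4 * τ) ≤ E ^ 2) :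
    IsMixing {y ∈ Y | ω y = j} (β / m) E := by
  have hm1 : (1 : ℝ) ≤ m := by exact_mod_cast hm
  refine isMixing_of_codegree _ _ (4 * τ) _ (by positivity) ((div_le_self hβ0 hm1).trans hβ1) (by linarith) ?_ (fun g hg => ?_) hE hE'
  · have h1 : (Fintype.card G * β - τ) / m ≤ #Y / m := by gcongr; linarith [(abs_le.1 hY).1]
    have h2 : τ / m ≤ τ := div_le_self (by linarith) hm1
    have h3 := (abs_le.1 hω).1
    rw [sub_div] at h1
    have h4 : β / m * Fintype.card G = Fintype.card G * β / m := by ring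
    linarith
  · have h1 : (#{y ∈ Y | y + g ∈ Y} : ℝ) / m ^ 2 ≤ (Fintype.card G * β ^ 2 + τ * 2) / m ^ 2 := by
      gcongr; linarith [(abs_le.1 (hcod g hg)).2]
    have h2 : τ * 2 / m ^ 2 ≤ τ * 2 := div_le_self (by linarith) (one_le_pow₀ hm1)
    have h3 := (abs_le.1 (hω' g hg)).2
    rw [add_div] at h1
    have h4 : (β / m) ^ 2 * Fintype.card G = Fintype.card G * β ^ 2 / m ^ 2 := by ring
    linarith

theorem mixing_error_le {n ν : ℕ} (hn : n ≤ 2 * ν ^ 64) (hν : 2 ≤ ν) :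
    4 * (n : ℝ) ^ 3 * (4 * (ν : ℝ) ^ 40) ≤ ((ν : ℝ) ^ 120) ^ 2 := by
  have h1 : (n : ℝ) ≤ 2 * (ν : ℝ) ^ 64 := by exact_mod_cast hn
  have h2 : (128 : ℝ) ≤ (ν : ℝ) ^ 8 := by
    calc (128 : ℝ) ≤ 2 ^ 8 := by norm_num
      _ ≤ (ν : ℝ) ^ 8 := by gcongr; exact_mod_cast hν
  calc 4 * (n : ℝ) ^ 3 * (4 * (ν : ℝ) ^ 40) ≤ 4 * (2 * (ν : ℝ) ^ 64) ^ 3 * (4 * (ν : ℝ) ^ 40) := by gcongr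
    _ = 128 * (ν : ℝ) ^ 232 := by ring
    _ ≤ (ν : ℝ) ^ 8 * (ν : ℝ) ^ 232 := by gcongr
    _ = _ := by ring

theorem disjoint_layers (X : Finset G) (ω : G → ℕ) {i j : ℕ} (h : i < j) : Disjoint {y ∈ X | ω y = i} {y ∈ X | ω y = j} :=
  disjoint_filter.2 fun _ _ h1 h2 => h.ne (h1.symm.trans h2)

variable {w : G} {F P Va Vb T : Finset G} {Adm : Set (G ⊕ G)} {c m ν B B' : ℕ}

set_option maxHeartbeats 1000000 in
theorem Frame.exists_lines_Va (hF : Frame w F P Va Vb T Adm c ((ν : ℝ) ^ 40) ((ν : ℝ) ^ 120) B B') (hm : 0 < m)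
    (hn : ν ^ 64 ≤ Fintype.card G) (hn' : Fintype.card G ≤ 2 * ν ^ 64) (hν : 1000 * m ≤ ν) (hc : 64 ≤ c)
    (hexp : 2 * (2 * (m * (Fintype.card G : ℝ))) * Real.exp (-((ν : ℝ) ^ 40) ^ 2 / (2 * Fintype.card G)) < 1)
    {V₁ : Finset G} (hV₁ : 2000 * #V₁ ≤ Fintype.card G) :
    ∃ (ℓ : ℕ) (E : Multiset (G × G × ℕ)) (U D : Finset G), (∀ e ∈ E, e.2.2 = m) ∧ Multiset.card E = ℓ ∧
      U ⊆ (Va \ V₁).erase 0 ∧ D ⊆ T \ insert 0 (P.image (w - ·)) ∧ #U = m * ℓ ∧ #D = (m - 1) * ℓ ∧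
      Realizes E (∑ x ∈ U, {Sum.inl x} + ∑ c ∈ D, {Sum.inr c}) ∧ #Va ≤ #V₁ + m * ℓ + m + m * ν ^ 63 + 1 := by
  set n := Fintype.card G with hn_def
  have hm1 : (1 : ℝ) ≤ m := by exact_mod_cast hm
  have hx : (1000 : ℝ) * m ≤ ν := by exact_mod_cast hν
  set x : ℝ := (ν : ℝ) with hx_def
  have hx1 : (1000 : ℝ) ≤ x := by linarith
  have hnr : x ^ 64 ≤ n := by rw [hx_def]; exact_mod_cast hn
  have hnr' : (n : ℝ) ≤ 2 * x ^ 64 := by rw [hx_def]; exact_mod_cast hn'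
  set X := (Va \ V₁).erase 0 with hX
  obtain ⟨ω, hω⟩ := exists_layers hm ![Va, X] (τ := x ^ 40) (by positivity) (by exact_mod_cast hexp)
  have hτ1 : (1 : ℝ) ≤ x ^ 40 := one_le_pow₀ (by linarith)
  have hτ : 1000 * x ^ 40 ≤ x ^ 41 := by rw [pow_succ x 40]; nlinarith
  have h41 : x ^ 41 ≤ x ^ 62 := pow_le_pow_right₀ (by linarith) (by norm_num)
  have h62 : 1000 * x ^ 62 ≤ x ^ 63 := by rw [pow_succ x 62]; nlinarith [pow_pos (by linarith : 0 < x) 62]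
  have h63 : x ^ 63 * (1000 * m) ≤ x ^ 64 := by rw [pow_succ x 63]; gcongr
  set L : ℝ := n / (64 * m) with hL
  have hmL : 64 * m * L = n := by rw [hL]; field_simp
  have hL15 : 15 * x ^ 63 ≤ L := by
    have : 64 * m * (15 * x ^ 63) ≤ 64 * m * L := by
      rw [hmL]
      have : 0 ≤ x ^ 63 * m := by positivity
      linarith
    exact le_of_mul_le_mul_left this (by positivity)
  have hVa := abs_le.1 hF.card_Va
  rw [← hn_def] at hVa
  have hV₁r : (2000 : ℝ) * #V₁ ≤ n := by exact_mod_cast hV₁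
  have hXup : (#X : ℝ) ≤ n / 64 + x ^ 40 := by
    have : (#X : ℝ) ≤ #Va := by exact_mod_cast card_le_card ((erase_subset _ _).trans sdiff_subset)
    linarith [hVa.2]
  have hXlow' : #Va ≤ #V₁ + #X + 1 := by
    have h1 := le_card_sdiff V₁ Va
    have h2 : #(Va \ V₁) - 1 ≤ #X := pred_card_le_card_erase
    omega
  have hXlow : (0.96 : ℝ) * (n / 64) ≤ #X := by
    have : (#Va : ℝ) ≤ #V₁ + #X + 1 := by exact_mod_cast hXlow'
    have h3 : x ^ 63 * 1000 ≤ x ^ 63 * (1000 * m) := by gcongr; linarith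
    linarith [hVa.1]
  have hmm : (#X : ℝ) / m * m = #X := by field_simp
  have hXm : 0.96 * L ≤ #X / m := by
    rw [le_div_iff₀ (by positivity)]
    linarith
  have hXm' : (#X : ℝ) / m ≤ L + x ^ 40 := by
    rw [div_le_iff₀ (by positivity)]
    have : x ^ 40 ≤ x ^ 40 * m := le_mul_of_one_le_right (by positivity) hm1
    linarith
  have hlay : ∀ j < m, |(#{y ∈ X | ω y = j} : ℝ) - #X / m| ≤ 2 * x ^ 40 := fun j hj => (hω 1 j hj).1
  have hmix : ∀ j < m, IsMixing {y ∈ Va | ω y = j} (1 / 64 / m) (x ^ 120) := fun j hj =>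
    isMixing_layer hm (by norm_num) (by norm_num) hτ1 hF.card_Va hF.codegree_Va (hω 0 j hj).1 (hω 0 j hj).2
      (by positivity) (mixing_error_le hn' (by omega))
  have hνX : ν ^ 63 ≤ #X / m := by
    rw [Nat.le_div_iff_mul_le hm]
    have : x ^ 63 * m ≤ #X := by
      rw [← hmm]
      gcongr
      have : 0 < x ^ 63 := by positivity
      linarith
    rw [hx_def] at this
    exact_mod_cast this
  set ℓ := #X / m - ν ^ 63 with hℓ
  have hℓX : (ℓ : ℝ) ≤ #X / m - x ^ 63 := by
    rw [hℓ, Nat.cast_sub hνX, hx_def]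
    push_cast
    have := @Nat.cast_div_le ℝ _ _ _ #X m
    linarith
  set C := T \ insert 0 (P.image (w - ·)) with hC
  have hCT : (#T : ℝ) ≤ #C + 1 + #P := by
    have h1 : #T - #(insert 0 (P.image (w - ·))) ≤ #C := le_card_sdiff _ _
    have h2 := card_insert_le 0 (P.image (w - ·))
    have h3 : #(P.image (w - ·)) ≤ #P := card_image_le
    have : #T ≤ #C + 1 + #P := by omega
    exact_mod_cast this
  have hc' : (1 : ℝ) / (64 * c) ≤ 1 / 4096 := by
    refine one_div_le_one_div_of_le (by norm_num) ?_
    have : (64 : ℝ) ≤ c := by exact_mod_cast hc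
    linarith
  have hP : (#P : ℝ) ≤ n / 4096 + 2 * x ^ 40 := by
    have h1 := hF.card_P.2
    rw [← hn_def] at h1
    have : (n : ℝ) * (1 / (64 * c)) ≤ n * (1 / 4096) := by gcongr
    linarith
  obtain ⟨E, U, D, h1, h2, h3, h4, h5, h6, h7⟩ := exists_lines (B := fun j => {y ∈ X | ω y = j}) (C := C) (m := m) (ℓ := ℓ) (d := ν ^ 62)
    hm (fun i j hij _ => disjoint_layers X ω hij) (by
      have h1 := (abs_le.1 (hlay 0 hm)).1
      have : ((ℓ + (m - 1) * ν ^ 62 : ℕ) : ℝ) ≤ #{y ∈ X | ω y = 0} := by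
        push_cast [Nat.cast_sub (show 1 ≤ m from hm)]
        rw [← hx_def]
        have : ((m : ℝ) - 1) * x ^ 62 ≤ x * x ^ 62 := by gcongr; linarith
        have e : x * x ^ 62 = x ^ 63 := by ring
        have h5 : 1000 * (((m : ℝ) - 1) * x ^ 62) ≤ x ^ 63 := by
          rw [← e]
          calc _ = (1000 * (m - 1)) * x ^ 62 := by ring
            _ ≤ _ := by gcongr; linarith
        have : 0 < x ^ 63 := by positivity
        linarith
      exact_mod_cast this) (by
      intro j hj A hA hAc C' hC' hCc
      have hj' : j < m := by omega
      have hAj : (#A : ℝ) ≤ #{y ∈ X | ω y = j} := by exact_mod_cast card_le_card hA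
      have l1 := abs_le.1 (hlay j hj')
      have l2 := abs_le.1 (hlay (j + 1) hj)
      have p63 : 0 < x ^ 63 := by positivity
      refine exists_rainbowMatching_of_wide_colours (L := L) (u := n / 50) (g := 4 * ν ^ 40) (K := 4 * ν ^ 2) (e := ν ^ 61)
        (hmix j hj') (hmix (j + 1) hj) hF.mixing (hA.trans (filter_subset_filter _ ((erase_subset _ _).trans sdiff_subset)))
        (filter_subset_filter _ ((erase_subset _ _).trans sdiff_subset)) (hC'.trans sdiff_subset) (by positivity) (by positivity)
        (by norm_num at hc' ⊢; linarith) ?_ (by positivity) (le_of_eq ?_) ?_ ?_ ?_ ?_ ?_ ?_ ?_ ?_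
      · have e1 : (#C' : ℝ) + j * #A = #C := by exact_mod_cast hCc
        have e2 : ((j : ℝ) + 1) * #A ≤ m * #A := by gcongr; exact_mod_cast hj'
        have e3 : (m : ℝ) * #A ≤ m * (#X / m + 2 * x ^ 40) := by gcongr; linarith
        have e4 : 1000 * m * x ^ 40 ≤ x * x ^ 40 := by gcongr
        have e5 : x * x ^ 40 = x ^ 41 := by ring
        have h3 : x ^ 63 * 1000 ≤ x ^ 63 * (1000 * m) := by gcongr; linarith
        linarith
      · rw [← hmL]; field_simp
      · have : (#A : ℝ) ≤ #{y ∈ X | ω y = j + 1} + 4 * x ^ 40 := by linarith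
        rw [hx_def] at this
        exact_mod_cast this
      · linarith
      · linarith
      · push_cast
        rw [← hx_def]
        have e1 : 15 * x ^ 63 * x ^ 62 ≤ L * x ^ 62 := by gcongr
        have e2 : 1000 ^ 5 * x ^ 120 ≤ x ^ 5 * x ^ 120 := by gcongr
        have e3 : x ^ 64 ≤ x ^ 120 := pow_le_pow_right₀ (by linarith) (by norm_num)
        have e4 : 15 * x ^ 63 * x ^ 62 = 15 * (x ^ 5 * x ^ 120) := by ring
        have e5 : 2 * (4 * x ^ 2) * x ^ 62 = 8 * x ^ 64 := by ring
        have : 0 < x ^ 120 := by positivity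
        linarith
      · have : 0 < ν := by omega
        positivity
      · push_cast
        rw [← hx_def]
        have e1 : x ^ 40 ≤ x ^ 59 := pow_le_pow_right₀ (by linarith) (by norm_num)
        have e2 : x ^ 2 ≤ x ^ 59 := pow_le_pow_right₀ (by linarith) (by norm_num)
        have e3 : 1000 ^ 2 * x ^ 59 ≤ x ^ 2 * x ^ 59 := by gcongr
        have e4 : x ^ 2 * x ^ 59 = x ^ 61 := by ring
        have p59 : 0 < x ^ 59 := by positivity
        have e5 : (4 * x ^ 40 + 12 * (4 * x ^ 2)) * L ≤ x ^ 61 / 2 * L := by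
          gcongr
          linarith
        have e6 : x ^ 61 / 2 * (15 * x ^ 63) ≤ x ^ 61 / 2 * L := by gcongr
        have e7 : x ^ 61 / 2 * (15 * x ^ 63) = 15 / 2 * (x ^ 4 * x ^ 120) := by ring
        have e8 : 1000 ^ 4 * x ^ 120 ≤ x ^ 4 * x ^ 120 := by gcongr
        have : 0 < x ^ 120 := by positivity
        linarith
      · have e0 : (#A : ℝ) ≤ n := by exact_mod_cast card_le_univ A
        have e1 : 0 < x ^ 62 := by positivity
        have e2 : 4 * x ^ 2 * (x ^ 62 - x ^ 61) = 4 * x ^ 64 - 4 * x ^ 63 := by ring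
        have h3 : x ^ 63 * 1000 ≤ x ^ 63 * (1000 * m) := by gcongr; linarith
        have e3 : (#A : ℝ) < x ^ 62 + 4 * x ^ 2 * (x ^ 62 - x ^ 61) := by linarith
        have e4 : ν ^ 61 ≤ ν ^ 62 := Nat.pow_le_pow_right (by omega) (by norm_num)
        have e5 : (#A : ℝ) < ((ν ^ 62 + 4 * ν ^ 2 * (ν ^ 62 - ν ^ 61) : ℕ) : ℝ) := by
          push_cast [Nat.cast_sub e4]
          exact e3
        exact_mod_cast e5
      · exact Nat.pow_le_pow_right (by omega) (by norm_num))
  refine ⟨ℓ, E, U, D, h1, h2, fun y hy => ?_, h4, h5, h6, h7, ?_⟩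
  · obtain ⟨j, -, hy⟩ := mem_biUnion.1 (h3 hy)
    exact (mem_filter.1 hy).1
  · have h8 := Nat.div_add_mod #X m
    have h9 := Nat.mod_lt #X hm
    have h10 : #X / m = ℓ + ν ^ 63 := by omega
    rw [h10, mul_add] at h8
    omega

end Stages

section Stages

open Finset

variable {G : Type} [AddCommGroup G] [Fintype G] [DecidableEq G]
variable {w : G} {F P Va Vb T : Finset G} {Adm : Set (G ⊕ G)} {c m ν B B' : ℕ}

set_option maxHeartbeats 1000000 in
theorem Frame.exists_lines_Vb (hF : Frame w F P Va Vb T Adm c ((ν : ℝ) ^ 40) ((ν : ℝ) ^ 120) B B') (hm : 0 < m)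
    (hn' : Fintype.card G ≤ 2 * ν ^ 64) (hν : 1000 * m ≤ ν) (hc : 64 ≤ c)
    (hexp : 2 * (1 * (m * (Fintype.card G : ℝ))) * Real.exp (-((ν : ℝ) ^ 40) ^ 2 / (2 * Fintype.card G)) < 1)
    {C : Finset G} {ℓ s : ℕ} (hℓ : m * ℓ + m * ν ^ 63 ≤ #Vb) (hC : (m - 1) * ℓ + 2 * s ≤ #C) (hs : m * m * ν ^ 62 ≤ s) :
    ∃ (E : Multiset (G × G × ℕ)) (U D : Finset G), (∀ e ∈ E, e.2.2 = m) ∧ Multiset.card E = ℓ ∧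
      U ⊆ Vb.erase 0 ∧ D ⊆ C ∧ #U = m * ℓ ∧ #D = (m - 1) * ℓ ∧
      Realizes E (∑ x ∈ U, {Sum.inl x} + ∑ c ∈ D, {Sum.inr c}) := by
  set n := Fintype.card G with hn_def
  have hm1 : (1 : ℝ) ≤ m := by exact_mod_cast hm
  have hx : (1000 : ℝ) * m ≤ ν := by exact_mod_cast hν
  have hsr : (m : ℝ) * m * (ν : ℝ) ^ 62 ≤ s := by exact_mod_cast hs
  set x : ℝ := (ν : ℝ) with hx_def
  have hx1 : (1000 : ℝ) ≤ x := by linarith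
  have hnr' : (n : ℝ) ≤ 2 * x ^ 64 := by rw [hx_def]; exact_mod_cast hn'
  obtain ⟨ω, hω⟩ := exists_layers hm ![Vb] (τ := x ^ 40) (by positivity) (by exact_mod_cast hexp)
  have hτ1 : (1 : ℝ) ≤ x ^ 40 := one_le_pow₀ (by linarith)
  have hτ : 1000 * x ^ 40 ≤ x ^ 41 := by rw [pow_succ x 40]; nlinarith
  have h41 : x ^ 41 ≤ x ^ 62 := pow_le_pow_right₀ (by linarith) (by norm_num)
  have h62 : 1000 * x ^ 62 ≤ x ^ 63 := by rw [pow_succ x 62]; nlinarith [pow_pos (by linarith : 0 < x) 62]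
  have p62 : 0 < x ^ 62 := by positivity
  have hc' : (1 : ℝ) / (64 * c) ≤ 1 / 4096 := by
    refine one_div_le_one_div_of_le (by norm_num) ?_
    have : (64 : ℝ) ≤ c := by exact_mod_cast hc
    linarith
  have hc0 : (0 : ℝ) ≤ 1 / (64 * c) := by positivity
  set β : ℝ := 63 / 64 - 1 / (64 * c) with hβ
  have hβ0 : 1 / 2 ≤ β := by linarith
  have hmix : ∀ j < m, IsMixing {y ∈ Vb | ω y = j} (β / m) (x ^ 120) := fun j hj =>
    isMixing_layer hm (by linarith) (by linarith) hτ1 hF.card_Vb hF.codegree_Vb (hω 0 j hj).1 (hω 0 j hj).2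
      (by positivity) (mixing_error_le hn' (by omega))
  have hsub : Vb.erase 0 ⊆ Vb := erase_subset _ _
  have hlay : ∀ j, #({y ∈ Vb | ω y = j} \ {y ∈ Vb.erase 0 | ω y = j}) ≤ 1 := fun j => by
    refine (card_le_card (t := {0}) fun y hy => ?_).trans (card_singleton _).le
    simp only [mem_sdiff, mem_filter, mem_erase] at hy
    rw [mem_singleton]
    tauto
  obtain ⟨E, U, D, h1, h2, h3, h4, h5, h6, h7⟩ := exists_lines (B := fun j => {y ∈ Vb.erase 0 | ω y = j}) (C := C) (m := m) (ℓ := ℓ) (d := ν ^ 62)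
    hm (fun i j hij _ => disjoint_layers _ ω hij) (by
      have l1 := (abs_le.1 (hω 0 0 hm).1).1
      have l2 : (ℓ : ℝ) + x ^ 63 ≤ #Vb / m := by
        rw [le_div_iff₀ (by positivity)]
        have : (m : ℝ) * ℓ + m * (ν : ℝ) ^ 63 ≤ #Vb := by exact_mod_cast hℓ
        linarith
      have l3 : (#{y ∈ Vb | ω y = 0} : ℝ) ≤ #{y ∈ Vb.erase 0 | ω y = 0} + 1 := by
        have h1 := hlay 0
        have h2 := le_card_sdiff {y ∈ Vb.erase 0 | ω y = 0} {y ∈ Vb | ω y = 0}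
        have : #{y ∈ Vb | ω y = 0} ≤ #{y ∈ Vb.erase 0 | ω y = 0} + 1 := by omega
        exact_mod_cast this
      have : ((ℓ + (m - 1) * ν ^ 62 : ℕ) : ℝ) ≤ #{y ∈ Vb.erase 0 | ω y = 0} := by
        push_cast [Nat.cast_sub (show 1 ≤ m from hm)]
        rw [← hx_def]
        have e : x * x ^ 62 = x ^ 63 := by ring
        have h5 : 1000 * (((m : ℝ) - 1) * x ^ 62) ≤ x ^ 63 := by
          rw [← e]
          calc _ = (1000 * (m - 1)) * x ^ 62 := by ring
            _ ≤ _ := by gcongr; linarith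
        have e0 : (#((![Vb] : Fin 1 → Finset G) 0) : ℝ) = #Vb := rfl
        have e1 : (#{y ∈ (![Vb] : Fin 1 → Finset G) 0 | ω y = 0} : ℝ) = #{y ∈ Vb | ω y = 0} := rfl
        rw [e0, e1] at l1
        linarith
      exact_mod_cast this) (by
      intro j hj A hA hAc C' hC' hCc
      have hj' : j < m := by omega
      have hA0 : (#A : ℝ) ≤ n := by exact_mod_cast card_le_univ A
      have hs0 : (0 : ℝ) < s := lt_of_lt_of_le (by positivity) hsr
      refine exists_rainbowMatching_of_mixing (c₀ := s) (K := 4 * ν ^ 2) (e := ν ^ 61)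
        (hmix j hj') (hmix (j + 1) hj) (hA.trans (filter_subset_filter _ hsub)) (hlay _)
        (by positivity) hs0 ?_ ?_ ?_ ?_
      · have e1 : (j + 1) * #A ≤ (m - 1) * ℓ + s := by
          rw [hAc, mul_add]
          refine Nat.add_le_add (Nat.mul_le_mul_right _ (by omega)) (le_trans ?_ hs)
          rw [← mul_assoc]
          exact Nat.mul_le_mul_right _ (Nat.mul_le_mul (by omega) (by omega))
        have e2 : s + #A ≤ #C' := by
          rw [add_mul, one_mul] at e1
          omega
        exact_mod_cast e2
      · push_cast
        rw [← hx_def]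
        have e1 : x ^ 2 * #A ≤ x ^ 2 * (2 * x ^ 64) := by gcongr; linarith
        have e2 : (1 : ℝ) * #A ≤ x ^ 2 * #A := by gcongr; exact one_le_pow₀ (by linarith)
        have e3 : x ^ 2 * (2 * x ^ 64) = 2 * x ^ 66 := by ring
        have e4 : x ^ 66 ≤ x ^ 120 := pow_le_pow_right₀ (by linarith) (by norm_num)
        have e5 : 1000 ^ 3 * x ^ 120 ≤ x ^ 3 * x ^ 120 := by gcongr
        have e6 : 1 / 2 * (x ^ 3 * x ^ 120) ≤ β / m * s * x ^ 61 := by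
          calc 1 / 2 * (x ^ 3 * x ^ 120) = 1 / 2 * x ^ 62 * x ^ 61 := by ring
            _ ≤ β / m * s * x ^ 61 := by
              refine mul_le_mul_of_nonneg_right ?_ (by positivity)
              calc 1 / 2 * x ^ 62 ≤ β * m * x ^ 62 := mul_le_mul_of_nonneg_right (by nlinarith) p62.le
                _ = β / m * (m * m * x ^ 62) := by field_simp
                _ ≤ β / m * s := mul_le_mul_of_nonneg_left hsr (by positivity)
        have : 0 < x ^ 120 := by positivity
        linarith
      · have e1 : 0 < x ^ 62 := by positivity
        have e2 : 4 * x ^ 2 * (x ^ 62 - x ^ 61) = 4 * x ^ 64 - 4 * x ^ 63 := by ring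
        have h3 : 1000 * x ^ 63 ≤ x ^ 64 := by rw [pow_succ x 63]; nlinarith [pow_pos (by linarith : 0 < x) 63]
        have e3 : (#A : ℝ) < x ^ 62 + 4 * x ^ 2 * (x ^ 62 - x ^ 61) := by
          have : 0 < x ^ 63 := by positivity
          linarith
        have e4 : ν ^ 61 ≤ ν ^ 62 := Nat.pow_le_pow_right (by omega) (by norm_num)
        have e5 : (#A : ℝ) < ((ν ^ 62 + 4 * ν ^ 2 * (ν ^ 62 - ν ^ 61) : ℕ) : ℝ) := by
          push_cast [Nat.cast_sub e4]
          exact e3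
        exact_mod_cast e5
      · exact Nat.pow_le_pow_right (by omega) (by norm_num))
  refine ⟨E, U, D, h1, h2, fun y hy => ?_, h4, h5, h6, h7⟩
  obtain ⟨j, -, hy⟩ := mem_biUnion.1 (h3 hy)
  exact (mem_filter.1 hy).1

end Stages

section Assembly

open Finset

variable {G : Type} [AddCommGroup G] [Fintype G] [DecidableEq G]

theorem Realizes.countP_isLeft {E : Multiset (G × G × ℕ)} {M : Multiset (G ⊕ G)} (h : Realizes E M) {m : ℕ}
    (hE : ∀ e ∈ E, e.2.2 = m) : M.countP (fun a => a.isLeft) = m * Multiset.card E := by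
  obtain ⟨Q, rfl, rfl⟩ := h
  induction Q using Multiset.induction_on with
  | empty => simp
  | cons l Q ih =>
    rw [Multiset.map_cons, Multiset.map_cons, Multiset.sum_cons, Multiset.countP_add, countP_isLeft_pathTokens, Multiset.card_cons, mul_add,
      ih fun e he => hE e (by rw [Multiset.map_cons]; exact Multiset.mem_cons_of_mem he)]
    have : l.length = m := hE (pathEnds l) (by rw [Multiset.map_cons]; exact Multiset.mem_cons_self _ _)
    omega

theorem Realizes.countP_isRight {E : Multiset (G × G × ℕ)} {M : Multiset (G ⊕ G)} (h : Realizes E M) {m : ℕ}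
    (hE : ∀ e ∈ E, e.2.2 = m) : M.countP (fun a => a.isRight) = (m - 1) * Multiset.card E := by
  obtain ⟨Q, rfl, rfl⟩ := h
  induction Q using Multiset.induction_on with
  | empty => simp
  | cons l Q ih =>
    rw [Multiset.map_cons, Multiset.map_cons, Multiset.sum_cons, Multiset.countP_add, countP_isRight_pathTokens, Multiset.card_cons, mul_add,
      ih fun e he => hE e (by rw [Multiset.map_cons]; exact Multiset.mem_cons_of_mem he)]
    have : l.length = m := hE (pathEnds l) (by rw [Multiset.map_cons]; exact Multiset.mem_cons_self _ _)
    rw [this]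
    ring

theorem countP_isLeft_disjSum (A B : Finset G) : (A.disjSum B).val.countP (fun a => a.isLeft) = #A := by
  simp [Finset.disjSum, Multiset.disjSum, Multiset.countP_map]

theorem countP_isRight_disjSum (A B : Finset G) : (A.disjSum B).val.countP (fun a => a.isRight) = #B := by
  simp [Finset.disjSum, Multiset.disjSum, Multiset.countP_map]

theorem countP_sum (s : Finset G) (f : G → Multiset (G ⊕ G)) (p : G ⊕ G → Prop) [DecidablePred p] :
    (∑ x ∈ s, f x).countP p = ∑ x ∈ s, (f x).countP p :=
  map_sum (Multiset.countPAddMonoidHom p) f s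

variable {w : G} {F P Va Vb T : Finset G} {Adm : Set (G ⊕ G)} {c m B B' : ℕ} {τ E₀ : ℝ}

theorem Frame.exists_absorber (hF : Frame w F P Va Vb T Adm c τ E₀ B B') {L aF aP g N : ℕ}
    (hcF : #F ≤ 2 ^ L) (hcP : #P ≤ 2 ^ L) (haF : aF ≤ #F) (haP : aP ≤ #P) (hg : 6 * g ≤ m)
    (hgN : 88 * (L + 1) * 2 ^ L ≤ g * N) (hU : 2 + 3 * 2 ^ L + (88 * (L + 1) * 2 ^ L + 3 * m * N) ≤ B) :
    ∃ (E : Multiset (G × G × ℕ)) (V₁ C₁ : Finset G), (∀ e ∈ E, e.2.2 = m) ∧ V₁ ⊆ Va.erase 0 ∧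
      (∀ c ∈ C₁, c ≠ 0 ∧ c ∉ T ∧ c ∉ P ∧ w - c ∉ P) ∧ #V₁ ≤ 88 * (L + 1) * 2 ^ L + 3 * m * N ∧
      m * Multiset.card E + aF = #V₁ + #F ∧ (m - 1) * Multiset.card E + 2 * aP = #C₁ + 2 * #P ∧
      ∀ D ⊆ F, #D = aF → ∀ D' ⊆ P, #D' = aP →
        Realizes E ((V₁.disjSum C₁).val + (∑ x ∈ F \ D, {Sum.inl x} + ∑ x ∈ P \ D', pairTok w x)) := by
  set Used : Finset (G ⊕ G) := (insert 0 F).disjSum (insert 0 (P ∪ P.image (w - ·))) with hUsed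
  have hUc : #Used ≤ 2 + 3 * 2 ^ L := by
    rw [hUsed, card_disjSum]
    have h1 := card_insert_le 0 F
    have h2 := card_insert_le 0 (P ∪ P.image (w - ·))
    have h3 := card_union_le P (P.image (w - ·))
    have h4 : #(P.image (w - ·)) ≤ #P := card_image_le
    omega
  obtain ⟨E, U, h1, h2, h3, h4⟩ := _root_.exists_absorber hF.vertex_supply hF.pair_supply hF.connectors (F := F) (P := P)
    (fun _ _ => trivial) (fun c hc => ⟨(hF.pair c hc).1, (hF.pair c hc).2.1⟩) hcF hcP (haF.trans hcF) (haP.trans hcP) hg hgN Used (by omega)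
  obtain ⟨V₁, C₁, rfl, -, -⟩ := h3.nodup.exists_tokens
  refine ⟨E, V₁, C₁, h1, fun v hv => ?_, fun c hc => ?_, ?_, ?_⟩
  · have hv' : Sum.inl v ∈ (V₁.disjSum C₁).val := inl_mem_disjSum.2 hv
    refine mem_erase.2 ⟨fun h => h3.fresh _ hv' ?_, hF.adm_vertex v (h3.adm _ hv')⟩
    rw [hUsed, inl_mem_disjSum, h]
    exact mem_insert_self _ _
  · have hc' : Sum.inr c ∈ (V₁.disjSum C₁).val := inr_mem_disjSum.2 hc
    have hf := h3.fresh _ hc'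
    rw [hUsed, inr_mem_disjSum, mem_insert, mem_union, mem_image, not_or, not_or] at hf
    exact ⟨hf.1, (hF.adm_colour c (h3.adm _ hc')).1, hf.2.1, fun h => hf.2.2 ⟨_, h, sub_sub_cancel _ _⟩⟩
  · refine le_trans ?_ h3.card_le
    rw [card_val, card_disjSum]
    omega
  · obtain ⟨D, hD, hDc⟩ := exists_subset_card_eq haF
    obtain ⟨D', hD', hDc'⟩ := exists_subset_card_eq haP
    have h5 := h4 D hD hDc D' hD' hDc'
    have h6 := h5.countP_isLeft h1
    have h7 := h5.countP_isRight h1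
    rw [Multiset.countP_add, Multiset.countP_add, countP_sum, countP_sum, countP_isLeft_disjSum] at h6
    rw [Multiset.countP_add, Multiset.countP_add, countP_sum, countP_sum, countP_isRight_disjSum] at h7
    have e1 : ∀ x : G, ({Sum.inl x} : Multiset (G ⊕ G)).countP (fun a => a.isLeft) = 1 := fun x => rfl
    have e2 : ∀ x : G, ({Sum.inl x} : Multiset (G ⊕ G)).countP (fun a => a.isRight) = 0 := fun x => rfl
    have e3 : ∀ x : G, (pairTok w x).countP (fun a => a.isLeft) = 0 := fun x => rfl
    have e4 : ∀ x : G, (pairTok w x).countP (fun a => a.isRight) = 2 := fun x => rfl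
    simp only [e1, e2, e3, e4, sum_const, smul_eq_mul, mul_one, mul_zero, add_zero, zero_add] at h6 h7
    have h8 := card_sdiff_add_card_eq_card hD
    have h9 := card_sdiff_add_card_eq_card hD'
    exact ⟨by omega, by omega, h4⟩

end Assembly

section Assembly

open Finset

variable {G : Type} [AddCommGroup G] [Fintype G] [DecidableEq G]

theorem sum_pairTok_eq (w : G) (P : Finset G) :
    ∑ c ∈ P, pairTok w c = ∑ c ∈ P, {Sum.inr c} + ∑ c ∈ P.image (w - ·), ({Sum.inr c} : Multiset (G ⊕ G)) := by
  rw [sum_image fun a _ b _ hab => sub_right_injective hab, ← sum_add_distrib]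
  rfl

variable {w : G} {F P Va Vb T : Finset G} {Adm : Set (G ⊕ G)} {c m B B' ν : ℕ}

theorem Frame.exists_perm (hF : Frame w F P Va Vb T Adm c ((ν : ℝ) ^ 40) ((ν : ℝ) ^ 120) B B')
    (hsum : ∑ g : G, g = 0) {k r q e L g N : ℕ} (hr : 0 < r) (hm : 0 < m) (he : e < q)
    (hk : k = q * (m + 17) + e) (hcard : r * k = Fintype.card G - 1)
    (hn : ν ^ 64 ≤ Fintype.card G) (hn' : Fintype.card G ≤ 2 * ν ^ 64) (hν : 1000 * m ≤ ν) (hc : 64 ≤ c)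
    (hexp : 2 * (2 * (m * (Fintype.card G : ℝ))) * Real.exp (-((ν : ℝ) ^ 40) ^ 2 / (2 * Fintype.card G)) < 1)
    (hB' : 106 * (r * q) + 100 ≤ B') (hcF : #F ≤ 2 ^ L) (hcP : #P ≤ 2 ^ L) (haF : 16 * (r * q) + r * e ≤ #F)
    (haP : 8 * (r * q) - 1 ≤ #P) (hg : 6 * g ≤ m) (hgN : 88 * (L + 1) * 2 ^ L ≤ g * N)
    (hU : 2 + 3 * 2 ^ L + (88 * (L + 1) * 2 ^ L + 3 * m * N) ≤ B)
    (hS : 2000 * (88 * (L + 1) * 2 ^ L + 3 * m * N) ≤ Fintype.card G) (hVa : #Va + #F ≤ m * (r * q))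
    (hs : 2 + m + 2 * (m * ν ^ 63) ≤ r * q) :
    ∃ σ : Equiv.Perm G, σ.support = univ.erase 0 ∧ (∀ c ∈ σ.cycleType, c = k) ∧
      Set.BijOn (fun v : G => v - σ v) {v : G | v ≠ 0} {v : G | v ≠ 0} := by
  have hcard' : Fintype.card G - 1 = (r * q) * (m + 17) + r * e := by rw [← hcard, hk]; ring
  set s := r * q with hs_def
  set aF := 16 * s + r * e with haF_def
  set aP := 8 * s - 1 with haP_def
  have hn1 : 2 < Fintype.card G := by
    have : s * 1 ≤ s * (m + 17) := Nat.mul_le_mul_left _ (by omega)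
    omega
  obtain ⟨E₁, V₁, C₁, hE₁, hV₁, hC₁, hcV₁, hlen₁, hlen₁', hreal₁⟩ := hF.exists_absorber hcF hcP haF haP hg hgN hU
  obtain ⟨ℓa, E₂, U₂, D₂, hE₂, hcE₂, hU₂, hD₂, hcU₂, hcD₂, hreal₂, hbig⟩ :=
    hF.exists_lines_Va hm hn hn' hν hc hexp (V₁ := V₁) (by omega)
  set a := Multiset.card E₁ with ha
  -- vertices
  have hVa0 : V₁ ⊆ Va := hV₁.trans (erase_subset _ _)
  have hU₂a : U₂ ⊆ Va := fun v hv => (mem_sdiff.1 (mem_of_mem_erase (hU₂ hv))).1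
  have hV₁U₂ : Disjoint V₁ U₂ := disjoint_left.2 fun v hv hv' => (mem_sdiff.1 (mem_of_mem_erase (hU₂ hv'))).2 hv
  have h1 : #V₁ + #U₂ ≤ #Va := by
    rw [← card_union_of_disjoint hV₁U₂]
    exact card_le_card (union_subset hVa0 hU₂a)
  have h2 : a + ℓa ≤ s := by
    refine le_of_mul_le_mul_left (a := m) ?_ hm
    rw [mul_add]
    omega
  obtain ⟨ℓb, hℓb⟩ : ∃ ℓb, a + ℓa + ℓb = s := ⟨s - (a + ℓa), by omega⟩
  have hmul : m * a + m * ℓa + m * ℓb = m * s := by rw [← hℓb]; ring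
  have hmul' : (m - 1) * a + (m - 1) * ℓa + (m - 1) * ℓb = (m - 1) * s := by rw [← hℓb]; ring
  have hsm : s * (m + 17) = m * s + 17 * s := by ring
  have hsm' : m * s = (m - 1) * s + s := by
    obtain ⟨m', rfl⟩ : ∃ m', m = m' + 1 := ⟨m - 1, by omega⟩
    rw [Nat.add_sub_cancel]; ring
  have hcov : Fintype.card G - 1 ≤ #F + #Va + #Vb := by
    rw [← card_univ, ← card_erase_of_mem (mem_univ (0 : G))]
    refine (card_le_card (t := F ∪ Va ∪ Vb) fun v hv => ?_).trans ((card_union_le _ _).trans (Nat.add_le_add_right (card_union_le _ _) _))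
    rw [mem_union, mem_union, or_assoc]
    exact hF.cover v (ne_of_mem_erase hv)
  have hℓ : m * ℓb + m * ν ^ 63 ≤ #Vb := by omega
  -- colours
  set wP := P.image (w - ·) with hwP
  have hcwP : #wP = #P := card_image_of_injective _ sub_right_injective
  have hPwP : Disjoint P wP := by
    refine disjoint_left.2 fun c hc hc' => ?_
    obtain ⟨d, hd, rfl⟩ := mem_image.1 hc'
    exact (hF.pair d hd).2.2 hc
  have hPC₁ : Disjoint (P ∪ wP) C₁ := by
    refine disjoint_left.2 fun c hc hc' => ?_
    rcases mem_union.1 hc with hc | hc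
    · exact (hC₁ c hc').2.2.1 hc
    · obtain ⟨d, hd, rfl⟩ := mem_image.1 hc
      exact (hC₁ _ hc').2.2.2 (by rwa [sub_sub_cancel])
  have hQ : Disjoint (P ∪ wP ∪ C₁) D₂ := by
    refine disjoint_left.2 fun c hc hc' => ?_
    obtain ⟨hT, hc0⟩ := mem_sdiff.1 (hD₂ hc')
    rcases mem_union.1 hc with hc | hc
    · rcases mem_union.1 hc with hc | hc
      · exact disjoint_left.1 hF.disjoint_T_P hT hc
      · exact hc0 (mem_insert_of_mem hc)
    · exact (hC₁ c hc).2.1 hT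
  set Q := P ∪ wP ∪ C₁ ∪ D₂ with hQ_def
  have hQ0 : Q ⊆ univ.erase 0 := by
    intro c hc
    refine mem_erase.2 ⟨?_, mem_univ _⟩
    rcases mem_union.1 hc with hc | hc
    · rcases mem_union.1 hc with hc | hc
      · rcases mem_union.1 hc with hc | hc
        · exact (hF.pair c hc).1
        · obtain ⟨d, hd, rfl⟩ := mem_image.1 hc
          exact sub_ne_zero.2 (hF.pair d hd).2.1.symm
      · exact (hC₁ c hc).1
    · rintro rfl
      exact (mem_sdiff.1 (hD₂ hc)).2 (mem_insert_self _ _)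
  have hcQ : #Q = 2 * #P + #C₁ + #D₂ := by
    rw [hQ_def, card_union_of_disjoint hQ, card_union_of_disjoint hPC₁, card_union_of_disjoint hPwP, hcwP]
    omega
  set Cb := univ.erase 0 \ Q with hCb
  have hcCb : #Cb + #Q = Fintype.card G - 1 := by
    rw [hCb, card_sdiff_add_card_eq_card hQ0, card_erase_of_mem (mem_univ _), card_univ]
  have hCbs : (m - 1) * ℓb + 2 * s ≤ #Cb := by omega
  have hss : m * m * ν ^ 62 ≤ s := by
    have : m * m * ν ^ 62 ≤ m * ν ^ 63 := by
      rw [mul_assoc, pow_succ' ν 62]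
      exact Nat.mul_le_mul_left _ (Nat.mul_le_mul_right _ (by omega))
    omega
  have hexp' : 2 * (1 * (m * (Fintype.card G : ℝ))) * Real.exp (-((ν : ℝ) ^ 40) ^ 2 / (2 * Fintype.card G)) < 1 := by
    refine lt_of_le_of_lt (mul_le_mul_of_nonneg_right ?_ (Real.exp_pos _).le) hexp
    have : (0 : ℝ) ≤ m * (Fintype.card G : ℝ) := by positivity
    linarith
  obtain ⟨E₃, U₃, D₃, hE₃, hcE₃, hU₃, hD₃, hcU₃, hcD₃, hreal₃⟩ := hF.exists_lines_Vb hm hn' hν hc hexp' hℓ hCbs hss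
  have hU₃b : U₃ ⊆ Vb := hU₃.trans (erase_subset _ _)
  have hFV₁ : Disjoint F V₁ := hF.disjoint_F_Va.mono_right hVa0
  have hFVU : Disjoint (F ∪ V₁) U₂ := disjoint_union_left.2 ⟨hF.disjoint_F_Va.mono_right hU₂a, hV₁U₂⟩
  have hA : Disjoint (F ∪ V₁ ∪ U₂) U₃ := disjoint_union_left.2 ⟨disjoint_union_left.2
    ⟨hF.disjoint_F_Vb.mono_right hU₃b, hF.disjoint_Va_Vb.mono hVa0 hU₃b⟩, hF.disjoint_Va_Vb.mono hU₂a hU₃b⟩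
  set A := F ∪ V₁ ∪ U₂ ∪ U₃ with hA_def
  have hA0 : A ⊆ univ.erase 0 := by
    intro v hv
    refine mem_erase.2 ⟨?_, mem_univ _⟩
    rcases mem_union.1 hv with hv | hv
    · rcases mem_union.1 hv with hv | hv
      · rcases mem_union.1 hv with hv | hv
        · rintro rfl
          exact hF.zero_notMem hv
        · exact ne_of_mem_erase (hV₁ hv)
      · exact ne_of_mem_erase (hU₂ hv)
    · exact ne_of_mem_erase (hU₃ hv)
  have hcA : #A = #F + #V₁ + #U₂ + #U₃ := by
    rw [hA_def, card_union_of_disjoint hA, card_union_of_disjoint hFVU, card_union_of_disjoint hFV₁]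
  have hcW : #(univ.erase 0 \ A) + #A = Fintype.card G - 1 := by
    rw [card_sdiff_add_card_eq_card hA0, card_erase_of_mem (mem_univ _), card_univ]
  have hcD : #(Cb \ D₃) + #D₃ = #Cb := card_sdiff_add_card_eq_card hD₃
  obtain ⟨z, hz⟩ : ∃ z : G, z ∉ ({0, w} : Finset G) := by
    by_contra! hcon
    have h5 : #(univ : Finset G) ≤ #({0, w} : Finset G) := card_le_card fun z _ => hcon z
    have h6 : #({0, w} : Finset G) ≤ 2 := card_le_two
    rw [card_univ] at h5
    omega
  rw [mem_insert, mem_singleton, not_or] at hz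
  refine exists_perm_of_lines hsum hr hm he hk hcard hF.link hz.1 hz.2 (D := Cb \ D₃) (W := univ.erase 0 \ A) (E := E₁ + E₂ + E₃)
    (M₀ := (V₁.disjSum C₁).val + (∑ x ∈ U₂, {Sum.inl x} + ∑ c ∈ D₂, {Sum.inr c}) + (∑ x ∈ U₃, {Sum.inl x} + ∑ c ∈ D₃, {Sum.inr c}))
    (fun c hc => (hF.pair c hc).2.1) (fun h0 => ?_) hB' (by omega) (by omega) (fun x hx => ?_) ?_ (fun F' hF' hcF' P' hP' hcP' => ?_)
    haF haP ?_
  · exact ne_of_mem_erase (mem_sdiff.1 (mem_sdiff.1 h0).1).1 rfl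
  · rcases Multiset.mem_add.1 hx with hx | hx
    · rcases Multiset.mem_add.1 hx with hx | hx
      exacts [hE₁ x hx, hE₂ x hx]
    · exact hE₃ x hx
  · rw [Multiset.card_add, Multiset.card_add, hcE₂, hcE₃]
    omega
  · convert ((hreal₁ F' hF' hcF' P' hP' hcP').add hreal₂).add hreal₃ using 1
    abel
  · have e1 : ∑ x ∈ univ.erase 0 \ A, {Sum.inl x} + ∑ x ∈ A, {Sum.inl x} = ∑ x ∈ univ.erase 0, ({Sum.inl x} : Multiset (G ⊕ G)) :=
      sum_sdiff hA0
    have e2 : ∑ x ∈ Cb, {Sum.inr x} + ∑ x ∈ Q, {Sum.inr x} = ∑ x ∈ univ.erase 0, ({Sum.inr x} : Multiset (G ⊕ G)) :=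
      sum_sdiff hQ0
    have e3 : ∑ x ∈ Cb \ D₃, {Sum.inr x} + ∑ x ∈ D₃, {Sum.inr x} = ∑ x ∈ Cb, ({Sum.inr x} : Multiset (G ⊕ G)) :=
      sum_sdiff hD₃
    rw [← e1, ← e2, ← e3, hA_def, hQ_def, sum_union hA, sum_union hFVU, sum_union hFV₁, sum_union hQ, sum_union hPC₁, sum_union hPwP,
      sum_pairTok_eq, ← sum_tokens_eq_val_disjSum]
    abel

end Assembly

section Numerics

open Finset

theorem exp_tail_lt_one {n l ν : ℕ} (hl : 100 ≤ l) (hlν : l ^ 30 ≤ ν) (hn : 0 < n) (hnl : n < 2 ^ (l + 1)) (hnν : n ≤ 2 * ν ^ 64) :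
    2 * (17 * (n : ℝ) ^ 30) * Real.exp (-((ν : ℝ) ^ 40) ^ 2 / (4 * n)) < 1 := by
  have hn0 : (0 : ℝ) < n := by exact_mod_cast hn
  have h1 : 2 * (17 * (n : ℝ) ^ 30) ≤ Real.exp (30 * (l + 1) + 6) := by
    have h2 : (n : ℝ) ≤ 2 ^ (l + 1) := by exact_mod_cast hnl.le
    have h3 : (2 : ℝ) ≤ Real.exp 1 := by linarith [Real.add_one_le_exp (1 : ℝ)]
    calc 2 * (17 * (n : ℝ) ^ 30) ≤ 2 ^ 6 * (2 ^ (l + 1)) ^ 30 := by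
          have h4 := pow_le_pow_left₀ hn0.le h2 30
          have h5 : (0 : ℝ) ≤ (2 ^ (l + 1)) ^ 30 := by positivity
          linarith
      _ = 2 ^ (30 * (l + 1) + 6) := by rw [pow_add 2 (30 * (l + 1)) 6, mul_comm 30, pow_mul, mul_comm]
      _ ≤ Real.exp 1 ^ (30 * (l + 1) + 6) := pow_le_pow_left₀ (by norm_num) h3 _
      _ = Real.exp (30 * (l + 1) + 6) := by rw [← Real.exp_nat_mul]; push_cast; ring_nf
  have hx : (l : ℝ) ≤ ν := by
    have : l ^ 1 ≤ l ^ 30 := Nat.pow_le_pow_right (by omega) (by norm_num)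
    exact_mod_cast (pow_one l ▸ this).trans hlν
  have hl' : (100 : ℝ) ≤ l := by exact_mod_cast hl
  set x : ℝ := (ν : ℝ) with hx_def
  have hx0 : 0 < x := by linarith
  have h4 : 30 * ((l : ℝ) + 1) + 6 < (x ^ 40) ^ 2 / (4 * n) := by
    rw [lt_div_iff₀ (by positivity)]
    have h5 : (n : ℝ) ≤ 2 * x ^ 64 := by rw [hx_def]; exact_mod_cast hnν
    have h6 : (30 * ((l : ℝ) + 1) + 6) * 8 < x ^ 16 := by
      have : x ^ 2 ≤ x ^ 16 := pow_le_pow_right₀ (by linarith) (by norm_num)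
      have : 100 * x ≤ x ^ 2 := by nlinarith
      have : x ^ 2 * 100 ≤ x ^ 16 := by
        have h7 : (100 : ℝ) ≤ x ^ 14 := le_trans (by linarith) (le_self_pow₀ (by linarith : (1 : ℝ) ≤ x) (by norm_num : 14 ≠ 0))
        calc x ^ 2 * 100 ≤ x ^ 2 * x ^ 14 := mul_le_mul_of_nonneg_left h7 (by positivity)
          _ = x ^ 16 := by ring
      nlinarith
    calc (30 * ((l : ℝ) + 1) + 6) * (4 * n) ≤ (30 * ((l : ℝ) + 1) + 6) * (4 * (2 * x ^ 64)) := by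
          refine mul_le_mul_of_nonneg_left ?_ (by positivity)
          linarith
      _ = ((30 * ((l : ℝ) + 1) + 6) * 8) * x ^ 64 := by ring
      _ < x ^ 16 * x ^ 64 := mul_lt_mul_of_pos_right h6 (by positivity)
      _ = (x ^ 40) ^ 2 := by ring
  calc 2 * (17 * (n : ℝ) ^ 30) * Real.exp (-(x ^ 40) ^ 2 / (4 * n))
      ≤ Real.exp (30 * (l + 1) + 6) * Real.exp (-(x ^ 40) ^ 2 / (4 * n)) := mul_le_mul_of_nonneg_right h1 (Real.exp_pos _).le
    _ = Real.exp (30 * (l + 1) + 6 + -(x ^ 40) ^ 2 / (4 * n)) := (Real.exp_add _ _).symm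
    _ < 1 := by
      rw [Real.exp_lt_one_iff, neg_div]
      linarith

theorem exists_pow_le_lt {d n a : ℕ} (hd : d ≠ 0) (ha : 0 < a) (hn : a ^ d ≤ n) : ∃ ν, a ≤ ν ∧ ν ^ d ≤ n ∧ n < (ν + 1) ^ d := by
  have hex : ∃ ν, n < (ν + 1) ^ d := ⟨n, lt_of_lt_of_le (Nat.lt_succ_self n) (Nat.le_self_pow hd _)⟩
  have h1 : n < (Nat.find hex + 1) ^ d := Nat.find_spec hex
  have h2 := lt_of_pow_lt_pow_left₀ d (Nat.zero_le _) (hn.trans_lt h1)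
  refine ⟨Nat.find hex, by omega, ?_, h1⟩
  have h3 := Nat.find_min hex (m := Nat.find hex - 1) (by omega)
  rw [Nat.sub_add_cancel (by omega)] at h3
  exact not_lt.1 h3

theorem succ_pow_le_two_mul {d ν : ℕ} (hd : (101 / 100 : ℝ) ^ d ≤ 2) (hν : 100 ≤ ν) : (ν + 1) ^ d ≤ 2 * ν ^ d := by
  have h4 : (100 : ℝ) ≤ ν := by exact_mod_cast hν
  have h6 : ((ν : ℝ) + 1) ^ d ≤ (101 / 100 * ν) ^ d := pow_le_pow_left₀ (by positivity) (by linarith) _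
  rw [mul_pow] at h6
  have h8 : ((ν : ℝ) + 1) ^ d ≤ 2 * (ν : ℝ) ^ d := h6.trans (mul_le_mul_of_nonneg_right hd (by positivity))
  exact_mod_cast h8

theorem exists_root {n a : ℕ} (ha : 100 ≤ a) (hn : a ^ 64 ≤ n) : ∃ ν, a ≤ ν ∧ ν ^ 64 ≤ n ∧ n ≤ 2 * ν ^ 64 := by
  obtain ⟨ν, h1, h2, h3⟩ := exists_pow_le_lt (by norm_num) (by omega) hn
  exact ⟨ν, h1, h2, le_trans (le_of_lt h3) (succ_pow_le_two_mul (by norm_num) (ha.trans h1))⟩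

theorem exists_pow_two_between {x : ℝ} (hx : 1 ≤ x) : ∃ L : ℕ, x ≤ 2 ^ L ∧ (2 : ℝ) ^ L ≤ 2 * x := by
  obtain ⟨L, h1, h2⟩ := exists_nat_pow_near hx (one_lt_two (α := ℝ))
  refine ⟨L + 1, h2.le, ?_⟩
  rw [pow_succ]
  linarith

/-- Splitting `k` into `q` nearly equal parts of length between `M` and `2 * M`. -/
theorem exists_split {k M : ℕ} (hM : 0 < M) (hk : M ≤ k) : ∃ q h e, 0 < q ∧ k = q * h + e ∧ e < q ∧ M ≤ h ∧ h < 2 * M := by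
  have hq : 0 < k / M := Nat.div_pos hk hM
  refine ⟨k / M, k / (k / M), k % (k / M), hq, (Nat.div_add_mod _ _).symm, Nat.mod_lt _ hq, ?_, ?_⟩
  · rw [Nat.le_div_iff_mul_le hq]
    exact Nat.mul_div_le k M
  · rw [Nat.div_lt_iff_lt_mul hq]
    have h1 := Nat.lt_mul_div_succ k hM
    have h2 : M * 1 ≤ M * (k / M) := Nat.mul_le_mul_left _ hq
    nlinarith

end Numerics

section Numerics

open Finset

variable {G : Type} [AddCommGroup G] [Fintype G] [DecidableEq G]

set_option maxHeartbeats 1000000 in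
theorem exists_perm_of_large (hsum : ∑ g : G, g = 0) {k l ν : ℕ} (hl : (2 : ℝ) ^ 1700 ≤ l) (hlν : l ^ 30 ≤ ν)
    (hnl : Fintype.card G < 2 ^ (l + 1)) (hn : ν ^ 64 ≤ Fintype.card G) (hn' : Fintype.card G ≤ 2 * ν ^ 64)
    (hk : l ^ 8 ≤ k) (hkn : k ∣ Fintype.card G - 1) :
    ∃ σ : Equiv.Perm G, σ.support = univ.erase 0 ∧ (∀ c ∈ σ.cycleType, c = k) ∧
      Set.BijOn (fun v : G => v - σ v) {v : G | v ≠ 0} {v : G | v ≠ 0} := by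
  set n := Fintype.card G with hn_def
  obtain ⟨κ, hκ⟩ : ∃ κ : ℝ, κ = 2 ^ 206 := ⟨_, rfl⟩
  have hκ1 : 10 ^ 9 ≤ κ := by rw [hκ]; norm_num
  have hκl : κ ^ 8 ≤ l := by
    refine le_trans (le_of_eq_of_le ?_ (pow_le_pow_right₀ (by norm_num : (1 : ℝ) ≤ 2) (by norm_num : 1648 ≤ 1700))) hl
    rw [hκ, ← pow_mul]
  set y : ℝ := (l : ℝ) with hy_def
  have hyκ : κ ≤ y := le_trans (le_self_pow₀ (by linarith) (by norm_num)) hκl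
  have hy1 : 10 ^ 9 ≤ y := hκ1.trans hyκ
  have hl9 : 10 ^ 9 ≤ l := by rw [hy_def] at hy1; exact_mod_cast hy1
  clear hl
  set x : ℝ := (ν : ℝ) with hx_def
  have hxy : y ^ 30 ≤ x := by rw [hy_def, hx_def]; exact_mod_cast hlν
  have hx0 : 10 ^ 9 ≤ x := (hy1.trans (le_self_pow₀ (by linarith) (by norm_num))).trans hxy
  have hnr : x ^ 64 ≤ n := by rw [hx_def]; exact_mod_cast hn
  have hn9 : (10 : ℝ) ^ 9 ≤ n := (hx0.trans (le_self_pow₀ (by linarith) (by norm_num))).trans hnr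
  have hn9' : 10 ^ 9 ≤ n := by exact_mod_cast hn9
  have hl0 : 0 < l ^ 8 := by positivity
  obtain ⟨r, hr⟩ := hkn
  obtain ⟨q, h, e, hq, hqk, he, hlh, hhl⟩ := exists_split hl0 hk
  have hl8 : 10 ^ 9 ≤ l ^ 8 := hl9.trans (Nat.le_self_pow (by norm_num) _)
  obtain ⟨m, rfl⟩ : ∃ m, h = m + 17 := ⟨h - 17, by omega⟩
  have hr0 : 0 < r := by
    rcases Nat.eq_zero_or_pos r with rfl | h0
    · omega
    · exact h0
  set s := r * q with hs_def
  have hrs : n - 1 = s * (m + 17) + r * e := by rw [hr, hqk]; ring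
  have hre : r * e + r ≤ s := by
    have := Nat.mul_le_mul_left r he
    rw [hs_def]
    linarith
  -- the scales
  obtain ⟨Z, hZ⟩ : ∃ Z : ℝ, Z = n / y ^ 8 := ⟨_, rfl⟩
  obtain ⟨Y, hY⟩ : ∃ Y : ℝ, Y = n / (κ * y) := ⟨_, rfl⟩
  obtain ⟨V, hV⟩ : ∃ V : ℝ, V = n / κ := ⟨_, rfl⟩
  have hZn : y ^ 8 * Z = n := by rw [hZ]; field_simp
  have hYn : κ * y * Y = n := by rw [hY]; field_simp
  have hVn : κ * V = n := by rw [hV]; field_simp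
  have hYV : y * Y = V := by rw [hY, hV]; field_simp
  have hZ0 : 0 ≤ Z := by rw [hZ]; positivity
  have hY0 : 0 ≤ Y := by rw [hY]; positivity
  have hsZ : (s : ℝ) ≤ Z := by
    rw [hZ, le_div_iff₀ (by positivity)]
    have h1 : s * l ^ 8 ≤ n := (Nat.mul_le_mul_left s hlh).trans (by omega)
    rw [hy_def]
    exact_mod_cast h1
  have hZs : Z ≤ 2 * s := by
    rw [hZ, div_le_iff₀ (by positivity)]
    have h1 : n ≤ 2 * s * l ^ 8 := by
      have : s * (m + 17 + 1) ≤ s * (2 * l ^ 8) := Nat.mul_le_mul_left s hhl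
      have h2 : s * (m + 17 + 1) = s * (m + 17) + s := by ring
      have h3 : s * (2 * l ^ 8) = 2 * s * l ^ 8 := by ring
      omega
    rw [hy_def]
    exact_mod_cast h1
  have hτZ : x ^ 40 ≤ Z := by
    rw [hZ, le_div_iff₀ (by positivity)]
    have h1 : y ^ 8 ≤ x ^ 24 := (pow_le_pow_right₀ (by linarith) (by norm_num : 8 ≤ 30)).trans
      (hxy.trans (le_self_pow₀ (by linarith) (by norm_num)))
    calc x ^ 40 * y ^ 8 ≤ x ^ 40 * x ^ 24 := mul_le_mul_of_nonneg_left h1 (by positivity)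
      _ = x ^ 64 := by ring
      _ ≤ n := hnr
  have hτ : x ≤ x ^ 40 := le_self_pow₀ (by linarith) (by norm_num)
  have hy7 : κ * y * 1000 ≤ y ^ 8 := by
    have h1 : y ^ 3 ≤ y ^ 8 := pow_le_pow_right₀ (by linarith) (by norm_num)
    have h2 : κ * y * 1000 ≤ y * y * y := by
      refine mul_le_mul (mul_le_mul_of_nonneg_right hyκ (by linarith)) (by linarith) (by norm_num) (by positivity)
    linarith [show y * y * y = y ^ 3 by ring]
  have hZY : 1000 * Z ≤ Y := by
    have h1 : κ * y * (1000 * Z) ≤ κ * y * Y := by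
      rw [hYn, ← hZn]
      linarith [mul_le_mul_of_nonneg_right hy7 hZ0]
    exact le_of_mul_le_mul_left h1 (by positivity)
  have hYV' : 10 ^ 9 * Y ≤ V := by
    rw [← hYV]
    exact mul_le_mul_of_nonneg_right hy1 hY0
  have hVn' : 10 ^ 9 * V ≤ n := by
    rw [← hVn]
    exact mul_le_mul_of_nonneg_right hκ1 (by linarith)
  have hmx : 1000 * m ≤ ν := by
    have h1 : (1000 * m : ℝ) ≤ x := by
      have h2 : (m : ℝ) ≤ 2 * y ^ 8 := by rw [hy_def]; exact_mod_cast (by omega : m ≤ 2 * l ^ 8)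
      have h3 : y ^ 8 * 2000 ≤ y ^ 8 * y ^ 22 :=
        mul_le_mul_of_nonneg_left (le_trans (by linarith) (le_self_pow₀ (by linarith : 1 ≤ y) (by norm_num : 22 ≠ 0))) (by positivity)
      have h4 : y ^ 8 * y ^ 22 = y ^ 30 := by ring
      linarith
    rw [hx_def] at h1
    exact_mod_cast h1
  have hmr : (m : ℝ) ≤ Z := by
    have : (1000 * m : ℝ) ≤ x := by rw [hx_def]; exact_mod_cast hmx
    have : (0 : ℝ) ≤ m := by positivity
    linarith
  -- the frame
  obtain ⟨c, hc⟩ : ∃ c : ℕ, c = 2 ^ 200 * l := ⟨_, rfl⟩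
  have hcr : 64 * (c : ℝ) = κ * y := by
    rw [hc, hκ, hy_def]
    push_cast
    ring
  have hcY : (n : ℝ) * (1 / (64 * c)) = Y := by rw [hcr, hY]; ring
  have hc64 : 64 ≤ c := by
    have : 64 * 1 ≤ 2 ^ 200 * l := Nat.mul_le_mul (by norm_num) (by omega)
    omega
  have hexp := exp_tail_lt_one (by omega) hlν (by omega) hnl hn'
  obtain ⟨B, hB⟩ : ∃ B : ℕ, B = n / 2 ^ 190 := ⟨_, rfl⟩
  have hBV : (B : ℝ) ≤ 65536 * V := by
    have h1 : B * 2 ^ 190 ≤ n := by rw [hB]; exact Nat.div_mul_le_self _ _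
    have h2 : (B : ℝ) * 2 ^ 190 ≤ n := by exact_mod_cast h1
    rw [hV, hκ, ← mul_div_assoc, le_div_iff₀ (by positivity)]
    linarith [show (B : ℝ) * 2 ^ 206 = 65536 * ((B : ℝ) * 2 ^ 190) by ring]
  obtain ⟨w, F, P, Va, Vb, T, Adm, hF⟩ := exists_frame (G := G) (q := c) (by omega) (τ := x ^ 40) (E := x ^ 120) (B := B)
    (B' := 106 * s + 100) (by linarith) (by omega) (by positivity) (by
      have h1 := mixing_error_le (n := n) (ν := ν) hn' (by
        have : (2 : ℝ) ≤ x := by linarith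
        rw [hx_def] at this
        exact_mod_cast this)
      refine le_trans (mul_le_mul_of_nonneg_left ?_ (by positivity)) h1
      linarith) hexp (by
      have h1 : ((n : ℝ) - 900) * (1 / 64) ^ 30 = 2 ^ 26 * V - 900 * (1 / 64) ^ 30 := by rw [← hVn, hκ]; ring
      rw [← hn_def, h1]
      have h2 : (900 : ℝ) * (1 / 64) ^ 30 ≤ 1 := by norm_num
      linarith) (by
      rw [← hn_def, hcr]
      have h1 : 1000000 * (κ * y) ^ 7 ≤ y ^ 8 := by
        have h2 : 1000000 * κ ^ 7 ≤ κ * κ ^ 7 := mul_le_mul_of_nonneg_right (by linarith) (by positivity)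
        have h3 : 1000000 * κ ^ 7 ≤ y := by linarith [show κ * κ ^ 7 = κ ^ 8 by ring]
        calc 1000000 * (κ * y) ^ 7 = 1000000 * κ ^ 7 * y ^ 7 := by ring
          _ ≤ y * y ^ 7 := mul_le_mul_of_nonneg_right h3 (by positivity)
          _ = y ^ 8 := by ring
      have h4 : 62500 * Z ≤ ((n : ℝ) / 2 - 2) * ((1 / (κ * y)) ^ 7 * (1 / 4)) := by
        have h5 : ((n : ℝ) / 2 - 2) * ((1 / (κ * y)) ^ 7 * (1 / 4)) = ((n : ℝ) / 2 - 2) / (4 * (κ * y) ^ 7) := by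
          rw [one_div, inv_pow]
          field_simp
        rw [h5, le_div_iff₀ (by positivity)]
        have h6 := mul_le_mul_of_nonneg_right h1 hZ0
        rw [hZn] at h6
        linarith
      push_cast
      linarith)
  -- sizes
  have hcF := hF.card_F
  have hcP := hF.card_P
  have hcVa := abs_le.1 hF.card_Va
  rw [← hn_def, hcY] at hcF hcP
  rw [← hn_def] at hcVa
  obtain ⟨L, hL, hL'⟩ := exists_pow_two_between (x := 2 * Y) (by linarith)
  have hLl : L + 1 ≤ l := by
    have h1 : (2 : ℝ) ^ L * 2 ^ 2 ≤ n := by linarith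
    have h2 : 2 ^ (L + 2) ≤ n := by rw [pow_add]; exact_mod_cast h1
    have h3 := (Nat.pow_lt_pow_iff_right (a := 2) (by norm_num)).1 (h2.trans_lt hnl)
    omega
  set T₀ := 88 * (L + 1) * 2 ^ L with hT₀
  have hT₀V : (T₀ : ℝ) ≤ 352 * V := by
    have h1 : ((L : ℝ) + 1) ≤ y := by rw [hy_def]; exact_mod_cast hLl
    have h2 : ((L : ℝ) + 1) * 2 ^ L ≤ y * (4 * Y) := mul_le_mul h1 (by linarith) (by positivity) (by linarith)
    rw [hT₀, ← hYV]
    push_cast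
    linarith
  obtain ⟨g, hg⟩ : ∃ g, g = m / 6 := ⟨_, rfl⟩
  have hg0 : 0 < g := by omega
  obtain ⟨N, hN⟩ : ∃ N, N = T₀ / g + 1 := ⟨_, rfl⟩
  have hgN : T₀ ≤ g * N := by rw [hN]; exact (Nat.lt_mul_div_succ _ hg0).le
  have hgN' : g * N ≤ T₀ + g := by
    rw [hN, mul_add, mul_one]
    exact Nat.add_le_add_right (Nat.mul_div_le _ _) _
  have hmN : 3 * m * N ≤ 36 * T₀ + 6 * m := by
    have h1 : 3 * m * N ≤ 36 * g * N := Nat.mul_le_mul_right _ (by omega)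
    have h2 : 36 * g * N = 36 * (g * N) := by ring
    omega
  have hmN' : ((3 * m * N : ℕ) : ℝ) ≤ 36 * T₀ + 6 * m := by exact_mod_cast hmN
  refine hF.exists_perm hsum (L := L) (g := g) (N := N) hr0 (by omega) he hqk (by rw [← hn_def, hr, mul_comm]) hn hn' hmx hc64 ?_ le_rfl ?_ ?_ ?_ ?_
    (by omega) hgN ?_ ?_ ?_ ?_
  · refine lt_of_le_of_lt (mul_le_mul ?_ (Real.exp_le_exp.2 ?_) (Real.exp_pos _).le (by positivity)) hexp
    · have h1 : (m : ℝ) ≤ n := by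
        have : (n : ℝ) ≥ V := by linarith
        linarith
      have h2 : (m : ℝ) * n ≤ (n : ℝ) ^ 2 := by
        rw [pow_two]; exact mul_le_mul_of_nonneg_right h1 (by positivity)
      have h3 : (n : ℝ) ^ 2 ≤ (n : ℝ) ^ 30 := pow_le_pow_right₀ (by linarith) (by norm_num)
      have h4 : (0 : ℝ) ≤ (n : ℝ) ^ 2 := by positivity
      linarith
    · rw [neg_div, neg_div, neg_le_neg_iff]
      exact div_le_div_of_nonneg_left (by positivity) (by positivity) (by linarith)
  · have h1 : (#F : ℝ) ≤ 2 ^ L := by linarith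
    exact_mod_cast h1
  · have h1 : (#P : ℝ) ≤ 2 ^ L := by linarith
    exact_mod_cast h1
  · have h1 : ((17 * s : ℕ) : ℝ) ≤ #F := by push_cast; linarith
    have h2 : 17 * s ≤ #F := by exact_mod_cast h1
    omega
  · have h1 : ((8 * s : ℕ) : ℝ) ≤ #P := by push_cast; linarith
    have h2 : 8 * s ≤ #P := by exact_mod_cast h1
    omega
  · rw [hB, Nat.le_div_iff_mul_le (by positivity)]
    have h1 : ((2 + 3 * 2 ^ L + (T₀ + 3 * m * N) : ℕ) : ℝ) ≤ 65536 * V := by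
      rw [Nat.cast_add, Nat.cast_add, Nat.cast_add]
      push_cast at hmN' ⊢
      linarith
    have h2 : ((2 + 3 * 2 ^ L + (T₀ + 3 * m * N) : ℕ) : ℝ) * 2 ^ 190 ≤ n := by
      rw [← hVn, hκ]
      linarith [mul_le_mul_of_nonneg_right h1 (by positivity : (0 : ℝ) ≤ 2 ^ 190)]
    exact_mod_cast h2
  · have h1 : ((2000 * (T₀ + 3 * m * N) : ℕ) : ℝ) ≤ n := by
      rw [Nat.cast_mul, Nat.cast_add]
      push_cast at hmN' ⊢
      linarith
    exact_mod_cast h1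
  · have h1 : n ≤ 2 * (m * s) := by
      have : s * (m + 18) ≤ s * (2 * m) := Nat.mul_le_mul_left s (by omega)
      have h2 : s * (m + 18) = s * (m + 17) + s := by ring
      have h3 : s * (2 * m) = 2 * (m * s) := by ring
      omega
    have h2 : (n : ℝ) ≤ 2 * (m * s) := by exact_mod_cast h1
    have h3 : ((#Va + #F : ℕ) : ℝ) ≤ ((m * s : ℕ) : ℝ) := by push_cast; linarith
    exact_mod_cast h3
  · have h1 : ((2 + m + 2 * (m * ν ^ 63) : ℕ) : ℝ) ≤ s := by
      push_cast
      rw [← hx_def]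
      have h2 : (m : ℝ) ≤ 2 * y ^ 8 := by rw [hy_def]; exact_mod_cast (by omega : m ≤ 2 * l ^ 8)
      have h3 : (1 : ℝ) ≤ m := by exact_mod_cast (by omega : 1 ≤ m)
      have h4 : (1 : ℝ) ≤ x ^ 63 := one_le_pow₀ (by linarith)
      have h5 : (m : ℝ) * 1 ≤ m * x ^ 63 := mul_le_mul_of_nonneg_left h4 (by linarith)
      have h6 : (m : ℝ) * x ^ 63 ≤ 2 * y ^ 8 * x ^ 63 := mul_le_mul_of_nonneg_right h2 (by linarith)
      have h7 : 20 * (y ^ 8 * x ^ 63) ≤ Z := by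
        rw [hZ, le_div_iff₀ (by positivity)]
        have h8 : 20 * y ^ 16 ≤ x := by
          have : y ^ 16 * 20 ≤ y ^ 16 * y ^ 14 :=
            mul_le_mul_of_nonneg_left (le_trans (by linarith) (le_self_pow₀ (by linarith : 1 ≤ y) (by norm_num : 14 ≠ 0))) (by positivity)
          linarith [show y ^ 16 * y ^ 14 = y ^ 30 by ring]
        calc 20 * (y ^ 8 * x ^ 63) * y ^ 8 = 20 * y ^ 16 * x ^ 63 := by ring
          _ ≤ x * x ^ 63 := mul_le_mul_of_nonneg_right h8 (by positivity)
          _ = x ^ 64 := by ring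
          _ ≤ n := hnr
      linarith
    exact_mod_cast h1

end Numerics

theorem exists_forall_pow_le_two_pow (d : ℕ) (K : ℝ) : ∃ l₀ : ℕ, ∀ l ≥ l₀, K ≤ l ∧ l ^ d ≤ 2 ^ l := by
  have h1 : ∀ᶠ l : ℕ in Filter.atTop, K ≤ l := tendsto_natCast_atTop_atTop.eventually_ge_atTop K
  have h2 : ∀ᶠ l : ℕ in Filter.atTop, (l : ℝ) ^ d / 2 ^ l < 1 :=
    (tendsto_pow_const_div_const_pow_of_one_lt d one_lt_two).eventually_lt_const one_pos
  obtain ⟨l₀, h⟩ := Filter.eventually_atTop.1 (h1.and h2)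
  refine ⟨l₀, fun l hl => ⟨(h l hl).1, ?_⟩⟩
  have h3 := (h l hl).2
  rw [div_lt_one (by positivity)] at h3
  exact_mod_cast h3.le

/-- High-girth case of the Friedlander–Gordon–Tannenbaum conjecture: for sufficiently
large abelian groups `G` of order `n` satisfying the Hall–Paige condition, and any
`k ≥ (log n)⁹` dividing `n - 1`, there is a permutation `σ` of `G \ {0}` all of whose
cycles have length exactly `k` such that `v ↦ v - σ v` is a bijection of `G \ {0}` onto
itself. -/
theorem fgt_high_girth :
    ∃ N : ℕ, ∀ (G : Type) [AddCommGroup G] [Fintype G] [DecidableEq G],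
      N ≤ Fintype.card G →
      (∑ g : G, g) = 0 →
      ∀ k : ℕ, (Real.log (Fintype.card G)) ^ 9 ≤ (k : ℝ) → k ∣ Fintype.card G - 1 →
      ∃ σ : Equiv.Perm G,
        σ.support = Finset.univ.erase 0 ∧
        (∀ c ∈ σ.cycleType, c = k) ∧
        Set.BijOn (fun v : G => v - σ v) {v : G | v ≠ 0} {v : G | v ≠ 0} := by
  obtain ⟨l₀, hl₀⟩ := exists_forall_pow_le_two_pow (30 * 64) (2 ^ 1700)
  refine ⟨2 ^ l₀, fun G _ _ _ hN hsum k hk hkn => ?_⟩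
  have hn0 : Fintype.card G ≠ 0 := Fintype.card_ne_zero
  have hl : l₀ ≤ Nat.log 2 (Fintype.card G) := Nat.le_log_of_pow_le (by norm_num) hN
  have hln : 2 ^ Nat.log 2 (Fintype.card G) ≤ Fintype.card G := Nat.pow_log_le_self 2 hn0
  have hnl : Fintype.card G < 2 ^ (Nat.log 2 (Fintype.card G) + 1) := Nat.lt_pow_succ_log_self (by norm_num) _
  obtain ⟨hK, hpow⟩ := hl₀ _ hl
  generalize Nat.log 2 (Fintype.card G) = l at *
  have hl9 : (10 ^ 9 : ℝ) ≤ l := by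
    refine le_trans ?_ hK
    calc (10 ^ 9 : ℝ) ≤ 2 ^ 100 := by norm_num
      _ ≤ 2 ^ 1700 := pow_le_pow_right₀ (by norm_num) (by norm_num)
  have hl9' : 10 ^ 9 ≤ l := by exact_mod_cast hl9
  obtain ⟨ν, h1, h2, h3⟩ := exists_root (n := Fintype.card G) (a := l ^ 30)
    (le_trans (by omega) (Nat.le_self_pow (by norm_num) l)) (by rw [← pow_mul]; exact hpow.trans hln)
  refine exists_perm_of_large hsum hK h1 hnl h2 h3 ?_ hkn
  have hlog : (l : ℝ) / 2 ≤ Real.log (Fintype.card G) := by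
    have h4 : (2 : ℝ) ^ l ≤ Fintype.card G := by exact_mod_cast hln
    have h5 := Real.log_le_log (by positivity) h4
    rw [Real.log_pow] at h5
    have h6 : (l : ℝ) * (1 / 2) ≤ l * Real.log 2 := mul_le_mul_of_nonneg_left (by linarith [Real.log_two_gt_d9]) (by positivity)
    linarith
  have h7 : (l : ℝ) ^ 8 ≤ k := by
    refine le_trans ?_ ((pow_le_pow_left₀ (by positivity) hlog 9).trans hk)
    have h8 : (l : ℝ) ^ 8 * 512 ≤ l ^ 8 * l := mul_le_mul_of_nonneg_left (le_trans (by norm_num) hl9) (by positivity)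
    linarith [show ((l : ℝ) / 2) ^ 9 = l ^ 8 * l / 512 by ring]
  exact_mod_cast h7
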